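/- arXiv:2602.11840 — 4 statements merged into one kernel-verified Lean document; each statement's English description precedes it below -/
import Mathlib

section
/- There exists a constant C > 0 such that for all integers n ≥ 1 and w ≥ 1 with w < n, there is a simple graph U on n vertices with at most (19/(6·ln 3))·(w+1)·n·ln(n/w) + C·n·w edges that contains every graph with at most n vertices and treewidth at most w as a subgraph (up to isomorphism). Consequently, s_w(n) ≤ (19/(6·ln 3))·(w+1)·n·ln(n/w) + O(n·w) uniformly in w. -/
/-- `(T, B)` is a tree-decomposition of the graph `G`: `T` is a (finite) tree, every
vertex of `G` lies in some bag, every edge of `G` has both endpoints in a common bag,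
and for each vertex of `G` the set of tree-vertices whose bag contains it induces a
connected subgraph (subtree) of `T`. -/
def IsTreeDecomp {V ι : Type} (G : SimpleGraph V) (T : SimpleGraph ι)
    (B : ι → Finset V) : Prop :=
  T.IsTree ∧
  (∀ v : V, ∃ x : ι, v ∈ B x) ∧
  (∀ u v : V, G.Adj u v → ∃ x : ι, u ∈ B x ∧ v ∈ B x) ∧
  (∀ v : V, (T.induce {x : ι | v ∈ B x}).Connected)

/-- The treewidth of `G` is at most `w`: there is a tree-decomposition all of whose
bags have size at most `w + 1`. -/
def TreewidthLE {V : Type} (G : SimpleGraph V) (w : ℕ) : Prop :=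
  ∃ (ι : Type) (_ : Fintype ι) (T : SimpleGraph ι) (B : ι → Finset V),
    IsTreeDecomp G T B ∧ ∀ x : ι, (B x).card ≤ w + 1

/-- `U` contains a copy of `H` as a subgraph (up to isomorphism):
there is an injective map preserving adjacency. -/
def Contains {α β : Type} (U : SimpleGraph α) (H : SimpleGraph β) : Prop :=
  ∃ f : β → α, Function.Injective f ∧ ∀ u v : β, H.Adj u v → U.Adj (f u) (f v)


/-- Step relation for the counts. -/
def StepOK (A B x y : ℕ) : Prop :=
  2 * x ≤ max A B ∧ 2 * y ≤ max A B ∧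
    (x + y + min x y ≤ min A B ∨ (2 * (x + y) ≤ max A B ∧ max A B < 2 * min A B))

theorem greedy_labels (s : ℕ → ℕ) (B : ℕ) (T : Finset ℕ) :
    ∀ a : ℕ, a < B → B ≤ a + ∑ t ∈ T, s t →
      ∃ R1 ⊆ T, ∃ t ∈ T, t ∉ R1 ∧ a + ∑ t ∈ R1, s t < B ∧ B ≤ a + ∑ t ∈ R1, s t + s t := by
  induction T using Finset.induction_on with
  | empty => intro a h1 h2; simp at h2; omega
  | insert e T he ih =>
    intro a h1 h2
    rw [Finset.sum_insert he] at h2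
    by_cases h : B ≤ a + s e
    · exact ⟨∅, by simp, e, by simp, by simp, by simpa using h1, by simpa using h⟩
    · obtain ⟨R1, hR, t, ht, htR, h3, h4⟩ := ih (a + s e) (by omega) (by omega)
      have heR : e ∉ R1 := fun h => he (hR h)
      refine ⟨insert e R1, Finset.insert_subset_insert _ hR, t, by simp [ht], ?_, ?_, ?_⟩
      · simp only [Finset.mem_insert, not_or]
        exact ⟨fun h => he (h ▸ ht), htR⟩
      · rw [Finset.sum_insert heR]; omega
      · rw [Finset.sum_insert heR]; omega

/-- purely numeric version: choose label sets for the right part and the middle part. -/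
theorem numeric_split (s : ℕ → ℕ) (Λ : Finset ℕ) (h0 : 0 ∈ Λ) (h1 : 1 ∈ Λ) (h2 : 2 ∈ Λ)
    (A u B : ℕ) (hBA : B ≤ A)
    (htot : ∑ t ∈ Λ, s t = A + u + B) (hs0 : s 0 ≤ A + u)
    (hs : ∀ t ∈ Λ, t ≠ 0 → s t ≤ B + u) :
    ∃ LR LY LL : Finset ℕ, Disjoint LR LY ∧ Disjoint LR LL ∧ Disjoint LY LL ∧
      LR ∪ LY ∪ LL = Λ ∧
      ∑ t ∈ LL, s t ≤ A + u ∧ ∑ t ∈ LR, s t ≤ B + u ∧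
      (LY = ∅ ∨ (∑ t ∈ LR, s t ≤ B ∧
        (∑ t ∈ LL, s t ≤ A → StepOK A B (A - ∑ t ∈ LL, s t) (B - ∑ t ∈ LR, s t)))) := by
  classical
  have hne : (Λ.erase 0).Nonempty := ⟨1, by simp [h1]⟩
  obtain ⟨c1, hc1, hmax1⟩ := Finset.exists_max_image (Λ.erase 0) s hne
  have hc1Λ : c1 ∈ Λ := (Finset.mem_erase.1 hc1).2
  have hc10 : c1 ≠ 0 := (Finset.mem_erase.1 hc1).1
  have hsum1 : s c1 + ∑ t ∈ Λ.erase c1, s t = A + u + B := by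
    rw [Finset.add_sum_erase _ _ hc1Λ, htot]
  by_cases hb : B ≤ s c1
  · refine ⟨{c1}, ∅, Λ.erase c1, by simp, by simp, by simp, ?_, by omega, ?_, Or.inl rfl⟩
    · ext t; simp only [Finset.union_empty, Finset.mem_union, Finset.mem_singleton, Finset.mem_erase]
      by_cases t = c1 <;> simp_all
    · simpa using hs c1 hc1Λ hc10
  push Not at hb
  have hne2 : ((Λ.erase 0).erase c1).Nonempty := by
    by_cases h : c1 = 1
    · exact ⟨2, by simp [h, h2]⟩
    · exact ⟨1, by simp [Ne.symm h, h1]⟩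
  obtain ⟨c2, hc2, hmax2⟩ := Finset.exists_max_image ((Λ.erase 0).erase c1) s hne2
  have hc21 : c2 ≠ c1 := (Finset.mem_erase.1 hc2).1
  have hc2' := (Finset.mem_erase.1 hc2).2
  have hc20 : c2 ≠ 0 := (Finset.mem_erase.1 hc2').1
  have hc2Λ : c2 ∈ Λ := (Finset.mem_erase.1 hc2').2
  have h21 : s c2 ≤ s c1 := hmax1 c2 hc2'
  have hc2e : c2 ∈ Λ.erase c1 := by simp [hc21, hc2Λ]
  have hsum2 : s c1 + (s c2 + ∑ t ∈ (Λ.erase c1).erase c2, s t) = A + u + B := by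
    rw [Finset.add_sum_erase _ _ hc2e, hsum1]
  by_cases hb2 : B ≤ s c1 + s c2
  · by_cases hx : 2 * (s c1 + s c2 - B - u) ≤ A
    · refine ⟨{c1}, {c2}, (Λ.erase c1).erase c2, by simp [hc21.symm], by simp, by simp, ?_,
        by omega, by simp; omega, Or.inr ⟨by simp; omega, ?_⟩⟩
      · ext t; simp only [Finset.mem_union, Finset.mem_singleton, Finset.mem_erase]
        by_cases t = c1 <;> by_cases t = c2 <;> simp_all
      · intro hl
        simp only [Finset.sum_singleton]
        unfold StepOK
        rw [max_eq_left hBA, min_eq_right hBA]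
        refine ⟨by omega, by omega, Or.inl ?_⟩
        have := min_le_right (A - ∑ t ∈ (Λ.erase c1).erase c2, s t) (B - s c1)
        omega
    · refine ⟨{c1}, (Λ.erase c1).erase c2, {c2}, by simp, by simp [hc21.symm], by simp, ?_,
        by simp; omega, by simp; omega, Or.inr ⟨by simp; omega, ?_⟩⟩
      · ext t; simp only [Finset.mem_union, Finset.mem_singleton, Finset.mem_erase]
        by_cases t = c1 <;> by_cases t = c2 <;> simp_all
      · intro hl
        simp only [Finset.sum_singleton] at hl ⊢
        unfold StepOK
        rw [max_eq_left hBA, min_eq_right hBA]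
        refine ⟨by omega, by omega, Or.inr ⟨by omega, by omega⟩⟩
  push Not at hb2
  have h0m : (0:ℕ) ∈ (Λ.erase c1).erase c2 := by simp [hc10.symm, hc20.symm, h0]
  have hsum3 : s c1 + (s c2 + (s 0 + ∑ t ∈ ((Λ.erase c1).erase c2).erase 0, s t)) = A + u + B := by
    rw [Finset.add_sum_erase _ _ h0m, hsum2]
  obtain ⟨R1, hR, t, ht, htR, h3, h4⟩ := greedy_labels s B (((Λ.erase c1).erase c2).erase 0)
    (s c1 + s c2) hb2 (by omega)
  have ht2 : s t ≤ s c2 := by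
    apply hmax2
    simp only [Finset.mem_erase] at ht ⊢
    tauto
  have hc1R : c1 ∉ insert c2 R1 := by
    simp only [Finset.mem_insert, not_or]
    exact ⟨hc21.symm, fun h => by simpa using hR h⟩
  have hc2R : c2 ∉ R1 := fun h => by simpa using hR h
  have hRΛ : insert c1 (insert c2 R1) ⊆ Λ := by
    intro e he
    simp only [Finset.mem_insert] at he
    rcases he with rfl | rfl | he
    · exact hc1Λ
    · exact hc2Λ
    · have := hR he; simp only [Finset.mem_erase] at this; tauto
  have htΛ : t ∈ Λ := by simp only [Finset.mem_erase] at ht; tauto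
  have htn : t ∉ insert c1 (insert c2 R1) := by
    simp only [Finset.mem_erase] at ht
    simp only [Finset.mem_insert]; tauto
  have hRs : ∑ e ∈ insert c1 (insert c2 R1), s e = s c1 + s c2 + ∑ e ∈ R1, s e := by
    rw [Finset.sum_insert hc1R, Finset.sum_insert hc2R]; ring
  have hts : t ∈ Λ \ insert c1 (insert c2 R1) := by simp only [Finset.mem_sdiff]; exact ⟨htΛ, htn⟩
  have hLs : ∑ e ∈ (Λ \ insert c1 (insert c2 R1)).erase t, s e + s t
      + ∑ e ∈ insert c1 (insert c2 R1), s e = A + u + B := by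
    rw [Finset.sum_erase_add _ _ hts, Finset.sum_sdiff hRΛ, htot]
  refine ⟨insert c1 (insert c2 R1), {t}, (Λ \ insert c1 (insert c2 R1)).erase t,
    by simpa using htn, ?_, by simp, ?_, by omega, by omega, Or.inr ⟨by omega, ?_⟩⟩
  · exact Finset.disjoint_of_subset_right (Finset.erase_subset _ _) Finset.disjoint_sdiff
  · ext e
    simp only [Finset.mem_union, Finset.mem_singleton, Finset.mem_erase, Finset.mem_sdiff]
    constructor
    · rintro ((h | rfl) | h)
      · exact hRΛ h
      · exact htΛ
      · exact h.2.1
    · intro h; by_cases e ∈ insert c1 (insert c2 R1) <;> by_cases e = t <;> tauto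
  · intro hl
    unfold StepOK
    rw [max_eq_left hBA, min_eq_right hBA]
    have := min_le_right (A - ∑ e ∈ (Λ \ insert c1 (insert c2 R1)).erase t, s e)
      (B - ∑ e ∈ insert c1 (insert c2 R1), s e)
    refine ⟨by omega, by omega, Or.inl (by omega)⟩

/-- Separator property of a graph. -/
def SepProp {V : Type} [DecidableEq V] (H : SimpleGraph V) (k : ℕ) : Prop :=
  ∀ (X : Finset V) (m : ℕ), 2 ≤ m → m ≤ X.card →
    ∃ S ⊆ X, S.card ≤ k ∧ ∃ lab : V → ℕ,
      (∀ u ∈ X \ S, ∀ v ∈ X \ S, H.Adj u v → lab u = lab v) ∧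
      ((X \ S).filter (fun v => lab v = 0)).card + m ≤ X.card ∧
      ∀ t, t ≠ 0 → ((X \ S).filter (fun v => lab v = t)).card < m

theorem vertex_split_aux {V : Type} [DecidableEq V] (H : SimpleGraph V) (k : ℕ) (hk : 2 ≤ k)
    (hS : SepProp H k) (X : Finset V) (A u B : ℕ) (hBA : B ≤ A) (hu : k ≤ u)
    (hX : X.card = k + (A + u + B)) :
    ∃ S XL Y XR : Finset V, S ∪ (XL ∪ (Y ∪ XR)) = X ∧ S.card = k ∧
      Disjoint S (XL ∪ (Y ∪ XR)) ∧ Disjoint XL (Y ∪ XR) ∧ Disjoint Y XR ∧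
      (∀ a ∈ XL, ∀ b ∈ Y ∪ XR, ¬ H.Adj a b) ∧ (∀ a ∈ Y, ∀ b ∈ XR, ¬ H.Adj a b) ∧
      XL.card ≤ A + u ∧ XR.card ≤ B + u ∧
      (Y = ∅ ∨ (XL.card ≤ A → XR.card ≤ B → StepOK A B (A - XL.card) (B - XR.card))) := by
  obtain ⟨S0, hS0X, hS0k, lab, hadj, h0, ht⟩ := hS X (B + k) (by omega) (by omega)
  obtain ⟨S, hS0S, hSX, hSk⟩ := Finset.exists_subsuperset_card_eq hS0X hS0k (by omega : k ≤ X.card)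
  have hsub : X \ S ⊆ X \ S0 := Finset.sdiff_subset_sdiff le_rfl hS0S
  have hcard : (X \ S).card = A + u + B := by
    rw [Finset.card_sdiff_of_subset hSX]; omega
  set s : ℕ → ℕ := fun t => ((X \ S).filter (fun v => lab v = t)).card with hs
  have hsle : ∀ t, s t ≤ ((X \ S0).filter (fun v => lab v = t)).card := fun t =>
    Finset.card_le_card (Finset.filter_subset_filter _ hsub)
  set Λ : Finset ℕ := (X \ S).image lab ∪ {0, 1, 2} with hΛ
  have hfib : ∀ L : Finset ℕ, ((X \ S).filter (fun v => lab v ∈ L)).card = ∑ t ∈ L, s t := by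
    intro L
    rw [Finset.card_eq_sum_card_fiberwise (f := lab) (t := L)]
    · apply Finset.sum_congr rfl
      intro t htL
      rw [Finset.filter_filter]
      simp only [hs]
      congr 1
      ext v
      simp only [Finset.mem_filter]
      constructor
      · rintro ⟨h1, h2, h3⟩; exact ⟨h1, h3⟩
      · rintro ⟨h1, h3⟩; exact ⟨h1, h3 ▸ htL, h3⟩
    · intro v hv
      simp only [Finset.coe_filter, Set.mem_ofPred_eq] at hv
      exact hv.2
  have hall : (X \ S).filter (fun v => lab v ∈ Λ) = X \ S := by
    apply Finset.filter_true_of_mem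
    intro v hv
    simp only [hΛ, Finset.mem_union, Finset.mem_image]
    exact Or.inl ⟨v, hv, rfl⟩
  have htot : ∑ t ∈ Λ, s t = A + u + B := by rw [← hfib, hall, hcard]
  obtain ⟨LR, LY, LL, d1, d2, d3, hun, hl, hr, hy⟩ := numeric_split s Λ (by simp [hΛ]) (by simp [hΛ])
    (by simp [hΛ]) A u B hBA htot (by have := hsle 0; omega)
    (fun t _ h => by have := hsle t; have := ht t h; omega)
  have hdis : ∀ L1 L2 : Finset ℕ, Disjoint L1 L2 → ∀ a ∈ (X \ S).filter (fun v => lab v ∈ L1),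
      ∀ b ∈ (X \ S).filter (fun v => lab v ∈ L2), a ≠ b ∧ ¬ H.Adj a b := by
    intro L1 L2 hd a ha b hb
    rw [Finset.mem_filter] at ha hb
    have hne : lab a ≠ lab b := by
      intro h
      exact Finset.disjoint_left.1 hd ha.2 (h ▸ hb.2)
    exact ⟨fun h => hne (by rw [h]), fun h => hne (hadj a (hsub ha.1) b (hsub hb.1) h)⟩
  have hU : (X \ S).filter (fun v => lab v ∈ LL) ∪ ((X \ S).filter (fun v => lab v ∈ LY) ∪
      (X \ S).filter (fun v => lab v ∈ LR)) = X \ S := by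
    rw [← hall, ← hun]
    ext v
    simp only [Finset.mem_union, Finset.mem_filter]
    tauto
  refine ⟨S, (X \ S).filter (fun v => lab v ∈ LL), (X \ S).filter (fun v => lab v ∈ LY),
    (X \ S).filter (fun v => lab v ∈ LR), ?_, hSk, ?_, ?_, ?_, ?_, ?_, ?_, ?_, ?_⟩
  · rw [hU]; exact Finset.union_sdiff_of_subset hSX
  · rw [hU]; exact Finset.disjoint_sdiff
  · rw [Finset.disjoint_left]
    intro a ha hb
    rw [Finset.mem_union] at hb
    rcases hb with hb | hb
    · exact (hdis LL LY d3.symm a ha a hb).1 rfl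
    · exact (hdis LL LR d2.symm a ha a hb).1 rfl
  · rw [Finset.disjoint_left]
    intro a ha hb
    exact (hdis LY LR d1.symm a ha a hb).1 rfl
  · intro a ha b hb
    rw [Finset.mem_union] at hb
    rcases hb with hb | hb
    · exact (hdis LL LY d3.symm a ha b hb).2
    · exact (hdis LL LR d2.symm a ha b hb).2
  · intro a ha b hb
    exact (hdis LY LR d1.symm a ha b hb).2
  · rw [hfib]; exact hl
  · rw [hfib]; exact hr
  · rw [hfib, hfib]
    rcases hy with rfl | hy
    · left; simp
    · right; intro h _; exact hy.2 h

theorem vertex_split {V : Type} [DecidableEq V] (H : SimpleGraph V) (k : ℕ) (hk : 2 ≤ k)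
    (hS : SepProp H k) (X : Finset V) (A u B : ℕ) (hu : k ≤ u)
    (hX : X.card = k + (A + u + B)) :
    ∃ S XL Y XR : Finset V, S ∪ (XL ∪ (Y ∪ XR)) = X ∧ S.card = k ∧
      Disjoint S (XL ∪ (Y ∪ XR)) ∧ Disjoint XL (Y ∪ XR) ∧ Disjoint Y XR ∧
      (∀ a ∈ XL, ∀ b ∈ Y ∪ XR, ¬ H.Adj a b) ∧ (∀ a ∈ Y, ∀ b ∈ XR, ¬ H.Adj a b) ∧
      XL.card ≤ A + u ∧ XR.card ≤ B + u ∧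
      (Y = ∅ ∨ (XL.card ≤ A → XR.card ≤ B → StepOK A B (A - XL.card) (B - XR.card))) := by
  rcases le_total B A with h | h
  · exact vertex_split_aux H k hk hS X A u B h hu hX
  · obtain ⟨S, XL, Y, XR, h1, h2, h3, h4, h5, h6, h7, h8, h9, h10⟩ :=
      vertex_split_aux H k hk hS X B u A h hu (by omega)
    have e : XR ∪ (Y ∪ XL) = XL ∪ (Y ∪ XR) := by
      ext v; simp only [Finset.mem_union]; tauto
    refine ⟨S, XR, Y, XL, by rw [e]; exact h1, h2, by rw [e]; exact h3, ?_, ?_, ?_, ?_, h9, h8, ?_⟩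
    · rw [Finset.disjoint_union_right] at h4 ⊢
      exact ⟨h5.symm, h4.2.symm⟩
    · rw [Finset.disjoint_union_right] at h4; exact h4.1.symm
    · intro a ha b hb hab
      rw [Finset.mem_union] at hb
      rcases hb with hb | hb
      · exact h7 b hb a ha hab.symm
      · exact h6 b hb a (Finset.mem_union_right _ ha) hab.symm
    · intro a ha b hb hab
      exact h6 b hb a (Finset.mem_union_left _ ha) hab.symm
    · rcases h10 with h10 | h10
      · exact Or.inl h10
      · right
        intro hl hr
        have := h10 hr hl
        unfold StepOK at this ⊢
        rw [max_comm A B, min_comm A B, min_comm (A - _), add_comm (A - _)]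
        tauto

/-- divisors for the covering radii. -/
def dv (j : ℕ) : ℕ := if j ≤ 2 then 2 ^ j else if j < 7 then 3 * 2 ^ (j - 1) else 2 ^ j

theorem dv_ge (j : ℕ) : 2 ^ j ≤ dv j := by
  unfold dv
  split_ifs with h1 h2
  · exact le_rfl
  · obtain ⟨t, rfl⟩ : ∃ t, j = t + 1 := ⟨j - 1, by omega⟩
    simp only [Nat.add_sub_cancel, pow_succ]; omega
  · exact le_rfl

theorem dv_pos (j : ℕ) : 0 < dv j := lt_of_lt_of_le (by positivity) (dv_ge j)

theorem dv_succ (j : ℕ) (hj : 3 ≤ j) : dv (j + 1) ≤ 2 * dv j := by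
  rcases Nat.lt_or_ge j 7 with h | h
  · interval_cases j <;> decide
  · unfold dv
    rw [if_neg (by omega), if_neg (by omega), if_neg (by omega), if_neg (by omega), pow_succ]
    omega

/-- the invariant on the counts in phase `j`. -/
def Cnt (N j A B : ℕ) : Prop :=
  max A B * dv j ≤ N ∧ (j = 1 → max A B + 2 * min A B ≤ N) ∧
    (j = 2 → 6 * min (max A B) (2 * min A B) ≤ N)

theorem Cnt.mono {N j A B A' B' : ℕ} (h : Cnt N j A B) (hA : A' ≤ A) (hB : B' ≤ B) :
    Cnt N j A' B' := by
  obtain ⟨h1, h2, h3⟩ := h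
  refine ⟨le_trans (Nat.mul_le_mul_right _ (by omega)) h1, fun hj => ?_, fun hj => ?_⟩
  · have := h2 hj; omega
  · have := h3 hj; omega

theorem Cnt.step {N j A B x y : ℕ} (h : Cnt N j A B) (hs : StepOK A B x y) :
    Cnt N (j + 1) x y := by
  obtain ⟨h1, h2, h3⟩ := h
  obtain ⟨s1, s2, s3⟩ := hs
  rcases Nat.lt_or_ge j 3 with hj | hj
  · interval_cases j
    · simp only [dv] at h1
      refine ⟨?_, fun _ => ?_, fun hj => by omega⟩
      · simp [dv] at h1 ⊢; omega
      · norm_num at h1; omega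
    · simp [dv] at h1 h2
      refine ⟨?_, fun hj => by omega, fun _ => ?_⟩
      · simp [dv]; omega
      · omega
    · simp at h3
      refine ⟨?_, fun hj => by omega, fun hj => by omega⟩
      simp only [dv]; norm_num; omega
  · refine ⟨?_, fun hj => by omega, fun hj => by omega⟩
    have hm : 2 * max x y ≤ max A B := by omega
    calc max x y * dv (j + 1) ≤ max x y * (2 * dv j) := Nat.mul_le_mul_left _ (dv_succ j hj)
      _ = (2 * max x y) * dv j := by ring
      _ ≤ max A B * dv j := Nat.mul_le_mul_right _ hm
      _ ≤ N := h1

/-- Covering relation between positions. -/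
def Cov (k L q q' : ℕ) : Prop :=
  (∃ R c j, q / L = 2 ^ R * (2 * c + 1) ∧ j < 7 ∧ q % L / k = j ∧
      q' / L ≤ q / L + (2 ^ R / dv j + 2) ∧ q / L ≤ q' / L + (2 ^ R / dv j + 2)) ∨
  (∃ r c, q / L = 2 ^ (r + 8) * c + 2 ^ r ∧ q % L / k = 7 ∧
      q' / L ≤ q / L + (3 * 2 ^ r + 3) ∧ q / L ≤ q' / L + (3 * 2 ^ r + 3)) ∨
  (∃ r c, q / L + 2 ^ r = 2 ^ (r + 8) * c ∧ q % L / k = 8 ∧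
      q' / L ≤ q / L + (3 * 2 ^ r + 3) ∧ q / L ≤ q' / L + (3 * 2 ^ r + 3))

def NearQ (L q q' : ℕ) : Prop := q / L ≤ q' / L + 20 ∧ q' / L ≤ q / L + 20

/-- adjacency in the universal graph -/
def UAdj (k L q q' : ℕ) : Prop :=
  q ≠ q' ∧ (NearQ L q q' ∨ Cov k L q q' ∨ Cov k L q' q)

theorem UAdj.symm {k L q q' : ℕ} (h : UAdj k L q q') : UAdj k L q' q := by
  obtain ⟨h1, h2⟩ := h
  refine ⟨h1.symm, ?_⟩
  unfold NearQ at *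
  tauto

/-- `H[X]` embeds in positions `F`. -/
def Emb {V : Type} (H : SimpleGraph V) (k L : ℕ) (X : Finset V) (F : Finset ℕ) : Prop :=
  ∃ f : V → ℕ, (∀ x ∈ X, f x ∈ F) ∧ (∀ x ∈ X, ∀ y ∈ X, f x = f y → x = y) ∧
    ∀ x ∈ X, ∀ y ∈ X, H.Adj x y → UAdj k L (f x) (f y)

theorem Emb.mono {V : Type} {H : SimpleGraph V} {k L : ℕ} {X : Finset V} {F F' : Finset ℕ}
    (h : Emb H k L X F) (hF : F ⊆ F') : Emb H k L X F' := by
  obtain ⟨f, h1, h2, h3⟩ := h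
  exact ⟨f, fun x hx => hF (h1 x hx), h2, h3⟩

theorem Emb.empty {V : Type} (H : SimpleGraph V) (k L : ℕ) (F : Finset ℕ) :
    Emb H k L ∅ F := ⟨fun _ => 0, by simp, by simp, by simp⟩

theorem Emb.union {V : Type} [DecidableEq V] {H : SimpleGraph V} {k L : ℕ} {X1 X2 : Finset V}
    {F1 F2 : Finset ℕ} (h1 : Emb H k L X1 F1) (h2 : Emb H k L X2 F2)
    (hF : Disjoint F1 F2) (hX : Disjoint X1 X2) (hE : ∀ a ∈ X1, ∀ b ∈ X2, ¬ H.Adj a b) :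
    Emb H k L (X1 ∪ X2) (F1 ∪ F2) := by
  obtain ⟨f, f1, f2, f3⟩ := h1
  obtain ⟨g, g1, g2, g3⟩ := h2
  have hn : ∀ x ∈ X2, x ∉ X1 := fun x hx hx' => Finset.disjoint_left.1 hX hx' hx
  refine ⟨fun x => if x ∈ X1 then f x else g x, ?_, ?_, ?_⟩
  · intro x hx
    rcases Finset.mem_union.1 hx with h | h
    · simp [h, f1 x h]
    · simp [hn x h, g1 x h]
  · intro x hx y hy
    rcases Finset.mem_union.1 hx with h | h <;> rcases Finset.mem_union.1 hy with h' | h'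
    · simp only [h, h', if_true]; exact f2 x h y h'
    · simp only [h, hn y h', if_true, if_false]
      intro e; exact absurd (g1 y h') (Finset.disjoint_left.1 hF (e ▸ f1 x h))
    · simp only [h', hn x h, if_true, if_false]
      intro e; exact absurd (g1 x h) (Finset.disjoint_left.1 hF (e ▸ f1 y h'))
    · simp only [hn x h, hn y h', if_false]; exact g2 x h y h'
  · intro x hx y hy ha
    rcases Finset.mem_union.1 hx with h | h <;> rcases Finset.mem_union.1 hy with h' | h'
    · simp only [h, h', if_true]; exact f3 x h y h' ha
    · exact absurd ha (hE x h y h')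
    · exact absurd ha.symm (hE y h' x h)
    · simp only [hn x h, hn y h', if_false]; exact g3 x h y h' ha

theorem exists_inj {V : Type} [DecidableEq V] (S : Finset V) (K : Finset ℕ) (h : S.card ≤ K.card) :
    ∃ e : V → ℕ, (∀ x ∈ S, e x ∈ K) ∧ ∀ x ∈ S, ∀ y ∈ S, e x = e y → x = y := by
  obtain ⟨e⟩ : Nonempty (S ↪ K) := by
    apply Function.Embedding.nonempty_of_card_le; simpa using h
  refine ⟨fun x => if hx : x ∈ S then (e ⟨x, hx⟩ : ℕ) else 0, ?_, ?_⟩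
  · intro x hx; simp [hx]
  · intro x hx y hy h
    simp only [hx, hy, dif_pos] at h
    have := e.injective (Subtype.ext h)
    simpa using this

theorem Emb.addSep {V : Type} [DecidableEq V] {H : SimpleGraph V} {k L : ℕ} {S X1 : Finset V}
    {K F1 : Finset ℕ} (h1 : Emb H k L X1 F1) (hc : S.card ≤ K.card)
    (hK : Disjoint K F1) (hX : Disjoint S X1)
    (hcov : ∀ q ∈ K, ∀ q' ∈ K ∪ F1, NearQ L q q' ∨ Cov k L q q' ∨ Cov k L q' q) :
    Emb H k L (S ∪ X1) (K ∪ F1) := by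
  obtain ⟨g, g1, g2, g3⟩ := h1
  obtain ⟨f, f1, f2⟩ := exists_inj S K hc
  have hn : ∀ x ∈ X1, x ∉ S := fun x hx hx' => Finset.disjoint_left.1 hX hx' hx
  refine ⟨fun x => if x ∈ S then f x else g x, ?_, ?_, ?_⟩
  · intro x hx
    rcases Finset.mem_union.1 hx with h | h
    · simp [h, f1 x h]
    · simp [hn x h, g1 x h]
  · intro x hx y hy
    rcases Finset.mem_union.1 hx with h | h <;> rcases Finset.mem_union.1 hy with h' | h'
    · simp only [h, h', if_true]; exact f2 x h y h'
    · simp only [h, hn y h', if_true, if_false]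
      intro e; exact absurd (g1 y h') (Finset.disjoint_left.1 hK (e ▸ f1 x h))
    · simp only [h', hn x h, if_true, if_false]
      intro e; exact absurd (g1 x h) (Finset.disjoint_left.1 hK (e ▸ f1 y h'))
    · simp only [hn x h, hn y h', if_false]; exact g2 x h y h'
  · intro x hx y hy ha
    rcases Finset.mem_union.1 hx with h | h <;> rcases Finset.mem_union.1 hy with h' | h'
    · simp only [h, h', if_true]
      exact ⟨fun e => ha.ne (f2 x h y h' e), hcov _ (f1 x h) _ (Finset.mem_union_left _ (f1 y h'))⟩
    · simp only [h, hn y h', if_true, if_false]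
      exact ⟨fun e => (Finset.disjoint_left.1 hK (f1 x h)) (e ▸ g1 y h'),
        hcov _ (f1 x h) _ (Finset.mem_union_right _ (g1 y h'))⟩
    · simp only [h', hn x h, if_true, if_false]
      apply UAdj.symm
      exact ⟨fun e => (Finset.disjoint_left.1 hK (f1 y h')) (e ▸ g1 x h),
        hcov _ (f1 y h') _ (Finset.mem_union_right _ (g1 x h))⟩
    · simp only [hn x h, hn y h', if_false]; exact g3 x h y h' ha

theorem Emb.leaf {V : Type} [DecidableEq V] {H : SimpleGraph V} {k L : ℕ} (hL : 0 < L)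
    {X : Finset V} {F : Finset ℕ} (a b : ℕ) (hF : F ⊆ Finset.Ico a b) (hab : b ≤ a + 20 * L)
    (hc : X.card ≤ F.card) : Emb H k L X F := by
  obtain ⟨f, f1, f2⟩ := exists_inj X F hc
  refine ⟨f, f1, f2, fun x hx y hy ha => ⟨fun e => ha.ne (f2 x hx y hy e), Or.inl ?_⟩⟩
  have key : ∀ q q', a ≤ q → q < b → a ≤ q' → q' < b → q / L ≤ q' / L + 20 := by
    intro q q' h1 h2 h3 h4
    have : q ≤ q' + 20 * L := by omega
    calc q / L ≤ (q' + 20 * L) / L := Nat.div_le_div_right this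
      _ = q' / L + 20 := by rw [Nat.add_mul_div_right _ _ hL]
  have hx' := Finset.mem_Ico.1 (hF (f1 x hx))
  have hy' := Finset.mem_Ico.1 (hF (f1 y hy))
  exact ⟨key _ _ hx'.1 hx'.2 hy'.1 hy'.2, key _ _ hy'.1 hy'.2 hx'.1 hx'.2⟩

theorem cut_exists (F : Finset ℕ) (lo hi v : ℕ) (hl : lo ≤ hi)
    (h1 : (F.filter (· < lo)).card ≤ v) (h2 : v ≤ (F.filter (· < hi)).card) :
    ∃ t, lo ≤ t ∧ t ≤ hi ∧ (F.filter (· < t)).card = v := by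
  induction hi, hl using Nat.le_induction with
  | base => exact ⟨lo, le_rfl, le_rfl, le_antisymm h1 h2⟩
  | succ hi hl ih =>
    by_cases h : v ≤ (F.filter (· < hi)).card
    · obtain ⟨t, a, b, c⟩ := ih h
      exact ⟨t, a, by omega, c⟩
    · refine ⟨hi + 1, by omega, le_rfl, le_antisymm ?_ h2⟩
      have : F.filter (· < hi + 1) ⊆ insert hi (F.filter (· < hi)) := by
        intro x hx
        simp only [Finset.mem_filter, Finset.mem_insert] at hx ⊢
        rcases Nat.lt_or_ge x hi with h | h
        · exact Or.inr ⟨hx.1, h⟩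
        · left; omega
      have := Finset.card_le_card this
      have := Finset.card_insert_le hi (F.filter (· < hi))
      omega

theorem block_iff {k L : ℕ} (hk : 0 < k) (hL : L = 10 * k) (q u s : ℕ) (hs : s < 10) :
    (q / L = u ∧ q % L / k = s) ↔ (u * L + s * k ≤ q ∧ q < u * L + s * k + k) := by
  have hL0 : 0 < L := by omega
  have hd := Nat.div_add_mod q L
  have hm := Nat.mod_lt q hL0
  have hsk : s * k + k ≤ L := by
    have : (s + 1) * k ≤ 10 * k := Nat.mul_le_mul_right _ (by omega)
    rw [hL]; nlinarith
  constructor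
  · rintro ⟨rfl, h2⟩
    rw [Nat.div_eq_iff hk] at h2
    rw [mul_comm] at hd
    omega
  · rintro ⟨h1, h2⟩
    have h3 : q / L = u := by
      rw [Nat.div_eq_iff hL0]; omega
    refine ⟨h3, ?_⟩
    rw [h3, mul_comm] at hd
    rw [Nat.div_eq_iff hk]; omega

theorem pow_cmp (r R : ℕ) :
    (r < R ∧ 2 * 2 ^ r ≤ 2 ^ R) ∨ r = R ∨ (R < r ∧ 2 * 2 ^ R ≤ 2 ^ r) := by
  rcases lt_trichotomy r R with h | h | h
  · left; refine ⟨h, ?_⟩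
    calc 2 * 2 ^ r = 2 ^ (r + 1) := by ring
      _ ≤ 2 ^ R := Nat.pow_le_pow_right (by norm_num) h
  · exact Or.inr (Or.inl h)
  · right; right; refine ⟨h, ?_⟩
    calc 2 * 2 ^ R = 2 ^ (R + 1) := by ring
      _ ≤ 2 ^ r := Nat.pow_le_pow_right (by norm_num) h

/-- positions reserved for the node `p`. -/
def Rsv (k L q p : ℕ) : Prop :=
  q / L = p ∨ (q % L / k = 7 ∧ ∃ r, q / L = p + 2 ^ r ∧ 2 ^ (r + 1) ∣ p) ∨
    (q % L / k = 8 ∧ ∃ r, q / L + 2 ^ r = p ∧ 2 ^ (r + 1) ∣ p)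

/-- positions of node `i` (level `R`) already used before phase `j`. -/
def Used (k L R j q i : ℕ) : Prop :=
  (q / L = i ∧ q % L / k < j ∧ q % L / k < 7) ∨
    (q % L / k = 7 ∧ ∃ r, r + 8 ≤ R ∧ R < r + 1 + j ∧ q / L = i + 2 ^ r) ∨
    (q % L / k = 8 ∧ ∃ r, r + 8 ≤ R ∧ R < r + 1 + j ∧ q / L + 2 ^ r = i)

theorem Used.rsv {k L R j q i : ℕ} (h : Used k L R j q i) (hi : 2 ^ R ∣ i) : Rsv k L q i := by
  rcases h with ⟨h, -⟩ | ⟨h, r, h1, -, h2⟩ | ⟨h, r, h1, -, h2⟩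
  · exact Or.inl h
  · exact Or.inr (Or.inl ⟨h, r, h2, (pow_dvd_pow 2 (by omega)).trans hi⟩)
  · exact Or.inr (Or.inr ⟨h, r, h2, (pow_dvd_pow 2 (by omega)).trans hi⟩)

theorem Used.succ {k L R j q i : ℕ} (h : Used k L R j q i) : Used k L R (j + 1) q i := by
  rcases h with ⟨h, h1, h2⟩ | ⟨h, r, h1, h3, h2⟩ | ⟨h, r, h1, h3, h2⟩
  · exact Or.inl ⟨h, by omega, h2⟩
  · exact Or.inr (Or.inl ⟨h, r, h1, by omega, h2⟩)
  · exact Or.inr (Or.inr ⟨h, r, h1, by omega, h2⟩)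

structure Clean (k L R P a b : ℕ) (F : Finset ℕ) : Prop where
  dvd : 2 ^ (R + 1) ∣ P
  sub : F ⊆ Finset.Ico a b
  ha : P * L ≤ a
  hb : b ≤ (P + 2 * 2 ^ R + 1) * L
  gap : ∀ q, a ≤ q → q < b → q ∉ F → Rsv k L q P ∨ Rsv k L q (P + 2 * 2 ^ R)

structure Chain (k L R P j a b : ℕ) (F : Finset ℕ) : Prop where
  dvd : 2 ^ (R + 1) ∣ P
  sub : F ⊆ Finset.Ico a b
  ha : P * L ≤ a
  hb : b ≤ (P + 2 * 2 ^ R + 1) * L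
  ha' : a ≤ (P + 2 ^ R) * L
  hb' : (P + 2 ^ R + 1) * L ≤ b
  gap : ∀ q, a ≤ q → q < b → q ∉ F →
    Rsv k L q P ∨ Rsv k L q (P + 2 * 2 ^ R) ∨ Used k L R j q (P + 2 ^ R)
  cnt : Cnt (2 ^ R * L) j (F.filter (· < (P + 2 ^ R) * L)).card
    (F.filter ((P + 2 ^ R + 1) * L ≤ ·)).card
  hj : j + 3 ≤ R

theorem half_left {k L R P a b : ℕ} {F : Finset ℕ} (hL : 0 < L) (dvd : 2 ^ (R + 1 + 1) ∣ P)
    (sub : F ⊆ Finset.Ico a b) (ha : P * L ≤ a) (hb : b ≤ (P + 2 ^ (R + 1) + 1) * L)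
    (gap : ∀ q, a ≤ q → q < b → q ∉ F → Rsv k L q P ∨ Rsv k L q (P + 2 * 2 ^ (R + 1)) ∨
      Rsv k L q (P + 2 ^ (R + 1))) : Clean k L R P a b F := by
  have e : 2 * 2 ^ R = 2 ^ (R + 1) := by ring
  refine ⟨(pow_dvd_pow 2 (by omega)).trans dvd, sub, ha, by rw [e]; exact hb, ?_⟩
  intro q h1 h2 h3
  rw [e]
  have u1 : P ≤ q / L := by rw [Nat.le_div_iff_mul_le hL]; omega
  have u2 : q / L < P + 2 ^ (R + 1) + 1 := by rw [Nat.div_lt_iff_lt_mul hL]; omega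
  have hp : 0 < 2 ^ (R + 1) := by positivity
  rcases gap q h1 h2 h3 with h | h | h
  · exact Or.inl h
  · rcases h with h | ⟨h, r, h4, h5⟩ | ⟨h, r, h4, h5⟩
    · omega
    · omega
    · rcases pow_cmp r (R + 1) with ⟨c1, c2⟩ | c | ⟨c1, c2⟩
      · have : 0 < 2 ^ r := by positivity
        omega
      · subst c; right; left; omega
      · left; left; omega
  · exact Or.inr h

theorem half_right {k L R P a b : ℕ} {F : Finset ℕ} (hL : 0 < L) (dvd : 2 ^ (R + 1 + 1) ∣ P)
    (sub : F ⊆ Finset.Ico a b) (ha : (P + 2 ^ (R + 1)) * L ≤ a)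
    (hb : b ≤ (P + 2 * 2 ^ (R + 1) + 1) * L)
    (gap : ∀ q, a ≤ q → q < b → q ∉ F → Rsv k L q P ∨ Rsv k L q (P + 2 * 2 ^ (R + 1)) ∨
      Rsv k L q (P + 2 ^ (R + 1))) : Clean k L R (P + 2 ^ (R + 1)) a b F := by
  have e : P + 2 ^ (R + 1) + 2 * 2 ^ R = P + 2 * 2 ^ (R + 1) := by ring
  refine ⟨dvd_add ((pow_dvd_pow 2 (by omega)).trans dvd) dvd_rfl, sub, ha,
    by rw [e]; exact hb, ?_⟩
  intro q h1 h2 h3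
  rw [e]
  have u1 : P + 2 ^ (R + 1) ≤ q / L := by rw [Nat.le_div_iff_mul_le hL]; omega
  have u2 : q / L < P + 2 * 2 ^ (R + 1) + 1 := by rw [Nat.div_lt_iff_lt_mul hL]; omega
  have hp : 0 < 2 ^ (R + 1) := by positivity
  rcases gap q h1 h2 h3 with h | h | h
  · rcases h with h | ⟨h, r, h4, h5⟩ | ⟨h, r, h4, h5⟩
    · omega
    · rcases pow_cmp r (R + 1) with ⟨c1, c2⟩ | c | ⟨c1, c2⟩
      · have : 0 < 2 ^ r := by positivity
        omega
      · subst c; left; left; omega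
      · right; left; omega
    · have : 0 < 2 ^ r := by positivity
      omega
  · exact Or.inr h
  · exact Or.inl h

theorem side_left {F : Finset ℕ} {a i L z : ℕ} (hL : 0 < L) (hz : 8 ≤ z)
    (hA : (F.filter (· < i * L)).card ≤ z * L) 
    (gap : ∀ q, a ≤ q → q < i * L → q ∉ F → q / L + z = i ∨ 2 * (q / L) + 3 * z ≤ 2 * i) :
    i * L ≤ a + (F.filter (· < i * L)).card + L := by
  by_contra hcon
  push Not at hcon
  set A := (F.filter (· < i * L)).card with hAdef
  have hsub : Finset.Ico (i * L - (A + L + 1)) (i * L) ⊆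
      F.filter (· < i * L) ∪ Finset.Ico ((i - z) * L) ((i - z) * L + L) := by
    intro q hq
    rw [Finset.mem_Ico] at hq
    rw [Finset.mem_union, Finset.mem_filter, Finset.mem_Ico]
    by_cases hqF : q ∈ F
    · exact Or.inl ⟨hqF, hq.2⟩
    · right
      rcases gap q (by omega) hq.2 hqF with h | h
      · have : i - z = q / L := by rw [← h, Nat.add_sub_cancel]
        rw [this]
        exact ⟨Nat.div_mul_le_self q L, by
          have := Nat.div_add_mod q L; have := Nat.mod_lt q hL; rw [mul_comm]; omega⟩
      · exfalso
        have h1 : q < (q / L + 1) * L := by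
          have := Nat.div_add_mod q L; have := Nat.mod_lt q hL; rw [add_mul, mul_comm]; omega
        have h2 : (q / L + 1) + z + 3 ≤ i := by omega
        have h3 : ((q / L + 1) + z + 3) * L ≤ i * L := Nat.mul_le_mul_right _ h2
        have h4 : (q / L + 1 + z + 3) * L = (q / L + 1) * L + z * L + 3 * L := by ring
        omega
  have h1 := Finset.card_le_card hsub
  have h2 := Finset.card_union_le (F.filter (· < i * L)) (Finset.Ico ((i - z) * L) ((i - z) * L + L))
  rw [Nat.card_Ico] at h1
  rw [Nat.card_Ico] at h2
  omega

theorem side_right {F : Finset ℕ} {b i L z : ℕ} (hL : 0 < L) (hz : 8 ≤ z)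
    (hB : (F.filter ((i + 1) * L ≤ ·)).card ≤ z * L) 
    (gap : ∀ q, (i + 1) * L ≤ q → q < b → q ∉ F → i + z = q / L ∨ 2 * i + 3 * z ≤ 2 * (q / L)) :
    b ≤ (i + 1) * L + (F.filter ((i + 1) * L ≤ ·)).card + L := by
  by_contra hcon
  push Not at hcon
  set B := (F.filter ((i + 1) * L ≤ ·)).card with hBdef
  have hsub : Finset.Ico ((i + 1) * L) ((i + 1) * L + B + L + 1) ⊆
      F.filter ((i + 1) * L ≤ ·) ∪ Finset.Ico ((i + z) * L) ((i + z) * L + L) := by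
    intro q hq
    rw [Finset.mem_Ico] at hq
    rw [Finset.mem_union, Finset.mem_filter, Finset.mem_Ico]
    by_cases hqF : q ∈ F
    · exact Or.inl ⟨hqF, hq.1⟩
    · right
      rcases gap q hq.1 (by omega) hqF with h | h
      · rw [h]
        exact ⟨Nat.div_mul_le_self q L, by
          have := Nat.div_add_mod q L; have := Nat.mod_lt q hL; rw [mul_comm]; omega⟩
      · exfalso
        have h1 := Nat.div_mul_le_self q L
        have h2 : (i + 1) + z + 3 ≤ q / L := by omega
        have h3 : ((i + 1) + z + 3) * L ≤ q / L * L := Nat.mul_le_mul_right _ h2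
        have h4 : ((i + 1) + z + 3) * L = (i + 1) * L + z * L + 3 * L := by ring
        omega
  have h1 := Finset.card_le_card hsub
  have h2 := Finset.card_union_le (F.filter ((i + 1) * L ≤ ·))
    (Finset.Ico ((i + z) * L) ((i + z) * L + L))
  rw [Nat.card_Ico] at h1
  rw [Nat.card_Ico] at h2
  omega

/-- The gaps of a chain state outside unit `i` are far away. -/
theorem gap_dist {k L R P j q z : ℕ} (hj : 1 ≤ j) (hjR : j + 3 ≤ R) (hz : z * 2 ^ j = 2 ^ R)
    (u1 : P ≤ q / L) (u2 : q / L ≤ P + 2 * 2 ^ R) (hne : q / L ≠ P + 2 ^ R)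
    (h : Rsv k L q P ∨ Rsv k L q (P + 2 * 2 ^ R) ∨ Used k L R j q (P + 2 ^ R)) :
    q / L + z = P + 2 ^ R ∨ P + 2 ^ R + z = q / L ∨ 2 * (q / L) + 3 * z ≤ 2 * (P + 2 ^ R) ∨
      2 * (P + 2 ^ R) + 3 * z ≤ 2 * (q / L) := by
  have hz' : z = 2 ^ (R - j) := by
    have : 2 ^ (R - j) * 2 ^ j = 2 ^ R := by rw [← pow_add]; congr 1; omega
    exact Nat.eq_of_mul_eq_mul_right (by positivity) (hz.trans this.symm)
  have hzz : 2 * z = 2 ^ (R - j + 1) := by rw [hz']; ring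
  have hzR : 2 * z ≤ 2 ^ R := by
    rw [hzz]; exact Nat.pow_le_pow_right (by norm_num) (by omega)
  have hDpos : 0 < 2 ^ R := by positivity
  -- generic facts on powers
  have key1 : ∀ r, r < R → 2 ^ r = 2 ^ R - z ∨ 2 ^ R - 2 ^ r = z ∨ 2 * 2 ^ r + 3 * z ≤ 2 * 2 ^ R := by
    intro r hr
    obtain ⟨R', rfl⟩ : ∃ R', R = R' + 1 := ⟨R - 1, by omega⟩
    have eD : 2 ^ (R' + 1) = 2 * 2 ^ R' := by ring
    rcases Nat.lt_or_ge 1 j with h1 | h1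
    · have : 2 * z ≤ 2 ^ R' := by
        rw [hzz]; exact Nat.pow_le_pow_right (by norm_num) (by omega)
      have : 2 ^ r ≤ 2 ^ R' := Nat.pow_le_pow_right (by norm_num) (by omega)
      omega
    · have : j = 1 := by omega
      subst this
      have : z = 2 ^ R' := by rw [hz']; congr 1
      rcases pow_cmp r R' with ⟨c1, c2⟩ | c | ⟨c1, c2⟩
      · omega
      · subst c; omega
      · omega
  have key2 : ∀ r, R < r + 1 + j → 2 ^ r = z ∨ 2 * z ≤ 2 ^ r := by
    intro r hr
    rcases pow_cmp r (R - j) with ⟨c1, c2⟩ | c | ⟨c1, c2⟩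
    · omega
    · left; rw [hz', c]
    · right; rw [hz']; exact c2
  rcases h with h | h | h
  · rcases h with h | ⟨h, r, h4, h5⟩ | ⟨h, r, h4, h5⟩
    · omega
    · rcases pow_cmp r R with ⟨c1, c2⟩ | c | ⟨c1, c2⟩
      · rcases key1 r c1 with h | h | h <;> omega
      · subst c; omega
      · omega
    · have : 0 < 2 ^ r := by positivity
      omega
  · rcases h with h | ⟨h, r, h4, h5⟩ | ⟨h, r, h4, h5⟩
    · omega
    · have : 0 < 2 ^ r := by positivity
      omega
    · rcases pow_cmp r R with ⟨c1, c2⟩ | c | ⟨c1, c2⟩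
      · rcases key1 r c1 with h | h | h <;> omega
      · subst c; omega
      · omega
  · rcases h with ⟨h, h1, h2⟩ | ⟨h, r, h1, h3, h2⟩ | ⟨h, r, h1, h3, h2⟩
    · exact absurd h hne
    · rcases key2 r h3 with h | h <;> omega
    · rcases key2 r h3 with h | h <;> omega

theorem card_split (G : Finset ℕ) (s t : ℕ) (h : s ≤ t) :
    (G.filter (· < s)).card + (G.filter (fun q => s ≤ q ∧ q < t)).card
      = (G.filter (· < t)).card := by
  rw [← Finset.card_union_of_disjoint]
  · congr 1; ext q; simp only [Finset.mem_union, Finset.mem_filter]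
    constructor
    · rintro (h | h) <;> exact ⟨h.1, by omega⟩
    · rintro ⟨h1, h2⟩
      rcases Nat.lt_or_ge q s with h | h
      · exact Or.inl ⟨h1, h⟩
      · exact Or.inr ⟨h1, h, h2⟩
  · rw [Finset.disjoint_left]; intro q h1 h2
    simp only [Finset.mem_filter] at h1 h2; omega

theorem card_split' (G : Finset ℕ) (t : ℕ) :
    (G.filter (· < t)).card + (G.filter (t ≤ ·)).card = G.card := by
  rw [← Finset.card_union_of_disjoint]
  · congr 1; ext q; simp only [Finset.mem_union, Finset.mem_filter]
    constructor
    · rintro (h | h) <;> exact h.1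
    · intro h1
      rcases Nat.lt_or_ge q t with h | h
      · exact Or.inl ⟨h1, h⟩
      · exact Or.inr ⟨h1, h⟩
  · rw [Finset.disjoint_left]; intro q h1 h2
    simp only [Finset.mem_filter] at h1 h2; omega

/-- All states with `s` positions can be embedded. -/
def GoodClean {V : Type} (H : SimpleGraph V) (k L s : ℕ) : Prop :=
  ∀ (R P a b : ℕ) (F : Finset ℕ) (X : Finset V), F.card = s → X.card = s →
    Clean k L R P a b F → Emb H k L X F

def GoodChain {V : Type} (H : SimpleGraph V) (k L s : ℕ) : Prop :=
  ∀ (j R P a b : ℕ) (F : Finset ℕ) (X : Finset V), F.card = s → X.card = s →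
    Chain k L R P j a b F → Emb H k L X F

theorem chain_core {V : Type} [DecidableEq V] (H : SimpleGraph V) {k L : ℕ} (hk : 2 ≤ k)
    (hL : L = 10 * k) (hS : SepProp H k) {R P j a b : ℕ} {F : Finset ℕ} {X : Finset V}
    (hIH : ∀ s < F.card, GoodClean H k L s ∧ GoodChain H k L s)
    (hC : Chain k L R P j a b F) (hX : X.card = F.card) (hj4 : j + 4 ≤ R)
    (K : Finset ℕ) (hKF : K ⊆ F) (hKc : K.card = k)
    (hKU : ∀ q ∈ K, Used k L R (j + 1) q (P + 2 ^ R))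
    (hKcov : ∀ q ∈ K, ∀ q' ∈ F, Cov k L q q') : Emb H k L X F := by
  obtain ⟨R', rfl⟩ : ∃ R', R = R' + 1 := ⟨R - 1, by omega⟩
  have hk0 : 0 < k := by omega
  have hL0 : 0 < L := by omega
  have hD : 0 < 2 ^ (R' + 1) := by positivity
  obtain ⟨dvd, sub, ha, hb, ha', hb', gap, cnt, hj⟩ := hC
  set i := P + 2 ^ (R' + 1) with hi
  have hiL : (i + 1) * L = i * L + L := by ring
  set G := F \ K with hG
  have hGF : G ⊆ F := Finset.sdiff_subset
  have hGc : G.card + k = F.card := by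
    rw [hG, ← hKc]; exact Finset.card_sdiff_add_card_eq_card hKF
  have hGsub : G ⊆ Finset.Ico a b := hGF.trans sub
  have hgapG : ∀ q, a ≤ q → q < b → q ∉ G →
      Rsv k L q P ∨ Rsv k L q (P + 2 * 2 ^ (R' + 1)) ∨ Used k L (R' + 1) (j + 1) q i := by
    intro q h1 h2 h3
    by_cases hq : q ∈ K
    · exact Or.inr (Or.inr (hKU q hq))
    · have : q ∉ F := fun h => h3 (by rw [hG]; exact Finset.mem_sdiff.2 ⟨h, hq⟩)
      rcases gap q h1 h2 this with h | h | h
      · exact Or.inl h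
      · exact Or.inr (Or.inl h)
      · exact Or.inr (Or.inr h.succ)
  have hidvd : 2 ^ (R' + 1) ∣ i := dvd_add ((pow_dvd_pow 2 (by omega)).trans dvd) dvd_rfl
  have hgapG' : ∀ q, a ≤ q → q < b → q ∉ G →
      Rsv k L q P ∨ Rsv k L q (P + 2 * 2 ^ (R' + 1)) ∨ Rsv k L q i := by
    intro q h1 h2 h3
    rcases hgapG q h1 h2 h3 with h | h | h
    · exact Or.inl h
    · exact Or.inr (Or.inl h)
    · exact Or.inr (Or.inr (h.rsv hidvd))
  have hslot9 : Finset.Ico (i * L + 9 * k) (i * L + 9 * k + k) ⊆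
      G.filter (fun q => i * L ≤ q ∧ q < (i + 1) * L) := by
    intro q hq
    rw [Finset.mem_Ico] at hq
    rw [Finset.mem_filter]
    obtain ⟨h1, h2⟩ := (block_iff hk0 hL q i 9 (by norm_num)).2 hq
    refine ⟨?_, by omega, by omega⟩
    by_contra hqG
    rcases hgapG q (by omega) (by omega) hqG with h | h | h
    · rcases h with h | h | h
      · omega
      · omega
      · omega
    · rcases h with h | h | h
      · omega
      · omega
      · omega
    · rcases h with h | h | h
      · omega
      · omega
      · omega
  have hu9 := Finset.card_le_card hslot9
  rw [Nat.card_Ico] at hu9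
  -- counts
  set A := (G.filter (· < i * L)).card with hA
  set B := (G.filter ((i + 1) * L ≤ ·)).card with hB
  set u := (G.filter (fun q => i * L ≤ q ∧ q < (i + 1) * L)).card with hu
  have hAu : A + u = (G.filter (· < (i + 1) * L)).card := card_split G _ _ (by omega)
  have hAuB : A + u + B = G.card := by rw [hAu]; exact card_split' G _
  have cntG : Cnt (2 ^ (R' + 1) * L) j A B :=
    cnt.mono (Finset.card_le_card (Finset.filter_subset_filter _ hGF))
      (Finset.card_le_card (Finset.filter_subset_filter _ hGF))
  obtain ⟨S, XL, Y, XR, e1, e2, e3, e4, e5, e6, e7, e8, e9, e10⟩ :=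
    vertex_split H k hk hS X A u B (by omega) (by omega)
  have hXcard : XL.card + Y.card + XR.card = G.card := by
    have h1 := Finset.card_union_of_disjoint e3
    have h2 := Finset.card_union_of_disjoint e4
    have h3 := Finset.card_union_of_disjoint e5
    rw [e1] at h1; omega
  -- cuts
  have hga : (G.filter (· < a)).card = 0 := by
    rw [Finset.card_eq_zero, Finset.filter_eq_empty_iff]
    intro q hq; have := Finset.mem_Ico.1 (hGsub hq); omega
  have hgb : (G.filter (· < b)).card = G.card := by
    rw [Finset.filter_true_of_mem]
    intro q hq; have := Finset.mem_Ico.1 (hGsub hq); omega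
  obtain ⟨s, hs1, hs2, hs3⟩ := cut_exists G a ((i + 1) * L) XL.card (by omega) (by omega) (by omega)
  obtain ⟨s', hs1', hs2', hs3'⟩ := cut_exists G (max s (i * L)) b (XL.card + Y.card) (by omega)
    (by rcases le_total s (i * L) with h | h
        · rw [max_eq_right h]; omega
        · rw [max_eq_left h]; omega) (by omega)
  have hm1 : s ≤ s' := (le_max_left _ _).trans hs1'
  have hm2 : i * L ≤ s' := (le_max_right _ _).trans hs1'
  clear hs1'
  set FL := G.filter (· < s) with hFL
  set FY := G.filter (fun q => s ≤ q ∧ q < s') with hFY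
  set FR := G.filter (s' ≤ ·) with hFR
  have cFY : XL.card + FY.card = XL.card + Y.card := by
    rw [← hs3', ← hs3]; exact card_split G s s' (by omega)
  have cFR : XL.card + Y.card + FR.card = G.card := by
    rw [← hs3']; exact card_split' G s'
  have EL : Emb H k L XL FL := by
    refine (hIH FL.card (by omega)).1 R' P a s FL XL rfl hs3.symm ?_
    apply half_left hL0 dvd _ ha hs2
    · intro q h1 h2 h3
      refine hgapG' q h1 (by omega) (fun h => h3 ?_)
      rw [hFL, Finset.mem_filter]; exact ⟨h, h2⟩
    · intro q hq
      rw [hFL, Finset.mem_filter] at hq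
      have := Finset.mem_Ico.1 (hGsub hq.1)
      rw [Finset.mem_Ico]; omega
  have ER : Emb H k L XR FR := by
    refine (hIH FR.card (by omega)).1 R' i s' b FR XR rfl (by omega) ?_
    apply half_right hL0 dvd _ (show i * L ≤ s' from hm2) hb
    · intro q h1 h2 h3
      refine hgapG' q (by omega) h2 (fun h => h3 ?_)
      rw [hFR, Finset.mem_filter]; exact ⟨h, h1⟩
    · intro q hq
      rw [hFR, Finset.mem_filter] at hq
      have := Finset.mem_Ico.1 (hGsub hq.1)
      rw [Finset.mem_Ico]; omega
  have hFYsub : FY ⊆ Finset.Ico s s' := by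
    intro q hq
    rw [hFY, Finset.mem_filter] at hq
    rw [Finset.mem_Ico]; omega
  have hgapY : ∀ q, s ≤ q → q < s' → q ∉ FY → q ∉ G := by
    intro q h1 h2 h3 h
    apply h3
    rw [hFY, Finset.mem_filter]; exact ⟨h, h1, h2⟩
  have EY : Emb H k L Y FY := by
    rcases e10 with hY | hstep
    · rw [hY]; exact Emb.empty H k L FY
    by_cases hin : s ≤ i * L ∧ (i + 1) * L ≤ s'
    · have c1 := card_split G s (i * L) hin.1
      rw [← hFL, ← hA] at c1
      have c2 := card_split G ((i + 1) * L) s' hin.2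
      refine (hIH FY.card (by omega)).2 (j + 1) (R' + 1) P s s' FY Y rfl (by omega) ?_
      refine ⟨dvd, hFYsub, by omega, by omega, hin.1, hin.2, ?_, ?_, by omega⟩
      · intro q h1 h2 h3
        exact hgapG q (by omega) (by omega) (hgapY q h1 h2 h3)
      · have f1 : FY.filter (· < i * L) = G.filter (fun q => s ≤ q ∧ q < i * L) := by
          ext q; rw [hFY]; simp only [Finset.mem_filter]; 
          constructor
          · rintro ⟨⟨h1, h2⟩, h3⟩; exact ⟨h1, h2.1, h3⟩
          · rintro ⟨h1, h2, h3⟩; exact ⟨⟨h1, h2, by omega⟩, h3⟩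
        have f2 : FY.filter ((i + 1) * L ≤ ·) = G.filter (fun q => (i + 1) * L ≤ q ∧ q < s') := by
          ext q; rw [hFY]; simp only [Finset.mem_filter]; 
          constructor
          · rintro ⟨⟨h1, h2⟩, h3⟩; exact ⟨h1, h3, h2.2⟩
          · rintro ⟨h1, h2, h3⟩; exact ⟨⟨h1, by omega, h3⟩, h2⟩
        have n1 : XL.card ≤ A := by omega
        have n2 : XR.card ≤ B := by omega
        have := cntG.step (hstep n1 n2)
        change Cnt _ _ (FY.filter (· < i * L)).card (FY.filter ((i + 1) * L ≤ ·)).card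
        rw [f1, f2]
        exact this.mono (by omega) (by omega)
    · rcases Nat.lt_or_ge (i * L) s with h | h
      · refine (hIH FY.card (by omega)).1 R' i s s' FY Y rfl (by omega) ?_
        apply half_right hL0 dvd hFYsub (show i * L ≤ s by omega) (by omega)
        intro q h1 h2 h3
        exact hgapG' q (by omega) (by omega) (hgapY q h1 h2 h3)
      · refine (hIH FY.card (by omega)).1 R' P s s' FY Y rfl (by omega) ?_
        apply half_left hL0 dvd hFYsub (by omega) (show s' ≤ (i + 1) * L by omega)
        intro q h1 h2 h3
        exact hgapG' q (by omega) (by omega) (hgapY q h1 h2 h3)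
  have dYR : Disjoint FY FR := by
    rw [Finset.disjoint_left]; intro q h1 h2
    rw [hFY, Finset.mem_filter] at h1
    rw [hFR, Finset.mem_filter] at h2
    omega
  have dL : Disjoint FL (FY ∪ FR) := by
    rw [Finset.disjoint_left]; intro q h1 h2
    rw [hFL, Finset.mem_filter] at h1
    rw [Finset.mem_union, hFY, hFR, Finset.mem_filter, Finset.mem_filter] at h2
    omega
  have hsubG : FL ∪ (FY ∪ FR) ⊆ G := by
    intro q hq
    simp only [Finset.mem_union, hFL, hFY, hFR, Finset.mem_filter] at hq
    tauto
  have E1 := EL.union (EY.union ER dYR e5 e7) dL e4 e6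
  have E2 := E1.mono hsubG
  have dK : Disjoint K G := by rw [hG]; exact Finset.disjoint_sdiff
  have hKG : K ∪ G = F := by rw [hG]; exact Finset.union_sdiff_of_subset hKF
  have E3 := E2.addSep (S := S) (K := K) (by omega) dK e3 (by
    intro q hq q' hq'
    rw [hKG] at hq'
    exact Or.inr (Or.inl (hKcov q hq q' hq')))
  rw [e1, hKG] at E3
  exact E3

theorem chain_pos {k L R P j a b : ℕ} {F : Finset ℕ} (hL : 0 < L) (hj1 : 1 ≤ j)
    (hC : Chain k L R P j a b F) :
    (P + 2 ^ R) * L ≤ a + (F.filter (· < (P + 2 ^ R) * L)).card + L ∧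
    b ≤ (P + 2 ^ R + 1) * L + (F.filter ((P + 2 ^ R + 1) * L ≤ ·)).card + L ∧
    (F.filter (· < (P + 2 ^ R) * L)).card ≤ 2 ^ (R - j) * L ∧
    (F.filter ((P + 2 ^ R + 1) * L ≤ ·)).card ≤ 2 ^ (R - j) * L := by
  obtain ⟨dvd, sub, ha, hb, ha', hb', gap, cnt, hj⟩ := hC
  have hz : 2 ^ (R - j) * 2 ^ j = 2 ^ R := by rw [← pow_add]; congr 1; omega
  have hz8 : 8 ≤ 2 ^ (R - j) := by
    calc 8 = 2 ^ 3 := by norm_num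
      _ ≤ 2 ^ (R - j) := Nat.pow_le_pow_right (by norm_num) (by omega)
  have hcnt := cnt.1
  have hmax : max (F.filter (· < (P + 2 ^ R) * L)).card
      (F.filter ((P + 2 ^ R + 1) * L ≤ ·)).card ≤ 2 ^ (R - j) * L := by
    have h1 := (Nat.mul_le_mul_left (max (F.filter (· < (P + 2 ^ R) * L)).card
      (F.filter ((P + 2 ^ R + 1) * L ≤ ·)).card) (dv_ge j)).trans hcnt
    exact Nat.le_of_mul_le_mul_right (h1.trans (le_of_eq (by rw [← hz]; ring)))
      (show 0 < 2 ^ j by positivity)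
  have hA := (le_max_left _ _).trans hmax
  have hB := (le_max_right _ _).trans hmax
  have hgd : ∀ q, a ≤ q → q < b → q ∉ F → q / L ≠ P + 2 ^ R → _ := fun q h1 h2 h3 h4 =>
    gap_dist hj1 hj hz (by rw [Nat.le_div_iff_mul_le hL]; omega)
      (Nat.lt_succ_iff.1 (by rw [Nat.div_lt_iff_lt_mul hL]; exact h2.trans_le hb)) h4 (gap q h1 h2 h3)
  refine ⟨side_left hL hz8 hA ?_, side_right hL hz8 hB ?_, hA, hB⟩
  · intro q h1 h2 h3
    have hlt : q / L < P + 2 ^ R := by rw [Nat.div_lt_iff_lt_mul hL]; exact h2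
    have : q < b := by
      have : (P + 2 ^ R + 1) * L = (P + 2 ^ R) * L + L := by ring
      omega
    rcases hgd q h1 this h3 hlt.ne with h | h | h | h <;> omega
  · intro q h1 h2 h3
    have hlt : P + 2 ^ R + 1 ≤ q / L := by rw [Nat.le_div_iff_mul_le hL]; exact h1
    have : a ≤ q := by
      have : (P + 2 ^ R + 1) * L = (P + 2 ^ R) * L + L := by ring
      omega
    rcases hgd q this h2 h3 (by omega) with h | h | h | h <;> omega

theorem chain_range {k L R P j a b : ℕ} {F : Finset ℕ} (hL : 0 < L)
    (hC : Chain k L R P j a b F) (q : ℕ) (hq : q ∈ F) :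
    q / L ≤ P + 2 ^ R + (2 ^ R / dv j + 2) ∧ P + 2 ^ R ≤ q / L + (2 ^ R / dv j + 2) := by
  have hq' := Finset.mem_Ico.1 (hC.sub hq)
  rcases Nat.eq_zero_or_pos j with h0 | h0
  · subst h0
    have h1 : P ≤ q / L := by rw [Nat.le_div_iff_mul_le hL]; have := hC.ha; omega
    have h2 : q / L < P + 2 * 2 ^ R + 1 := by
      rw [Nat.div_lt_iff_lt_mul hL]; have := hC.hb; omega
    have : dv 0 = 1 := rfl
    rw [this, Nat.div_one]; omega
  · obtain ⟨p1, p2, -, -⟩ := chain_pos hL h0 hC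
    have hcnt := hC.cnt.1
    set A := (F.filter (· < (P + 2 ^ R) * L)).card
    set B := (F.filter ((P + 2 ^ R + 1) * L ≤ ·)).card
    set d := 2 ^ R / dv j with hd
    have hdv := dv_pos j
    have hlt : 2 ^ R < (d + 1) * dv j := by
      rw [mul_comm]; exact Nat.lt_mul_div_succ _ hdv
    have hM : max A B < (d + 1) * L := by
      have : max A B * dv j < (d + 1) * L * dv j := by
        calc max A B * dv j ≤ 2 ^ R * L := hcnt
          _ < (d + 1) * dv j * L := Nat.mul_lt_mul_of_pos_right hlt hL
          _ = (d + 1) * L * dv j := by ring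
      exact Nat.lt_of_mul_lt_mul_right this
    have e1 : (d + 2) * L = (d + 1) * L + L := by ring
    constructor
    · apply Nat.lt_succ_iff.1
      rw [Nat.div_lt_iff_lt_mul hL]
      have : (P + 2 ^ R + (d + 2)).succ * L = (P + 2 ^ R + 1) * L + (d + 2) * L := by
        rw [Nat.succ_eq_add_one]; ring
      rw [this]; omega
    · rw [← Nat.add_mul_div_right _ _ hL, Nat.le_div_iff_mul_le hL]
      omega

theorem chain_leaf {k L R P j a b : ℕ} {F : Finset ℕ} (hL : 0 < L)
    (hC : Chain k L R P j a b F) (h : ¬ b ≤ a + 20 * L) : j + 4 ≤ R := by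
  by_contra hcon
  have hj := hC.hj
  have hR : R = j + 3 := by omega
  apply h
  rcases Nat.eq_zero_or_pos j with h0 | h0
  · subst h0
    subst hR
    have h1 := hC.ha
    have h2 := hC.hb
    have : (P + 2 * 2 ^ (0 + 3) + 1) * L = P * L + 17 * L := by ring
    omega
  · obtain ⟨p1, p2, p3, p4⟩ := chain_pos hL h0 hC
    have : R - j = 3 := by omega
    rw [this] at p3 p4
    have : (P + 2 ^ R + 1) * L = (P + 2 ^ R) * L + L := by ring
    omega

theorem chain_step {V : Type} [DecidableEq V] (H : SimpleGraph V) {k L : ℕ} (hk : 2 ≤ k)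
    (hL : L = 10 * k) (hS : SepProp H k) {R P j a b : ℕ} {F : Finset ℕ} {X : Finset V}
    (hIH : ∀ s < F.card, GoodClean H k L s ∧ GoodChain H k L s)
    (hC : Chain k L R P j a b F) (hX : X.card = F.card)
    (hnext : Chain k L R P (j + 1) a b F → Emb H k L X F) : Emb H k L X F := by
  have hk0 : 0 < k := by omega
  have hL0 : 0 < L := by omega
  by_cases hleaf : b ≤ a + 20 * L
  · exact Emb.leaf hL0 a b hC.sub hleaf hX.le
  have hj4 := chain_leaf hL0 hC hleaf
  have hrange := chain_range hL0 hC
  have hD : 0 < 2 ^ R := by positivity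
  obtain ⟨c, hc⟩ := hC.dvd
  have ha' := hC.ha'
  have hb' := hC.hb'
  have ha := hC.ha
  have hb := hC.hb
  have hiL : (P + 2 ^ R + 1) * L = (P + 2 ^ R) * L + L := by ring
  have hform : P + 2 ^ R = 2 ^ R * (2 * c + 1) := by rw [hc]; ring
  rcases Nat.lt_or_ge j 7 with hj7 | hj7
  · -- own slot
    have hblk : ∀ q ∈ Finset.Ico ((P + 2 ^ R) * L + j * k) ((P + 2 ^ R) * L + j * k + k),
        q / L = P + 2 ^ R ∧ q % L / k = j := fun q hq =>
      (block_iff hk0 hL q (P + 2 ^ R) j (by omega)).2 (Finset.mem_Ico.1 hq)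
    have hjk : j * k + k ≤ L := by
      have : (j + 1) * k ≤ 10 * k := Nat.mul_le_mul_right _ (by omega)
      rw [hL]; linarith
    refine chain_core H hk hL hS hIH hC hX hj4 (hKF := ?_) (hKc := by simp) (hKU := ?_) (hKcov := ?_) (K := Finset.Ico
      ((P + 2 ^ R) * L + j * k) ((P + 2 ^ R) * L + j * k + k))
    · intro q hq
      obtain ⟨h1, h2⟩ := hblk q hq
      rw [Finset.mem_Ico] at hq
      by_contra hqF
      rcases hC.gap q (by omega) (by omega) hqF with h | h | h
      · rcases h with h | h | h <;> omega
      · rcases h with h | h | h <;> omega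
      · rcases h with h | h | h <;> omega
    · intro q hq
      obtain ⟨h1, h2⟩ := hblk q hq
      exact Or.inl ⟨h1, by omega, by omega⟩
    · intro q hq q' hq'
      obtain ⟨h1, h2⟩ := hblk q hq
      obtain ⟨r1, r2⟩ := hrange q' hq'
      left
      exact ⟨R, c, j, by rw [h1, hform], hj7, h2, by rw [h1]; exact r1, by rw [h1]; exact r2⟩
  · obtain ⟨r, hr⟩ : ∃ r, R = r + 1 + j := ⟨R - j - 1, by omega⟩
    have hdv : dv j = 2 ^ j := by unfold dv; rw [if_neg (by omega), if_neg (by omega)]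
    have hd : 2 ^ R / dv j = 2 * 2 ^ r := by
      rw [hdv, hr, pow_add, Nat.mul_div_cancel _ (by positivity)]; ring
    rw [hd] at hrange
    have hrR : 2 * 2 ^ r ≤ 2 ^ R := by
      calc 2 * 2 ^ r = 2 ^ (r + 1) := by ring
        _ ≤ 2 ^ R := Nat.pow_le_pow_right (by norm_num) (by omega)
    have hrp : 0 < 2 ^ r := by positivity
    obtain ⟨c', hc'⟩ : 2 ^ (r + 8) ∣ P + 2 ^ R := by
      rw [hform]; exact Dvd.dvd.mul_right (pow_dvd_pow 2 (by omega)) _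
    by_cases hl : a + 2 ^ r * L ≤ (P + 2 ^ R) * L
    · -- left host
      have hun : (P + 2 ^ R - 2 ^ r) * L + 2 ^ r * L = (P + 2 ^ R) * L := by
        rw [← add_mul]; congr 1; omega
      have hLr : L ≤ 2 ^ r * L := Nat.le_mul_of_pos_left _ hrp
      have hblk : ∀ q ∈ Finset.Ico ((P + 2 ^ R - 2 ^ r) * L + 8 * k)
          ((P + 2 ^ R - 2 ^ r) * L + 8 * k + k),
          q / L = P + 2 ^ R - 2 ^ r ∧ q % L / k = 8 := fun q hq =>
        (block_iff hk0 hL q _ 8 (by omega)).2 (Finset.mem_Ico.1 hq)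
      refine chain_core H hk hL hS hIH hC hX hj4 (hKF := ?_) (hKc := by simp) (hKU := ?_) (hKcov := ?_) (K := Finset.Ico
        ((P + 2 ^ R - 2 ^ r) * L + 8 * k) ((P + 2 ^ R - 2 ^ r) * L + 8 * k + k))
      · intro q hq
        obtain ⟨h1, h2⟩ := hblk q hq
        rw [Finset.mem_Ico] at hq
        by_contra hqF
        rcases hC.gap q (by omega) (by omega) hqF with h | h | h
        · rcases h with h | h | ⟨h, t, h3, h4⟩ <;> omega
        · rcases h with h | h | ⟨h, t, h3, h4⟩
          · omega
          · omega
          · have : 2 ^ t = 2 ^ R + 2 ^ r := by omega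
            rcases pow_cmp t R with ⟨c1, c2⟩ | c | ⟨c1, c2⟩
            · omega
            · subst c; omega
            · omega
        · rcases h with h | h | ⟨h, t, h3, h4, h5⟩
          · omega
          · omega
          · rcases pow_cmp t r with ⟨c1, c2⟩ | c | ⟨c1, c2⟩ <;> omega
      · intro q hq
        obtain ⟨h1, h2⟩ := hblk q hq
        exact Or.inr (Or.inr ⟨h2, r, by omega, by omega, by omega⟩)
      · intro q hq q' hq'
        obtain ⟨h1, h2⟩ := hblk q hq
        obtain ⟨r1, r2⟩ := hrange q' hq'
        right; right
        exact ⟨r, c', by omega, h2, by omega, by omega⟩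
    by_cases hrr : (P + 2 ^ R + 1) * L + 2 ^ r * L ≤ b
    · -- right host
      have hun : (P + 2 ^ R + 2 ^ r) * L = (P + 2 ^ R) * L + 2 ^ r * L := by ring
      have hblk : ∀ q ∈ Finset.Ico ((P + 2 ^ R + 2 ^ r) * L + 7 * k)
          ((P + 2 ^ R + 2 ^ r) * L + 7 * k + k),
          q / L = P + 2 ^ R + 2 ^ r ∧ q % L / k = 7 := fun q hq =>
        (block_iff hk0 hL q _ 7 (by omega)).2 (Finset.mem_Ico.1 hq)
      refine chain_core H hk hL hS hIH hC hX hj4 (hKF := ?_) (hKc := by simp) (hKU := ?_) (hKcov := ?_) (K := Finset.Ico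
        ((P + 2 ^ R + 2 ^ r) * L + 7 * k) ((P + 2 ^ R + 2 ^ r) * L + 7 * k + k))
      · intro q hq
        obtain ⟨h1, h2⟩ := hblk q hq
        rw [Finset.mem_Ico] at hq
        by_contra hqF
        rcases hC.gap q (by omega) (by omega) hqF with h | h | h
        · rcases h with h | ⟨h, t, h3, h4⟩ | h
          · omega
          · have : 2 ^ t = 2 ^ R + 2 ^ r := by omega
            rcases pow_cmp t R with ⟨c1, c2⟩ | c | ⟨c1, c2⟩
            · omega
            · subst c; omega
            · omega
          · omega
        · rcases h with h | ⟨h, t, h3, h4⟩ | h <;> omega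
        · rcases h with h | ⟨h, t, h3, h4, h5⟩ | h
          · omega
          · rcases pow_cmp t r with ⟨c1, c2⟩ | c | ⟨c1, c2⟩ <;> omega
          · omega
      · intro q hq
        obtain ⟨h1, h2⟩ := hblk q hq
        exact Or.inr (Or.inl ⟨h2, r, by omega, by omega, by omega⟩)
      · intro q hq q' hq'
        obtain ⟨h1, h2⟩ := hblk q hq
        obtain ⟨r1, r2⟩ := hrange q' hq'
        right; left
        exact ⟨r, c', by omega, h2, by omega, by omega⟩
    -- skip
    apply hnext
    refine ⟨hC.dvd, hC.sub, ha, hb, ha', hb', ?_, ?_, by omega⟩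
    · intro q h1 h2 h3
      rcases hC.gap q h1 h2 h3 with h | h | h
      · exact Or.inl h
      · exact Or.inr (Or.inl h)
      · exact Or.inr (Or.inr h.succ)
    · refine ⟨?_, fun h => by omega, fun h => by omega⟩
      have hA : (F.filter (· < (P + 2 ^ R) * L)).card ≤ 2 ^ r * L := by
        have : F.filter (· < (P + 2 ^ R) * L) ⊆ Finset.Ico a ((P + 2 ^ R) * L) := by
          intro q hq
          rw [Finset.mem_filter] at hq
          have := Finset.mem_Ico.1 (hC.sub hq.1)
          rw [Finset.mem_Ico]; omega
        have := Finset.card_le_card this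
        rw [Nat.card_Ico] at this
        omega
      have hB : (F.filter ((P + 2 ^ R + 1) * L ≤ ·)).card ≤ 2 ^ r * L := by
        have : F.filter ((P + 2 ^ R + 1) * L ≤ ·) ⊆ Finset.Ico ((P + 2 ^ R + 1) * L) b := by
          intro q hq
          rw [Finset.mem_filter] at hq
          have := Finset.mem_Ico.1 (hC.sub hq.1)
          rw [Finset.mem_Ico]; omega
        have := Finset.card_le_card this
        rw [Nat.card_Ico] at this
        omega
      have hdv' : dv (j + 1) = 2 ^ (j + 1) := by
        unfold dv; rw [if_neg (by omega), if_neg (by omega)]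
      rw [hdv']
      calc _ ≤ 2 ^ r * L * 2 ^ (j + 1) := Nat.mul_le_mul_right _ (max_le hA hB)
        _ = 2 ^ R * L := by rw [hr]; ring

theorem chain_good {V : Type} [DecidableEq V] (H : SimpleGraph V) {k L : ℕ} (hk : 2 ≤ k)
    (hL : L = 10 * k) (hS : SepProp H k) {s : ℕ}
    (hIH : ∀ s' < s, GoodClean H k L s' ∧ GoodChain H k L s') : GoodChain H k L s := by
  have key : ∀ t j R P a b : ℕ, ∀ (F : Finset ℕ) (X : Finset V), R - j = t → F.card = s →
      X.card = s → Chain k L R P j a b F → Emb H k L X F := by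
    intro t
    induction t with
    | zero => intro j R P a b F X h1 _ _ hC; have := hC.hj; omega
    | succ t ih =>
      intro j R P a b F X h1 h2 h3 hC
      exact chain_step H hk hL hS (by rw [h2]; exact hIH) hC (h3.trans h2.symm)
        (fun hC' => ih (j + 1) R P a b F X (by omega) h2 h3 hC')
  intro j R P a b F X h2 h3 hC
  exact key _ j R P a b F X rfl h2 h3 hC

theorem clean_good {V : Type} [DecidableEq V] (H : SimpleGraph V) {k L : ℕ} (hk : 2 ≤ k)
    (hL : L = 10 * k) {s : ℕ} (hchain : GoodChain H k L s) : GoodClean H k L s := by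
  have hL0 : 0 < L := by omega
  intro R
  induction R with
  | zero =>
    intro P a b F X h1 h2 hC
    refine Emb.leaf hL0 a b hC.sub ?_ (by omega)
    have h3 := hC.ha
    have h4 := hC.hb
    have : (P + 2 * 2 ^ 0 + 1) * L = P * L + 3 * L := by ring
    omega
  | succ R ih =>
    intro P a b F X h1 h2 hC
    obtain ⟨dvd, sub, ha, hb, gap⟩ := hC
    have gap' : ∀ q, a ≤ q → q < b → q ∉ F → Rsv k L q P ∨ Rsv k L q (P + 2 * 2 ^ (R + 1)) ∨
        Rsv k L q (P + 2 ^ (R + 1)) := by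
      intro q h1 h2 h3
      rcases gap q h1 h2 h3 with h | h
      · exact Or.inl h
      · exact Or.inr (Or.inl h)
    by_cases hleaf : b ≤ a + 20 * L
    · exact Emb.leaf hL0 a b sub hleaf (by omega)
    rcases Nat.lt_or_ge ((P + 2 ^ (R + 1)) * L) a with h | h
    · exact ih _ _ _ _ _ h1 h2 (half_right hL0 dvd sub h.le hb gap')
    rcases Nat.lt_or_ge b ((P + 2 ^ (R + 1) + 1) * L) with h' | h'
    · exact ih _ _ _ _ _ h1 h2 (half_left hL0 dvd sub ha h'.le gap')
    refine hchain 0 (R + 1) P a b F X h1 h2 ⟨dvd, sub, ha, hb, h, h', ?_, ?_, ?_⟩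
    · intro q h1 h2 h3
      rcases gap q h1 h2 h3 with h | h
      · exact Or.inl h
      · exact Or.inr (Or.inl h)
    · refine ⟨?_, fun h => by omega, fun h => by omega⟩
      have : dv 0 = 1 := rfl
      rw [this, mul_one]
      apply max_le
      · have hs : F.filter (· < (P + 2 ^ (R + 1)) * L) ⊆
            Finset.Ico a ((P + 2 ^ (R + 1)) * L) := by
          intro q hq
          rw [Finset.mem_filter] at hq
          have := Finset.mem_Ico.1 (sub hq.1)
          rw [Finset.mem_Ico]; omega
        have := Finset.card_le_card hs
        rw [Nat.card_Ico] at this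
        have e : (P + 2 ^ (R + 1)) * L = P * L + 2 ^ (R + 1) * L := by ring
        omega
      · have hs : F.filter ((P + 2 ^ (R + 1) + 1) * L ≤ ·) ⊆
            Finset.Ico ((P + 2 ^ (R + 1) + 1) * L) b := by
          intro q hq
          rw [Finset.mem_filter] at hq
          have := Finset.mem_Ico.1 (sub hq.1)
          rw [Finset.mem_Ico]; omega
        have := Finset.card_le_card hs
        rw [Nat.card_Ico] at this
        have e : (P + 2 * 2 ^ (R + 1) + 1) * L =
          (P + 2 ^ (R + 1) + 1) * L + 2 ^ (R + 1) * L := by ring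
        omega
    · by_contra hcon
      apply hleaf
      have : 2 ^ (R + 1) ≤ 4 := by
        calc 2 ^ (R + 1) ≤ 2 ^ 2 := Nat.pow_le_pow_right (by norm_num) (by omega)
          _ = 4 := by norm_num
      have e : (P + 2 * 2 ^ (R + 1) + 1) * L = P * L + (2 * 2 ^ (R + 1) + 1) * L := by ring
      have : (2 * 2 ^ (R + 1) + 1) * L ≤ 20 * L := Nat.mul_le_mul_right _ (by omega)
      omega

theorem all_good {V : Type} [DecidableEq V] (H : SimpleGraph V) {k L : ℕ} (hk : 2 ≤ k)
    (hL : L = 10 * k) (hS : SepProp H k) (s : ℕ) : GoodClean H k L s ∧ GoodChain H k L s := by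
  induction s using Nat.strong_induction_on with
  | _ s ih =>
    have := chain_good H hk hL hS ih
    exact ⟨clean_good H hk hL this, this⟩

theorem embed_all {V : Type} [DecidableEq V] (H : SimpleGraph V) {k L : ℕ} (hk : 2 ≤ k)
    (hL : L = 10 * k) (hS : SepProp H k) (X : Finset V) :
    Emb H k L X (Finset.range X.card) := by
  refine (all_good H hk hL hS X.card).1 X.card 0 0 X.card _ X (by simp) rfl
    ⟨dvd_zero _, ?_, by simp, ?_, ?_⟩
  · intro q hq; simpa using hq
  · have h1 : X.card < 2 ^ X.card := Nat.lt_two_pow_self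
    have h2 : (0 + 2 * 2 ^ X.card + 1) * 1 ≤ (0 + 2 * 2 ^ X.card + 1) * L :=
      Nat.mul_le_mul_left _ (by omega)
    omega
  · intro q _ h1 h2
    exact absurd (Finset.mem_range.2 h1) h2

theorem tree_nbr_unique {ι : Type} {T : SimpleGraph ι} (hT : T.IsTree) {x y y' z : ι}
    (h1 : T.Adj x y) (h2 : T.Adj x y') (d1 : T.dist z y < T.dist z x)
    (d2 : T.dist z y' < T.dist z x) : y = y' := by
  have key : ∀ w, T.Adj x w → T.dist z w < T.dist z x →
      ∃ p : T.Path x z, (p : T.Walk x z).snd = w := by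
    intro w hw hd
    obtain ⟨p, hp⟩ := hT.connected.exists_walk_length_eq_dist w z
    refine ⟨⟨SimpleGraph.Walk.cons hw p, ?_⟩, by simp⟩
    apply SimpleGraph.Walk.isPath_of_length_eq_dist
    rw [SimpleGraph.Walk.length_cons, hp]
    have := hT.dist_eq_dist_add_one_of_adj z hw
    rw [SimpleGraph.dist_comm (u := w), SimpleGraph.dist_comm (u := x)]
    omega
  obtain ⟨p, hp⟩ := key y h1 d1
  obtain ⟨p', hp'⟩ := key y' h2 d2
  rw [← hp, ← hp', (hT.isAcyclic.subsingleton_path x z).elim p p']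

theorem tree_nbr_exists {ι : Type} {T : SimpleGraph ι} (hT : T.IsTree) {x z : ι} (h : z ≠ x) :
    ∃ y, T.Adj x y ∧ T.dist z y < T.dist z x := by
  obtain ⟨p, hp⟩ := hT.connected.exists_walk_length_eq_dist x z
  cases p with
  | nil => exact absurd rfl h
  | cons hw p =>
    rename_i w
    refine ⟨w, hw, ?_⟩
    rw [SimpleGraph.Walk.length_cons] at hp
    have := SimpleGraph.dist_le p
    rw [SimpleGraph.dist_comm (v := w), SimpleGraph.dist_comm (v := x)]
    omega

theorem tree_cross {ι : Type} {T : SimpleGraph ι} (hT : T.IsTree) {x y z z' : ι}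
    (h1 : T.Adj x y) (hz : T.Adj z z') (hx : z' ≠ x) (d1 : T.dist z y < T.dist z x) :
    T.dist z' y < T.dist z' x := by
  by_contra hcon
  have a1 := hT.dist_eq_dist_add_one_of_adj z h1
  have a2 := hT.dist_eq_dist_add_one_of_adj z' h1
  have a3 := hT.dist_eq_dist_add_one_of_adj x hz
  have a4 := hT.dist_eq_dist_add_one_of_adj y hz
  rw [SimpleGraph.dist_comm (u := x), SimpleGraph.dist_comm (u := x)] at a3
  rw [SimpleGraph.dist_comm (u := y), SimpleGraph.dist_comm (u := y)] at a4
  by_cases hzy : z = y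
  · subst hzy
    rw [SimpleGraph.dist_self] at *
    have : T.dist z' x = 0 := by omega
    exact hx ((hT.connected.dist_eq_zero_iff).1 this)
  · obtain ⟨z2, b1, b2⟩ := tree_nbr_exists hT (x := z) (z := y) (Ne.symm hzy)
    have b3 : T.dist x z2 < T.dist x z := by
      have := hT.connected.dist_triangle (u := x) (v := y) (w := z2)
      have h11 : T.dist x y = 1 := SimpleGraph.dist_eq_one_iff_adj.2 h1
      rw [SimpleGraph.dist_comm (u := y) (v := z)] at b2
      rw [SimpleGraph.dist_comm (u := x) (v := z)]
      omega
    have b4 : T.dist x z' < T.dist x z := by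
      rw [SimpleGraph.dist_comm (u := x), SimpleGraph.dist_comm (u := x)]; omega
    have := tree_nbr_unique hT b1 hz b3 b4
    subst this
    rw [SimpleGraph.dist_comm (u := y), SimpleGraph.dist_comm (u := y)] at b2
    omega

theorem sep_of_td {V ι : Type} [DecidableEq V] [Fintype ι] (G : SimpleGraph V) (T : SimpleGraph ι)
    (B : ι → Finset V) (h : IsTreeDecomp G T B) (k : ℕ) (hk : ∀ x, (B x).card ≤ k) :
    SepProp G k := by
  classical
  obtain ⟨hT, hcov, hedge, hconn⟩ := h
  choose t ht using hcov
  -- branch function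
  have hbr : ∀ x z : ι, ∃ y, z ≠ x → T.Adj x y ∧ T.dist z y < T.dist z x := by
    intro x z
    by_cases hz : z = x
    · exact ⟨x, fun h => absurd hz h⟩
    · obtain ⟨y, hy⟩ := tree_nbr_exists hT hz
      exact ⟨y, fun _ => hy⟩
  choose br hbr using hbr
  have hbru : ∀ x z y, z ≠ x → T.Adj x y → T.dist z y < T.dist z x → br x z = y := by
    intro x z y h1 h2 h3
    exact tree_nbr_unique hT (hbr x z h1).1 h2 (hbr x z h1).2 h3
  have hstep : ∀ x z z', z ≠ x → z' ≠ x → T.Adj z z' → br x z = br x z' := by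
    intro x z z' h1 h2 h3
    symm
    apply hbru x z' _ h2 (hbr x z h1).1
    exact tree_cross hT (hbr x z h1).1 h3 h2 (hbr x z h1).2
  have hsame : ∀ x v, v ∉ B x → ∀ z z', v ∈ B z → v ∈ B z' → br x z = br x z' := by
    intro x v hv z z' hz hz'
    obtain ⟨p⟩ := (hconn v).preconnected ⟨z, hz⟩ ⟨z', hz'⟩
    have : ∀ (a b : {x : ι | v ∈ B x}), (T.induce {x : ι | v ∈ B x}).Walk a b →
        br x a = br x b := by
      intro a b p
      induction p with
      | nil => rfl
      | @cons a c b hadj p ih =>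
        refine (hstep x (a : ι) (c : ι) ?_ ?_ hadj).trans ih
        · intro e; exact hv (e ▸ a.property)
        · intro e; exact hv (e ▸ c.property)
    exact this _ _ p
  have htne : ∀ x v, v ∉ B x → t v ≠ x := by
    rintro x v hv rfl; exact hv (ht v)
  obtain ⟨r⟩ : Nonempty ι := hT.connected.nonempty
  intro X m hm2 hmX
  let Up : ι → V → Prop := fun x v => v ∉ B x ∧ x ≠ r ∧ br x (t v) = br x r
  let W : ι → Finset V := fun x => X.filter (fun v => ¬ Up x v)
  have hWr : m ≤ (W r).card := by
    have : W r = X := by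
      apply Finset.filter_true_of_mem
      rintro v _ ⟨_, h, _⟩; exact h rfl
    rw [this]; exact hmX
  obtain ⟨x, hxm, hxmax⟩ := Finset.exists_max_image
    (Finset.univ.filter (fun x => m ≤ (W x).card)) (fun x => T.dist r x) ⟨r, by simpa using hWr⟩
  simp only [Finset.mem_filter, Finset.mem_univ, true_and] at hxm hxmax
  refine ⟨B x ∩ X, Finset.inter_subset_right,
    (Finset.card_le_card Finset.inter_subset_left).trans (hk x),
    fun v => if Up x v then 0 else (Fintype.equivFin ι (br x (t v)) : ℕ) + 1, ?_, ?_, ?_⟩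
  · intro u hu v hv huv
    have hu' : u ∉ B x := fun h => by
      simp only [Finset.mem_sdiff, Finset.mem_inter] at hu; tauto
    have hv' : v ∉ B x := fun h => by
      simp only [Finset.mem_sdiff, Finset.mem_inter] at hv; tauto
    obtain ⟨z, hz1, hz2⟩ := hedge u v huv
    have e : br x (t u) = br x (t v) :=
      (hsame x u hu' _ _ (ht u) hz1).trans (hsame x v hv' _ _ hz2 (ht v))
    have : Up x u ↔ Up x v := by simp only [Up, e, hu', hv', not_false_eq_true, true_and]
    simp only [this, e]
  · have h1 : ((X \ (B x ∩ X)).filter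
        (fun v => (if Up x v then 0 else (Fintype.equivFin ι (br x (t v)) : ℕ) + 1) = 0)) ⊆
        X.filter (fun v => Up x v) := by
      intro v hv
      rw [Finset.mem_filter] at hv ⊢
      refine ⟨(Finset.mem_sdiff.1 hv.1).1, ?_⟩
      by_contra hc
      have := hv.2
      rw [if_neg hc] at this
      omega
    have h2 := Finset.card_le_card h1
    have h3 := Finset.card_filter_add_card_filter_not (s := X) (fun v => Up x v)
    have h4 : (W x).card = (X.filter (fun v => ¬ Up x v)).card := rfl
    beta_reduce
    omega
  · intro l hl
    by_contra hcon
    push Not at hcon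
    obtain ⟨v0, hv0⟩ : ((X \ (B x ∩ X)).filter (fun v =>
        (if Up x v then 0 else (Fintype.equivFin ι (br x (t v)) : ℕ) + 1) = l)).Nonempty := by
      rw [← Finset.card_pos]; omega
    have hprop : ∀ v, v ∈ ((X \ (B x ∩ X)).filter (fun v =>
        (if Up x v then 0 else (Fintype.equivFin ι (br x (t v)) : ℕ) + 1) = l)) →
        v ∈ X ∧ v ∉ B x ∧ ¬ Up x v ∧ (Fintype.equivFin ι (br x (t v)) : ℕ) + 1 = l := by
      intro v hv
      rw [Finset.mem_filter, Finset.mem_sdiff, Finset.mem_inter] at hv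
      obtain ⟨⟨h1, h2⟩, h3⟩ := hv
      by_cases hU : Up x v
      · rw [if_pos hU] at h3; exact absurd h3.symm hl
      · rw [if_neg hU] at h3
        exact ⟨h1, fun h => h2 ⟨h, h1⟩, hU, h3⟩
    obtain ⟨p1, p2, p3, p4⟩ := hprop v0 hv0
    set y := br x (t v0) with hy
    have hxy := (hbr x (t v0) (htne x v0 p2))
    rw [← hy] at hxy
    have hdr : T.dist r x < T.dist r y := by
      rcases hT.dist_eq_dist_add_one_of_adj r hxy.1 with h | h
      · exfalso
        have hxr : r ≠ x := by
          rintro rfl; rw [SimpleGraph.dist_self] at h; omega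
        exact p3 ⟨p2, hxr.symm, (hbru x r y hxr hxy.1 (by omega)).symm ▸ rfl⟩
      · omega
    have hsub : ((X \ (B x ∩ X)).filter (fun v =>
        (if Up x v then 0 else (Fintype.equivFin ι (br x (t v)) : ℕ) + 1) = l)) ⊆ W y := by
      intro v hv
      obtain ⟨q1, q2, q3, q4⟩ := hprop v hv
      refine Finset.mem_filter.2 ⟨q1, ?_⟩
      rintro ⟨u1, u2, u3⟩
      have e : br x (t v) = y := by
        apply (Fintype.equivFin ι).injective
        apply Fin.ext; omega
      have e2 : br y r = x := hbru y r x u2.symm hxy.1.symm hdr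
      have b1 := hbr x (t v) (htne x v q2)
      have b2 := hbr y (t v) (htne y v u1)
      rw [e] at b1
      rw [u3, e2] at b2
      omega
    have := hxmax y (hcon.trans (Finset.card_le_card hsub))
    omega

theorem edges_le {n : ℕ} (U : SimpleGraph (Fin n)) (D : Finset (ℕ × ℕ))
    (h : ∀ q q' : Fin n, U.Adj q q' → ((q : ℕ), (q' : ℕ)) ∈ D ∨ ((q' : ℕ), (q : ℕ)) ∈ D) :
    U.edgeSet.ncard ≤ D.card := by
  classical
  have hinj : Set.InjOn (fun e : Sym2 (Fin n) => Sym2.map (fun q : Fin n => (q : ℕ)) e) U.edgeSet :=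
    (Sym2.map.injective Fin.val_injective).injOn
  rw [← Set.ncard_image_of_injOn hinj]
  have hsub : (fun e : Sym2 (Fin n) => Sym2.map (fun q : Fin n => (q : ℕ)) e) '' U.edgeSet ⊆
      ((D.image (fun p => s(p.1, p.2)) : Finset (Sym2 ℕ)) : Set (Sym2 ℕ)) := by
    rintro _ ⟨e, he, rfl⟩
    induction e using Sym2.ind with
    | _ x y =>
      rw [SimpleGraph.mem_edgeSet] at he
      simp only [Sym2.map_mk, Finset.coe_image, Set.mem_image, Finset.mem_coe]
      rcases h x y he with h | h
      · exact ⟨_, h, rfl⟩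
      · exact ⟨_, h, Sym2.eq_swap⟩
  calc _ ≤ ((D.image (fun p => s(p.1, p.2)) : Finset (Sym2 ℕ)) : Set (Sym2 ℕ)).ncard :=
        Set.ncard_le_ncard hsub (Finset.finite_toSet _)
    _ = (D.image (fun p => s(p.1, p.2))).card := Set.ncard_coe_finset _
    _ ≤ D.card := Finset.card_image_le

def Blk (k L u s d : ℕ) : Finset (ℕ × ℕ) :=
  Finset.Ico (u * L + s * k) (u * L + s * k + k) ×ˢ Finset.Ico ((u - d) * L) ((u + d + 1) * L)

theorem Blk_card (k L u s d : ℕ) : (Blk k L u s d).card ≤ k * ((2 * d + 1) * L) := by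
  unfold Blk
  rw [Finset.card_product, Nat.card_Ico, Nat.card_Ico, Nat.add_sub_cancel_left, ← Nat.sub_mul]
  exact Nat.mul_le_mul_left _ (Nat.mul_le_mul_right _ (by omega))

theorem mem_range_units {L q' u d : ℕ} (hL : 0 < L) (h1 : q' / L ≤ u + d) (h2 : u ≤ q' / L + d) :
    q' ∈ Finset.Ico ((u - d) * L) ((u + d + 1) * L) := by
  rw [Finset.mem_Ico, ← Nat.le_div_iff_mul_le hL, ← Nat.div_lt_iff_lt_mul hL]
  generalize q' / L = t at *
  omega

theorem mem_Blk {k L q q' u s d : ℕ} (hk : 0 < k) (hL : L = 10 * k) (hs : s < 10)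
    (h0 : q / L = u) (h1 : q % L / k = s) (h2 : q' / L ≤ u + d) (h3 : u ≤ q' / L + d) :
    (q, q') ∈ Blk k L u s d := by
  unfold Blk
  rw [Finset.mem_product]
  refine ⟨?_, mem_range_units (by omega) h2 h3⟩
  rw [Finset.mem_Ico]
  exact (block_iff hk hL q u s hs).1 ⟨h0, h1⟩

def DNear (L n : ℕ) : Finset (ℕ × ℕ) :=
  (Finset.range n).biUnion fun q => {q} ×ˢ Finset.Ico ((q / L - 20) * L) ((q / L + 20 + 1) * L)

def DOwn (k L Nu Q : ℕ) : Finset (ℕ × ℕ) :=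
  (Finset.range Q).biUnion fun R => (Finset.range 7).biUnion fun j =>
    (Finset.range (Nu / 2 ^ (R + 1) + 1)).biUnion fun c =>
      Blk k L (2 ^ R * (2 * c + 1)) j (2 ^ R / dv j + 2)

def DR (k L Nu Q : ℕ) : Finset (ℕ × ℕ) :=
  (Finset.range Q).biUnion fun r => (Finset.range (Nu / 2 ^ (r + 8) + 1)).biUnion fun c =>
      Blk k L (2 ^ (r + 8) * c + 2 ^ r) 7 (3 * 2 ^ r + 3)

def DL (k L Nu Q : ℕ) : Finset (ℕ × ℕ) :=
  (Finset.range Q).biUnion fun r => (Finset.range (Nu / 2 ^ (r + 8) + 2)).biUnion fun c =>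
      Blk k L (2 ^ (r + 8) * c - 2 ^ r) 8 (3 * 2 ^ r + 3)

theorem DNear_card (L n : ℕ) : (DNear L n).card ≤ n * (41 * L) := by
  unfold DNear
  refine Finset.card_biUnion_le.trans ?_
  calc _ ≤ ∑ q ∈ Finset.range n, 41 * L := by
        apply Finset.sum_le_sum
        intro q _
        rw [Finset.card_product, Finset.card_singleton, one_mul, Nat.card_Ico, ← Nat.sub_mul]
        exact Nat.mul_le_mul_right _ (by omega)
    _ = n * (41 * L) := by simp

theorem DOwn_card (k L Nu Q : ℕ) : (DOwn k L Nu Q).card ≤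
    ∑ R ∈ Finset.range Q, ∑ j ∈ Finset.range 7,
      (Nu / 2 ^ (R + 1) + 1) * (k * ((2 * (2 ^ R / dv j + 2) + 1) * L)) := by
  unfold DOwn
  refine Finset.card_biUnion_le.trans (Finset.sum_le_sum fun R _ => ?_)
  refine Finset.card_biUnion_le.trans (Finset.sum_le_sum fun j _ => ?_)
  refine Finset.card_biUnion_le.trans ?_
  refine (Finset.sum_le_sum fun c _ => Blk_card _ _ _ _ _).trans ?_
  simp

theorem DR_card (k L Nu Q : ℕ) : (DR k L Nu Q).card ≤
    ∑ r ∈ Finset.range Q, (Nu / 2 ^ (r + 8) + 1) * (k * ((2 * (3 * 2 ^ r + 3) + 1) * L)) := by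
  unfold DR
  refine Finset.card_biUnion_le.trans (Finset.sum_le_sum fun R _ => ?_)
  refine Finset.card_biUnion_le.trans ?_
  refine (Finset.sum_le_sum fun c _ => Blk_card _ _ _ _ _).trans ?_
  simp

theorem DL_card (k L Nu Q : ℕ) : (DL k L Nu Q).card ≤
    ∑ r ∈ Finset.range Q, (Nu / 2 ^ (r + 8) + 2) * (k * ((2 * (3 * 2 ^ r + 3) + 1) * L)) := by
  unfold DL
  refine Finset.card_biUnion_le.trans (Finset.sum_le_sum fun R _ => ?_)
  refine Finset.card_biUnion_le.trans ?_
  refine (Finset.sum_le_sum fun c _ => Blk_card _ _ _ _ _).trans ?_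
  simp

theorem near_mem {L n q q' : ℕ} (hL : 0 < L) (hq : q < n) (h : NearQ L q q') :
    (q, q') ∈ DNear L n := by
  unfold DNear
  rw [Finset.mem_biUnion]
  refine ⟨q, Finset.mem_range.2 hq, ?_⟩
  rw [Finset.mem_product]
  exact ⟨Finset.mem_singleton_self q, mem_range_units hL h.2 h.1⟩

theorem cov_mem {k L Nu Q q q' : ℕ} (hk : 0 < k) (hL : L = 10 * k) (hq : q / L < Nu)
    (hQ : Nu ≤ 2 ^ Q) (h : Cov k L q q') :
    (q, q') ∈ DOwn k L Nu Q ∪ (DR k L Nu Q ∪ DL k L Nu Q) := by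
  have hlt : ∀ r, 2 ^ r < Nu → r < Q := fun r hr =>
    (Nat.pow_lt_pow_iff_right (by norm_num)).1 (hr.trans_le hQ)
  rw [Finset.mem_union, Finset.mem_union]
  rcases h with ⟨R, c, j, h1, h2, h3, h4, h5⟩ | ⟨r, c, h1, h2, h3, h4⟩ | ⟨r, c, h1, h2, h3, h4⟩
  · left
    have e : 2 ^ R * (2 * c + 1) = 2 ^ (R + 1) * c + 2 ^ R := by ring
    have hp : 0 < 2 ^ R := by positivity
    unfold DOwn
    simp only [Finset.mem_biUnion, Finset.mem_range]
    refine ⟨R, hlt R (by omega), j, h2, c, ?_,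
      mem_Blk hk hL (by omega) h1 h3 (by rw [← h1]; exact h4) (by rw [← h1]; exact h5)⟩
    rw [Nat.lt_succ_iff, Nat.le_div_iff_mul_le (by positivity), mul_comm]
    omega
  · right; left
    have hp : 0 < 2 ^ r := by positivity
    unfold DR
    simp only [Finset.mem_biUnion, Finset.mem_range]
    refine ⟨r, hlt r (by omega), c, ?_,
      mem_Blk hk hL (by omega) h1 h2 (by rw [← h1]; exact h3) (by rw [← h1]; exact h4)⟩
    rw [Nat.lt_succ_iff, Nat.le_div_iff_mul_le (by positivity), mul_comm]
    omega
  · right; right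
    have hp : 0 < 2 ^ r := by positivity
    have e8 : 2 ^ (r + 8) = 256 * 2 ^ r := by ring
    have hu : q / L = 2 ^ (r + 8) * c - 2 ^ r := by rw [← h1, Nat.add_sub_cancel]
    unfold DL
    simp only [Finset.mem_biUnion, Finset.mem_range]
    refine ⟨r, hlt r ?_, c, ?_,
      mem_Blk hk hL (by omega) hu h2 (by rw [← hu]; exact h3) (by rw [← hu]; exact h4)⟩
    · have hc : 1 ≤ c := by
        rcases Nat.eq_zero_or_pos c with h0 | h0
        · subst h0; omega
        · exact h0
      have : 2 ^ (r + 8) * 1 ≤ 2 ^ (r + 8) * c := Nat.mul_le_mul_left _ hc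
      omega
    · have h9 : 2 ^ (r + 8) * c ≤ Nu + 2 ^ (r + 8) := by omega
      have : c ≤ (Nu + 2 ^ (r + 8)) / 2 ^ (r + 8) := by
        rw [Nat.le_div_iff_mul_le (by positivity), mul_comm]; exact h9
      rw [Nat.add_div_right _ (by positivity)] at this
      omega

theorem sum_pow_le (Q : ℕ) : ∑ r ∈ Finset.range Q, (2 : ℝ) ^ r ≤ 2 ^ Q := by
  have := geom_sum_eq (show (2 : ℝ) ≠ 1 by norm_num) Q
  rw [this]; norm_num

theorem sum_inv_le (Q : ℕ) : ∑ r ∈ Finset.range Q, (1 : ℝ) / 2 ^ (r + 1) ≤ 1 := by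
  have : ∑ r ∈ Finset.range Q, (1 : ℝ) / 2 ^ (r + 1) = 1 - 1 / 2 ^ Q := by
    induction Q with
    | zero => simp
    | succ Q ih => rw [Finset.sum_range_succ, ih]; field_simp; ring
  rw [this]
  have : (0 : ℝ) ≤ 1 / 2 ^ Q := by positivity
  linarith

theorem own_real (k L Nu Q : ℕ) (hQ : 2 ^ Q ≤ 2 * Nu) (hQN : Q ≤ Nu) :
    ((∑ R ∈ Finset.range Q, ∑ j ∈ Finset.range 7,
      (Nu / 2 ^ (R + 1) + 1) * (k * ((2 * (2 ^ R / dv j + 2) + 1) * L)) : ℕ) : ℝ) ≤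
    k * L * (61 / 32 * Nu * Q + 78 * Nu) := by
  push_cast
  have h1 : ∀ R ∈ Finset.range Q, ∑ j ∈ Finset.range 7,
      (((Nu / 2 ^ (R + 1) : ℕ) : ℝ) + 1) *
        (k * ((2 * (((2 ^ R / dv j : ℕ) : ℝ) + 2) + 1) * L)) ≤
      k * L * (61 / 32 * Nu + 35 * Nu * (1 / 2 ^ (R + 1)) + 61 / 16 * 2 ^ R + 35) := by
    intro R _
    have hN : ((Nu / 2 ^ (R + 1) : ℕ) : ℝ) ≤ Nu / 2 ^ (R + 1) := by
      have := @Nat.cast_div_le ℝ _ _ _ Nu (2 ^ (R + 1)); push_cast at this; exact this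
    have hd : ∀ j, ((2 ^ R / dv j : ℕ) : ℝ) ≤ 2 ^ R / (dv j : ℝ) := by
      intro j
      have := @Nat.cast_div_le ℝ _ _ _ (2 ^ R) (dv j); push_cast at this; exact this
    calc _ ≤ ∑ j ∈ Finset.range 7, ((Nu : ℝ) / 2 ^ (R + 1) + 1) *
        (k * ((2 * (2 ^ R / (dv j : ℝ) + 2) + 1) * L)) := by
          apply Finset.sum_le_sum
          intro j _
          have := hd j
          gcongr
      _ = _ := by
          simp only [Finset.sum_range_succ, Finset.sum_range_zero, dv]
          norm_num
          field_simp
          ring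
  refine (Finset.sum_le_sum h1).trans ?_
  rw [← Finset.mul_sum]
  apply mul_le_mul_of_nonneg_left _ (by positivity)
  rw [Finset.sum_add_distrib, Finset.sum_add_distrib, Finset.sum_add_distrib, ← Finset.mul_sum,
    ← Finset.mul_sum]
  have s0 : ∑ x ∈ Finset.range Q, ((61 / 16) : ℝ) * 2 ^ x = (61 / 16) * ∑ x ∈ Finset.range Q, (2 : ℝ) ^ x := by
    rw [Finset.mul_sum]
  simp only [Finset.sum_const, Finset.card_range, nsmul_eq_mul]
  have s1 := sum_pow_le Q
  have s2 := sum_inv_le Q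
  have s3 : (2 : ℝ) ^ Q ≤ 2 * Nu := by exact_mod_cast hQ
  have s4 : (Q : ℝ) ≤ Nu := by exact_mod_cast hQN
  have s5 : 35 * (Nu : ℝ) * ∑ r ∈ Finset.range Q, (1 : ℝ) / 2 ^ (r + 1) ≤ 35 * Nu * 1 :=
    mul_le_mul_of_nonneg_left s2 (by positivity)
  have : (0 : ℝ) ≤ Nu := by positivity
  nlinarith

theorem host_real (k L Nu Q e : ℕ) (he : e ≤ 2) (hQ : 2 ^ Q ≤ 2 * Nu) (hQN : Q ≤ Nu) :
    ((∑ r ∈ Finset.range Q, (Nu / 2 ^ (r + 8) + e) * (k * ((2 * (3 * 2 ^ r + 3) + 1) * L)) : ℕ) : ℝ)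
    ≤ k * L * (3 / 128 * Nu * Q + 39 * Nu) := by
  push_cast
  have he' : (e : ℝ) ≤ 2 := by exact_mod_cast he
  have h1 : ∀ r ∈ Finset.range Q,
      (((Nu / 2 ^ (r + 8) : ℕ) : ℝ) + e) * (k * ((2 * (3 * 2 ^ r + 3) + 1) * L)) ≤
      k * L * (3 / 128 * Nu + 7 / 128 * Nu * (1 / 2 ^ (r + 1)) + 12 * 2 ^ r + 14) := by
    intro r _
    have hN : ((Nu / 2 ^ (r + 8) : ℕ) : ℝ) ≤ Nu / 2 ^ (r + 8) := by
      have := @Nat.cast_div_le ℝ _ _ _ Nu (2 ^ (r + 8)); push_cast at this; exact this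
    calc _ ≤ ((Nu : ℝ) / 2 ^ (r + 8) + 2) * (k * ((2 * (3 * 2 ^ r + 3) + 1) * L)) := by gcongr
      _ = _ := by
        have : (2 : ℝ) ^ (r + 8) = 256 * 2 ^ r := by ring
        rw [this]
        have : (2 : ℝ) ^ (r + 1) = 2 * 2 ^ r := by ring
        rw [this]
        field_simp
        ring
  refine (Finset.sum_le_sum h1).trans ?_
  rw [← Finset.mul_sum]
  apply mul_le_mul_of_nonneg_left _ (by positivity)
  rw [Finset.sum_add_distrib, Finset.sum_add_distrib, Finset.sum_add_distrib, ← Finset.mul_sum,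
    ← Finset.mul_sum]
  have s0 : ∑ x ∈ Finset.range Q, (12 : ℝ) * 2 ^ x = 12 * ∑ x ∈ Finset.range Q, (2 : ℝ) ^ x := by
    rw [Finset.mul_sum]
  simp only [Finset.sum_const, Finset.card_range, nsmul_eq_mul]
  have s1 := sum_pow_le Q
  have s2 := sum_inv_le Q
  have s3 : (2 : ℝ) ^ Q ≤ 2 * Nu := by exact_mod_cast hQ
  have s4 : (Q : ℝ) ≤ Nu := by exact_mod_cast hQN
  have s5 : 7 / 128 * (Nu : ℝ) * ∑ r ∈ Finset.range Q, (1 : ℝ) / 2 ^ (r + 1) ≤ 7 / 128 * Nu * 1 :=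
    mul_le_mul_of_nonneg_left s2 (by positivity)
  have : (0 : ℝ) ≤ Nu := by positivity
  nlinarith

theorem log_const : (125 : ℝ) / 64 / Real.log 2 ≤ 19 / (6 * Real.log 3) := by
  have h2 : 0 < Real.log 2 := Real.log_pos (by norm_num)
  have h3 : 0 < Real.log 3 := Real.log_pos (by norm_num)
  have h : 5 * Real.log 3 ≤ 8 * Real.log 2 := by
    have h5 : Real.log ((3 : ℝ) ^ 5) ≤ Real.log ((2 : ℝ) ^ 8) :=
      Real.log_le_log (by norm_num) (by norm_num)
    rw [Real.log_pow, Real.log_pow] at h5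
    push_cast at h5
    exact h5
  rw [div_div, div_le_div_iff₀ (by positivity) (by positivity)]
  linarith

theorem clog_bound {n w Nu : ℕ} (hw : 1 ≤ w) (hwn : w < n) (hNu : Nu * w ≤ n) :
    (Nat.clog 2 Nu : ℝ) ≤ Real.log ((n : ℝ) / w) / Real.log 2 + 1 := by
  have hw' : (0 : ℝ) < w := by exact_mod_cast hw
  have h2 : 0 < Real.log 2 := Real.log_pos (by norm_num)
  rcases Nat.eq_zero_or_pos (Nat.clog 2 Nu) with h0 | h0
  · rw [h0]
    have : 0 ≤ Real.log ((n : ℝ) / w) := by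
      apply Real.log_nonneg
      rw [le_div_iff₀ hw', one_mul]
      exact_mod_cast hwn.le
    have := div_nonneg this h2.le
    push_cast
    linarith
  · have hlt : 2 ^ (Nat.clog 2 Nu - 1) < Nu := by
      rw [← Nat.lt_clog_iff_pow_lt (by norm_num)]
      omega
    have hr : (2 : ℝ) ^ (Nat.clog 2 Nu - 1) ≤ (n : ℝ) / w := by
      rw [le_div_iff₀ hw']
      have : 2 ^ (Nat.clog 2 Nu - 1) * w ≤ n := (Nat.mul_le_mul_right _ hlt.le).trans hNu
      exact_mod_cast this
    have hl := Real.log_le_log (by positivity) hr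
    rw [Real.log_pow, Nat.cast_sub h0] at hl
    rw [← sub_le_iff_le_add, le_div_iff₀ h2]
    simpa using hl

theorem contains_of_le {n m : ℕ} (h : m ≤ n) (H : SimpleGraph (Fin m)) :
    Contains (⊤ : SimpleGraph (Fin n)) H := by
  refine ⟨Fin.castLE h, Fin.castLE_injective h, fun u v huv => ?_⟩
  rw [SimpleGraph.top_adj]
  exact fun e => huv.ne (Fin.castLE_injective h e)

def UGraph (k L n : ℕ) : SimpleGraph (Fin n) where
  Adj q q' := UAdj k L q q'
  symm := ⟨fun _ _ h => UAdj.symm h⟩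
  loopless := ⟨fun _ h => h.1 rfl⟩

theorem UGraph_contains {n m w : ℕ} (hw : 1 ≤ w) (h : m ≤ n) (H : SimpleGraph (Fin m))
    (ht : TreewidthLE H w) : Contains (UGraph (w + 1) (10 * (w + 1)) n) H := by
  obtain ⟨ι, _, T, B, hT, hB⟩ := ht
  obtain ⟨f, f1, f2, f3⟩ := embed_all H (by omega) rfl (sep_of_td H T B hT (w + 1) hB)
    Finset.univ
  have f1' : ∀ x, f x < n := by
    intro x
    have := Finset.mem_range.1 (f1 x (Finset.mem_univ x))
    rw [Finset.card_univ, Fintype.card_fin] at this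
    omega
  refine ⟨fun x => ⟨f x, f1' x⟩, ?_, ?_⟩
  · intro x y hxy
    exact f2 x (Finset.mem_univ _) y (Finset.mem_univ _) (Fin.mk.inj_iff.1 hxy)
  · intro u v huv
    exact f3 u (Finset.mem_univ _) v (Finset.mem_univ _) huv

theorem UGraph_edges {k n Nu Q : ℕ} (hk : 0 < k) (hNu : ∀ q < n, q / (10 * k) < Nu)
    (hQ : Nu ≤ 2 ^ Q) (hQ2 : 2 ^ Q ≤ 2 * Nu) (hQN : Q ≤ Nu) :
    ((UGraph k (10 * k) n).edgeSet.ncard : ℝ) ≤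
      n * (41 * (10 * k)) + k * (10 * k) * (125 / 64 * Nu * Q + 156 * Nu) := by
  set L := 10 * k with hL
  have h1 : (UGraph k L n).edgeSet.ncard ≤
      (DNear L n ∪ (DOwn k L Nu Q ∪ (DR k L Nu Q ∪ DL k L Nu Q))).card := by
    apply edges_le
    intro q q' h
    obtain ⟨_, h | h | h⟩ := h
    · left
      exact Finset.mem_union_left _ (near_mem (by omega) q.2 h)
    · left
      exact Finset.mem_union_right _ (cov_mem hk hL (hNu q q.2) hQ h)
    · right
      exact Finset.mem_union_right _ (cov_mem hk hL (hNu q' q'.2) hQ h)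
  have h2 := Finset.card_union_le (DNear L n) (DOwn k L Nu Q ∪ (DR k L Nu Q ∪ DL k L Nu Q))
  have h3 := Finset.card_union_le (DOwn k L Nu Q) (DR k L Nu Q ∪ DL k L Nu Q)
  have h4 := Finset.card_union_le (DR k L Nu Q) (DL k L Nu Q)
  have c0 : ((DNear L n).card : ℝ) ≤ n * (41 * L) := by exact_mod_cast DNear_card L n
  have c1 : ((DOwn k L Nu Q).card : ℝ) ≤ _ :=
    (Nat.cast_le.2 (DOwn_card k L Nu Q)).trans (own_real k L Nu Q hQ2 hQN)
  have c2 : ((DR k L Nu Q).card : ℝ) ≤ _ :=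
    (Nat.cast_le.2 (DR_card k L Nu Q)).trans (host_real k L Nu Q 1 (by norm_num) hQ2 hQN)
  have c3 : ((DL k L Nu Q).card : ℝ) ≤ _ :=
    (Nat.cast_le.2 (DL_card k L Nu Q)).trans (host_real k L Nu Q 2 (by norm_num) hQ2 hQN)
  have h5 : ((UGraph k L n).edgeSet.ncard : ℝ) ≤ (DNear L n).card + ((DOwn k L Nu Q).card +
      ((DR k L Nu Q).card + (DL k L Nu Q).card)) := by
    exact_mod_cast (by omega : (UGraph k L n).edgeSet.ncard ≤ (DNear L n).card +
      ((DOwn k L Nu Q).card + ((DR k L Nu Q).card + (DL k L Nu Q).card)))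
  have hLr : (L : ℝ) = 10 * k := by rw [hL]; push_cast; ring
  rw [hLr] at c0 c1 c2 c3
  linarith

theorem final_real {k n Nu Q w l c : ℝ} (hk0 : 0 ≤ k) (hn : 0 ≤ n) (hQ0 : 0 ≤ Q) (hkw : k ≤ 2 * w)
    (h1 : Nu * (10 * k) ≤ n + 10 * k) (h2 : 10 * k ≤ n) (hQN : Q ≤ Nu)
    (hQ : 125 / 64 * Q ≤ c * l + 2) :
    n * (41 * (10 * k)) + k * (10 * k) * (125 / 64 * Nu * Q + 156 * Nu) ≤
      c * k * n * l + 2000 * n * w := by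
  have hkn : 0 ≤ k * n := mul_nonneg hk0 hn
  have a1 : k * (10 * k) * Nu ≤ 2 * (k * n) := by
    have := mul_le_mul_of_nonneg_left (h1.trans (by linarith : n + 10 * k ≤ 2 * n)) hk0
    linarith
  have a2 : (k * Q) * (Nu * (10 * k)) ≤ (k * Q) * (n + 10 * k) :=
    mul_le_mul_of_nonneg_left h1 (mul_nonneg hk0 hQ0)
  have a3 : k * (10 * k) * Q ≤ k * (10 * k) * Nu :=
    mul_le_mul_of_nonneg_left hQN (by positivity)
  have a4 : (k * n) * (125 / 64 * Q) ≤ (k * n) * (c * l + 2) := mul_le_mul_of_nonneg_left hQ hkn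
  have a5 : n * k ≤ n * (2 * w) := mul_le_mul_of_nonneg_left hkw hn
  linarith

/-- Upper bound: there is a constant `C > 0` such that for all `1 ≤ w < n`, there is a
graph on `n` vertices with at most `(19/(6 ln 3)) (w+1) n ln(n/w) + C n w` edges that
contains every graph with at most `n` vertices and treewidth at most `w` as a
subgraph. -/
theorem stmt_3 :
    ∃ C : ℝ, 0 < C ∧ ∀ n w : ℕ, 1 ≤ w → w < n →
      ∃ U : SimpleGraph (Fin n),
        (U.edgeSet.ncard : ℝ) ≤
            19 / (6 * Real.log 3) * ((w : ℝ) + 1) * n * Real.log ((n : ℝ) / (w : ℝ))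
              + C * n * w ∧
        ∀ (m : ℕ) (H : SimpleGraph (Fin m)), m ≤ n → TreewidthLE H w →
          Contains U H := by
  refine ⟨2000, by norm_num, fun n w hw hwn => ?_⟩
  have hw' : (1 : ℝ) ≤ w := by exact_mod_cast hw
  have hlog : 0 ≤ Real.log ((n : ℝ) / w) := by
    apply Real.log_nonneg
    rw [le_div_iff₀ (by linarith), one_mul]
    exact_mod_cast hwn.le
  have h3 : 0 < Real.log 3 := Real.log_pos (by norm_num)
  have h2 : 0 < Real.log 2 := Real.log_pos (by norm_num)
  rcases lt_or_ge n (10 * (w + 1)) with hn | hn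
  · refine ⟨⊤, ?_, fun m H hm _ => contains_of_le hm H⟩
    have e1 : (⊤ : SimpleGraph (Fin n)).edgeSet.ncard ≤
        (Finset.range n ×ˢ Finset.range n).card := by
      apply edges_le
      intro q q' _
      left
      simp
    rw [Finset.card_product, Finset.card_range] at e1
    have e2 : n * n ≤ n * (20 * w) := Nat.mul_le_mul_left _ (by omega)
    have e3 : (((⊤ : SimpleGraph (Fin n)).edgeSet.ncard : ℕ) : ℝ) ≤ n * (20 * w) := by
      exact_mod_cast e1.trans e2
    have e4 : 0 ≤ 19 / (6 * Real.log 3) * ((w : ℝ) + 1) * n * Real.log ((n : ℝ) / (w : ℝ)) := by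
      positivity
    have e5 : (0 : ℝ) ≤ n * w := by positivity
    linarith
  · refine ⟨UGraph (w + 1) (10 * (w + 1)) n, ?_, fun m H hm ht => UGraph_contains hw hm H ht⟩
    obtain ⟨Nu, hNu⟩ : ∃ Nu, Nu = (n - 1) / (10 * (w + 1)) + 1 := ⟨_, rfl⟩
    have hdiv := Nat.div_mul_le_self (n - 1) (10 * (w + 1))
    have hNuL : Nu * (10 * (w + 1)) ≤ n + 10 * (w + 1) := by
      rw [hNu, add_mul, one_mul]
      omega
    have hNuw : Nu * w ≤ n := by
      have : Nu * (10 * (w + 1)) = 10 * (Nu * w) + 10 * Nu := by ring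
      omega
    have hbnd : ∀ q < n, q / (10 * (w + 1)) < Nu := by
      intro q hq
      rw [hNu, Nat.lt_succ_iff]
      exact Nat.div_le_div_right (by omega)
    have hNu1 : 1 ≤ Nu := by rw [hNu]; exact Nat.le_add_left 1 _
    have hQ1 : Nu ≤ 2 ^ Nat.clog 2 Nu := Nat.le_pow_clog (by norm_num) _
    have hQN : Nat.clog 2 Nu ≤ Nu := by
      rw [Nat.clog_le_iff_le_pow (by norm_num)]
      exact Nat.lt_two_pow_self.le
    have hQ2 : 2 ^ Nat.clog 2 Nu ≤ 2 * Nu := by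
      rcases Nat.eq_zero_or_pos (Nat.clog 2 Nu) with h0 | h0
      · rw [h0]; omega
      · have hlt : 2 ^ (Nat.clog 2 Nu - 1) < Nu := by
          rw [← Nat.lt_clog_iff_pow_lt (by norm_num)]
          omega
        obtain ⟨t, ht⟩ : ∃ t, Nat.clog 2 Nu = t + 1 := ⟨Nat.clog 2 Nu - 1, by omega⟩
        rw [ht] at hlt ⊢
        rw [pow_succ]
        simp only [Nat.add_sub_cancel] at hlt
        omega
    have hE := UGraph_edges (Nat.succ_pos w) hbnd hQ1 hQ2 hQN
    refine hE.trans ?_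
    have hcl := clog_bound hw hwn hNuw
    push_cast
    apply final_real (by positivity) (by positivity) (by positivity) (by linarith)
    · exact_mod_cast hNuL
    · exact_mod_cast hn
    · exact_mod_cast hQN
    · have hc := mul_le_mul_of_nonneg_right log_const hlog
      have : (125 : ℝ) / 64 / Real.log 2 * Real.log ((n : ℝ) / w) =
        125 / 64 * (Real.log ((n : ℝ) / w) / Real.log 2) := by ring
      linarith
end

section
/- Let X, N be integers with X > 0 and N ≥ X, and let F be a forest with 2N + X + 2 ≤ |F| ≤ 5N + X + 2. Then there exists a vertex s of F and a partition of F minus s into parts F_1, F_2, F_3 such that |F_1| ≤ 2N + X, |F_2| ≤ 2N + Δ(|F_1|), |F_3| ≤ 2N + Δ(|F_1| + |F_2|) + 1, and |F_1| + |F_2| ≥ 2N + X. -/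
/-- For integers `N ≥ X > 0`: `Δ(a) = X - a` if `a < X`, and
`Δ(a) = N - ((a - X) % N)` if `a ≥ X`. -/
def delta (N X a : ℕ) : ℕ := if a < X then X - a else N - ((a - X) % N)

/-- The vertex set `S` avoids `s` and is a union of components of `F - s`. -/
def GoodSet {V : Type} (F : SimpleGraph V) (s : V) (S : Finset V) : Prop :=
  s ∉ S ∧ ∀ x ∈ S, ∀ y, y ≠ s → F.Adj x y → y ∈ S

/-- The graph `F` with all edges at `s` removed. -/
def cutGraph {V : Type} (F : SimpleGraph V) (s : V) : SimpleGraph V where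
  Adj x y := F.Adj x y ∧ x ≠ s ∧ y ≠ s
  symm := ⟨fun _ _ h => ⟨h.1.symm, h.2.2, h.2.1⟩⟩
  loopless := ⟨fun _ h => h.1.ne rfl⟩

open Classical in
/-- The component of `x` in `F - s`. -/
noncomputable def comp {V : Type} [Fintype V] (F : SimpleGraph V) (s x : V) : Finset V :=
  Finset.univ.filter fun y => (cutGraph F s).Reachable x y

theorem mem_comp {V : Type} [Fintype V] {F : SimpleGraph V} {s x y : V} :
    y ∈ comp F s x ↔ (cutGraph F s).Reachable x y := by
  simp [comp]

theorem self_mem_comp {V : Type} [Fintype V] (F : SimpleGraph V) (s x : V) :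
    x ∈ comp F s x := mem_comp.2 (SimpleGraph.Reachable.refl _)

theorem GoodSet.reach {V : Type} {F : SimpleGraph V} {s : V} {S : Finset V}
    (h : GoodSet F s S) {x y : V} (hx : x ∈ S) (hr : (cutGraph F s).Reachable x y) : y ∈ S := by
  obtain ⟨w⟩ := hr
  induction w with
  | nil => exact hx
  | cons ha _ ih => exact ih (h.2 _ hx _ ha.2.2 ha.1)

theorem GoodSet.comp_subset {V : Type} [Fintype V] {F : SimpleGraph V} {s : V} {S : Finset V}
    (h : GoodSet F s S) {x : V} (hx : x ∈ S) : comp F s x ⊆ S :=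
  fun _ hy => h.reach hx (mem_comp.1 hy)

theorem GoodSet.comp_disjoint {V : Type} [Fintype V] {F : SimpleGraph V} {s : V} {S : Finset V}
    (h : GoodSet F s S) {x : V} (hx : x ∉ S) : Disjoint S (comp F s x) := by
  rw [Finset.disjoint_left]
  exact fun y hy hy' => hx (h.reach hy (mem_comp.1 hy').symm)

theorem goodSet_univ {V : Type} [Fintype V] [DecidableEq V] (F : SimpleGraph V) (s : V) :
    GoodSet F s (Finset.univ.erase s) := by
  simp +contextual [GoodSet]

theorem goodSet_comp {V : Type} [Fintype V] [DecidableEq V] (F : SimpleGraph V) {s x : V}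
    (hx : x ≠ s) : GoodSet F s (comp F s x) := by
  have h1 : s ∉ comp F s x := by
    intro h
    have := (goodSet_univ F s).reach (x := x) (by simpa using hx) (mem_comp.1 h)
    simp at this
  refine ⟨h1, fun y hy z hz ha => mem_comp.2 ((mem_comp.1 hy).trans ?_)⟩
  have : (cutGraph F s).Adj y z := ⟨ha, fun h => h1 (h ▸ hy), hz⟩
  exact this.reachable

theorem GoodSet.union {V : Type} [DecidableEq V] {F : SimpleGraph V} {s : V} {S T : Finset V}
    (h : GoodSet F s S) (h' : GoodSet F s T) : GoodSet F s (S ∪ T) := by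
  refine ⟨by simp [h.1, h'.1], fun x hx y hy ha => ?_⟩
  rcases Finset.mem_union.1 hx with hx | hx
  · exact Finset.mem_union_left _ (h.2 x hx y hy ha)
  · exact Finset.mem_union_right _ (h'.2 x hx y hy ha)

theorem GoodSet.sdiff {V : Type} [DecidableEq V] {F : SimpleGraph V} {s : V} {S T : Finset V}
    (h : GoodSet F s S) (h' : GoodSet F s T) : GoodSet F s (S \ T) := by
  refine ⟨by simp [h.1], fun x hx y hy ha => ?_⟩
  rw [Finset.mem_sdiff] at hx ⊢
  refine ⟨h.2 x hx.1 y hy ha, fun hyT => hx.2 (h'.2 y hyT x ?_ ha.symm)⟩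
  rintro rfl
  exact h.1 hx.1

theorem unique_nbr {V : Type} [Fintype V] {F : SimpleGraph V} (hF : F.IsAcyclic) {s v w : V}
    (hv : F.Adj s v) (hw : F.Adj s w) (hr : (cutGraph F s).Reachable w v) : w = v := by
  by_contra hne
  have hb := SimpleGraph.isAcyclic_iff_forall_adj_isBridge.1 hF hv
  rw [SimpleGraph.isBridge_iff] at hb
  apply hb
  have h1 : (F \ SimpleGraph.fromEdgeSet {s(s, v)}).Adj s w := by
    simp [hw, hne, hw.ne']
  refine h1.reachable.trans (hr.mono ?_)
  intro a b hab
  have := hab.2.1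
  have := hab.2.2
  simp [hab.1]
  grind

theorem exists_split {V : Type} [Fintype V] [DecidableEq V] (F : SimpleGraph V)
    (hF : F.IsAcyclic) (T : ℕ) (hT : T + 1 ≤ Fintype.card V) :
    ∃ (s : V) (D : Finset V), GoodSet F s D ∧ T ≤ D.card ∧
      ∀ x ∈ D, (comp F s x).card ≤ T := by
  classical
  let P : ℕ → Prop := fun k => ∃ (s : V) (D : Finset V), s ∈ D ∧ T + 1 ≤ D.card ∧ D.card = k ∧
    ∀ x ∈ D, ∀ y, y ∉ D → F.Adj x y → x = s
  have hP : ∃ k, P k := by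
    have : 0 < Fintype.card V := by omega
    obtain ⟨v⟩ := Fintype.card_pos_iff.1 this
    exact ⟨_, v, Finset.univ, by simp, by simpa using hT, rfl, by simp⟩
  obtain ⟨s, D, hs, hD, hk, hc⟩ := Nat.find_spec hP
  have hg : GoodSet F s (D.erase s) := by
    refine ⟨by simp, fun x hx y hy ha => ?_⟩
    rw [Finset.mem_erase] at hx ⊢
    refine ⟨hy, ?_⟩
    by_contra h
    exact hx.1 (hc x hx.2 y h ha)
  refine ⟨s, D.erase s, hg, by rw [Finset.card_erase_of_mem hs]; omega, fun x hx => ?_⟩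
  by_contra hlt
  have hsub := hg.comp_subset hx
  have hcard := Finset.card_le_card hsub
  rw [Finset.card_erase_of_mem hs] at hcard
  have hxs : x ≠ s := (Finset.mem_erase.1 hx).1
  have hgc := goodSet_comp F hxs
  apply Nat.find_min hP (m := (comp F s x).card) (by omega)
  by_cases hn : ∃ v ∈ comp F s x, F.Adj s v
  · obtain ⟨v, hv, hsv⟩ := hn
    refine ⟨v, comp F s x, hv, by omega, rfl, fun a ha b hb hab => ?_⟩
    have hbs : b = s := by
      by_contra hbs
      exact hb (hgc.2 a ha b hbs hab)
    subst hbs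
    exact unique_nbr hF hsv hab.symm ((mem_comp.1 ha).symm.trans (mem_comp.1 hv))
  · refine ⟨x, comp F s x, self_mem_comp F s x, by omega, rfl, fun a ha b hb hab => ?_⟩
    have hbs : b = s := by
      by_contra hbs
      exact hb (hgc.2 a ha b hbs hab)
    subst hbs
    exact absurd ⟨a, ha, hab.symm⟩ hn

theorem greedy {V : Type} [Fintype V] [DecidableEq V] (F : SimpleGraph V) (s : V)
    (W A : Finset V) (m k : ℕ) (hW : GoodSet F s W) (hA : GoodSet F s A)
    (hAm : A.card ≤ m) (hWm : m ≤ W.card)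
    (hsmall : ∀ x ∈ W, x ∉ A → (comp F s x).card ≤ k) :
    ∃ P Q : Finset V, GoodSet F s P ∧ GoodSet F s Q ∧ Disjoint P Q ∧ P.card ≤ m ∧
      Q.card ≤ k ∧ m ≤ P.card + Q.card := by
  classical
  obtain ⟨P, hP, hmax⟩ := Finset.exists_max_image
    (Finset.univ.filter fun P : Finset V => GoodSet F s P ∧ A ⊆ P ∧ P.card ≤ m) Finset.card
    ⟨A, by simp [hA, hAm]⟩
  simp only [Finset.mem_filter, Finset.mem_univ, true_and] at hP hmax
  by_cases hPm : m ≤ P.card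
  · exact ⟨P, ∅, hP.1, ⟨by simp, by simp⟩, by simp, hP.2.2, by simp, by simpa using hPm⟩
  have : ¬ W ⊆ P := fun h => by
    have := Finset.card_le_card h
    omega
  obtain ⟨x, hxW, hxP⟩ := Finset.not_subset.1 this
  have hxs : x ≠ s := fun h => hW.1 (h ▸ hxW)
  have hd := hP.1.comp_disjoint hxP
  have hc := goodSet_comp F hxs
  refine ⟨P, comp F s x, hP.1, hc, hd, hP.2.2,
    hsmall x hxW (fun h => hxP (hP.2.1 h)), ?_⟩
  by_contra hlt
  have hcard := Finset.card_union_of_disjoint hd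
  have := hmax (P ∪ comp F s x)
    ⟨hP.1.union hc, hP.2.1.trans Finset.subset_union_left, by omega⟩
  have : 0 < (comp F s x).card := Finset.card_pos.2 ⟨x, self_mem_comp F s x⟩
  omega

theorem delta_bound (N X q : ℕ) (hX : 0 < X) (hNX : X ≤ N) (hq : 2 * N + X ≤ q) :
    3 * N + X ≤ q + delta N X q := by
  obtain ⟨r, rfl⟩ := Nat.exists_eq_add_of_le hq
  have h1 : ¬ (2 * N + X + r < X) := by omega
  have h2 : 2 * N + X + r - X = r + N * 2 := by
    rw [Nat.mul_comm N 2]; omega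
  rw [delta, if_neg h1, h2, Nat.add_mul_mod_self_left]
  have := Nat.mod_le r N
  have := Nat.mod_lt r (show 0 < N by omega)
  omega

theorem finish {V : Type} [Fintype V] [DecidableEq V]
    (F : SimpleGraph V) (N X : ℕ) (hX : 0 < X) (hNX : X ≤ N)
    (hhigh : Fintype.card V ≤ 5 * N + X + 2) (s : V) (P Q : Finset V)
    (hP : GoodSet F s P) (hQ : GoodSet F s Q) (hd : Disjoint P Q) (hPc : P.card ≤ 2 * N + X)
    (hQc : Q.card ≤ 2 * N) (hPQ : 2 * N + X ≤ P.card + Q.card) :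
    ∃ (s : V) (F1 F2 F3 : Finset V),
      Disjoint F1 F2 ∧ Disjoint F1 F3 ∧ Disjoint F2 F3 ∧
      F1 ∪ F2 ∪ F3 = Finset.univ.erase s ∧
      (∀ u v : V, F.Adj u v →
        ¬(u ∈ F1 ∧ v ∈ F2) ∧ ¬(u ∈ F1 ∧ v ∈ F3) ∧ ¬(u ∈ F2 ∧ v ∈ F3)) ∧
      F1.card ≤ 2 * N + X ∧
      F2.card ≤ 2 * N + delta N X F1.card ∧
      F3.card ≤ 2 * N + delta N X (F1.card + F2.card) + 1 ∧
      2 * N + X ≤ F1.card + F2.card := by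
  have hsub : P ∪ Q ⊆ Finset.univ.erase s := by
    intro x hx
    have : x ≠ s := fun h => (hP.union hQ).1 (h ▸ hx)
    simpa using this
  have hcr := Finset.card_sdiff_add_card_eq_card hsub
  rw [Finset.card_union_of_disjoint hd, Finset.card_erase_of_mem (Finset.mem_univ s),
    Finset.card_univ] at hcr
  have hdel := delta_bound N X _ hX hNX hPQ
  have hR : GoodSet F s (Finset.univ.erase s \ (P ∪ Q)) := (goodSet_univ F s).sdiff (hP.union hQ)
  have hdR : Disjoint (P ∪ Q) (Finset.univ.erase s \ (P ∪ Q)) := Finset.disjoint_sdiff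
  rw [Finset.disjoint_union_left] at hdR
  have key : ∀ A B : Finset V, GoodSet F s A → GoodSet F s B → Disjoint A B →
      ∀ u v, F.Adj u v → ¬(u ∈ A ∧ v ∈ B) := by
    rintro A B hA hB hAB u v ha ⟨hu, hv⟩
    exact Finset.disjoint_left.1 hAB (hA.2 u hu v (fun h => hB.1 (h ▸ hv)) ha) hv
  exact ⟨s, P, Q, _, hd, hdR.1, hdR.2, Finset.union_sdiff_of_subset hsub,
    fun u v ha => ⟨key _ _ hP hQ hd u v ha, key _ _ hP hR hdR.1 u v ha,
      key _ _ hQ hR hdR.2 u v ha⟩, hPc, by omega, by omega, hPQ⟩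

/-- For `N ≥ X > 0` and a forest `F` with `2N + X + 2 ≤ |F| ≤ 5N + X + 2`, there is a
vertex `s` and a partition of `F` minus `s` into parts `F₁, F₂, F₃` (pairwise disjoint
vertex sets covering all vertices except `s`, with no edge of `F` between different
parts) with `|F₁| ≤ 2N + X`, `|F₂| ≤ 2N + Δ(|F₁|)`, `|F₃| ≤ 2N + Δ(|F₁| + |F₂|) + 1`
and `|F₁| + |F₂| ≥ 2N + X`. -/
theorem stmt_6 {V : Type} [Fintype V] [DecidableEq V]
    (F : SimpleGraph V) (hF : F.IsAcyclic) (N X : ℕ)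
    (hX : 0 < X) (hNX : X ≤ N)
    (hlow : 2 * N + X + 2 ≤ Fintype.card V)
    (hhigh : Fintype.card V ≤ 5 * N + X + 2) :
    ∃ (s : V) (F1 F2 F3 : Finset V),
      Disjoint F1 F2 ∧ Disjoint F1 F3 ∧ Disjoint F2 F3 ∧
      F1 ∪ F2 ∪ F3 = Finset.univ.erase s ∧
      (∀ u v : V, F.Adj u v →
        ¬(u ∈ F1 ∧ v ∈ F2) ∧ ¬(u ∈ F1 ∧ v ∈ F3) ∧ ¬(u ∈ F2 ∧ v ∈ F3)) ∧
      F1.card ≤ 2 * N + X ∧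
      F2.card ≤ 2 * N + delta N X F1.card ∧
      F3.card ≤ 2 * N + delta N X (F1.card + F2.card) + 1 ∧
      2 * N + X ≤ F1.card + F2.card := by
  have hmin : ∃ t, t = min (Fintype.card V - 1 - 4 * N - X) X := ⟨_, rfl⟩
  obtain ⟨t, ht⟩ := hmin
  obtain ⟨s, D, hD, hDc, hDs⟩ := exists_split F hF (2 * N + t) (by omega)
  have hfin := finish F N X hX hNX hhigh s
  have huniv := goodSet_univ F s
  have hcu : (Finset.univ.erase s).card = Fintype.card V - 1 := by
    rw [Finset.card_erase_of_mem (Finset.mem_univ s), Finset.card_univ]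
  -- components outside `D`
  have hout : ∀ x, x ≠ s → x ∉ D → comp F s x ⊆ Finset.univ.erase s \ D := fun x hx hxD =>
    (huniv.sdiff hD).comp_subset (by simp [hx, hxD])
  have hDsub : D ⊆ Finset.univ.erase s := by
    intro x hx
    have : x ≠ s := fun h => hD.1 (h ▸ hx)
    simpa using this
  have hUc := Finset.card_sdiff_add_card_eq_card hDsub
  -- the set of admissible vertices
  have hW : ∃ W : Finset V, GoodSet F s W ∧ 2 * N + X ≤ W.card ∧
      ∀ x ∈ W, (comp F s x).card ≤ 2 * N + X ∧
        (x ∉ D → (Finset.univ.erase s \ D).card ≤ 2 * N + X) := by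
    by_cases hc : Fintype.card V - 1 - 4 * N - X ≤ X
    · refine ⟨Finset.univ.erase s, huniv, by omega, fun x hx => ?_⟩
      refine ⟨?_, fun _ => by omega⟩
      by_cases hxD : x ∈ D
      · have := hDs x hxD
        omega
      · have := Finset.card_le_card (hout x (Finset.mem_erase.1 hx).1 hxD)
        omega
    · refine ⟨D, hD, by omega, fun x hx => ⟨?_, fun h => absurd hx h⟩⟩
      have := hDs x hx
      omega
  obtain ⟨W, hWg, hWc, hWs⟩ := hW
  have hne : ∀ x ∈ W, x ≠ s := fun x hx h => hWg.1 (h ▸ hx)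
  by_cases hbig : ∃ x ∈ W, 2 * N < (comp F s x).card
  swap
  · obtain ⟨P, Q, h1, h2, h3, h4, h5, h6⟩ := greedy F s W ∅ (2 * N + X) (2 * N) hWg
      ⟨by simp, by simp⟩ (by simp) hWc (fun x hx _ => by
        by_contra h
        exact hbig ⟨x, hx, by omega⟩)
    exact hfin P Q h1 h2 h3 h4 h5 h6
  obtain ⟨x, hxW, hx⟩ := hbig
  have hgx := goodSet_comp F (hne x hxW)
  by_cases hbig2 : ∃ y ∈ W, y ∉ comp F s x ∧ 2 * N < (comp F s y).card
  swap
  · obtain ⟨P, Q, h1, h2, h3, h4, h5, h6⟩ := greedy F s W (comp F s x) (2 * N + X) (2 * N) hWg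
      hgx (hWs x hxW).1 hWc (fun y hy hyx => by
        by_contra h
        exact hbig2 ⟨y, hy, hyx, by omega⟩)
    exact hfin P Q h1 h2 h3 h4 h5 h6
  obtain ⟨y, hyW, hyx, hy⟩ := hbig2
  have hgy := goodSet_comp F (hne y hyW)
  have hdxy := hgx.comp_disjoint hyx
  -- two big components, one of which lies in `D`
  have two : ∀ c d : Finset V, GoodSet F s c → GoodSet F s d → Disjoint c d →
      2 * N < c.card → 2 * N < d.card → c.card ≤ 2 * N + t → d.card ≤ 2 * N + X →
      ∃ P Q : Finset V, GoodSet F s P ∧ GoodSet F s Q ∧ Disjoint P Q ∧ P.card ≤ 2 * N + X ∧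
      Q.card ≤ 2 * N ∧ 2 * N + X ≤ P.card + Q.card := by
    intro c d hc hd hcd hc1 hd1 hc2 hd2
    have hg := hc.union hd
    have hsub : c ∪ d ⊆ Finset.univ.erase s := by
      intro z hz
      have : z ≠ s := fun h => hg.1 (h ▸ hz)
      simpa using this
    have hcr := Finset.card_sdiff_add_card_eq_card hsub
    rw [Finset.card_union_of_disjoint hcd] at hcr
    refine ⟨d, Finset.univ.erase s \ (c ∪ d), hd, huniv.sdiff hg, ?_, hd2, by omega, by omega⟩
    exact Finset.disjoint_of_subset_left Finset.subset_union_right Finset.disjoint_sdiff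
  have hfinal : ∃ P Q : Finset V, GoodSet F s P ∧ GoodSet F s Q ∧ Disjoint P Q ∧
      P.card ≤ 2 * N + X ∧ Q.card ≤ 2 * N ∧ 2 * N + X ≤ P.card + Q.card := by
    by_cases hxD : x ∈ D
    · exact two _ _ hgx hgy hdxy hx hy (hDs x hxD) (hWs y hyW).1
    by_cases hyD : y ∈ D
    · exact two _ _ hgy hgx hdxy.symm hy hx (hDs y hyD) (hWs x hxW).1
    exfalso
    have h1 := Finset.card_le_card
      (Finset.union_subset (hout x (hne x hxW) hxD) (hout y (hne y hyW) hyD))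
    rw [Finset.card_union_of_disjoint hdxy] at h1
    have h2 := (hWs x hxW).2 hxD
    omega
  obtain ⟨P, Q, h1, h2, h3, h4, h5, h6⟩ := hfinal
  exact hfin P Q h1 h2 h3 h4 h5 h6
end

section
/- Let X, N be integers with X > 0 and N ≥ X, and let F be a forest with 5N + X + 3 ≤ |F| ≤ 8N + X + 3. Define I_i = 1 if |F| = 8N + X + 3 and i = 6, and I_i = 0 otherwise. Then there exists a vertex s_1 of F and a partition of F minus s_1 into parts F_1, F_2, F_4, F̄, and a vertex s_2 of F̄ and a partition of F̄ minus s_2 into parts F_3, F_5, F_6, such that |F_1| ≤ 2N + X, |F_1| + |F_2| ≥ (3/2)·N + X, and |F_i| ≤ 2N + Δ(|F_1| + ⋯ + |F_{i−1}|) + I_i for every i with 2 ≤ i ≤ 6. -/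
/-- `A` is a union of components of `F[U] - s`. -/
def ClosedPart {V : Type} (F : SimpleGraph V) (U : Finset V) (s : V) (A : Finset V) : Prop :=
  A ⊆ U ∧ s ∉ A ∧ ∀ x ∈ A, ∀ y ∈ U, F.Adj x y → y ∈ A ∨ y = s

/-- `A` has a single vertex through which it is attached to the rest of `U`. -/
def Branch {V : Type} (F : SimpleGraph V) (U : Finset V) (A : Finset V) : Prop :=
  ∃ b ∈ A, ∀ x ∈ A, ∀ y ∈ U, y ∉ A → F.Adj x y → x = b

lemma ClosedPart.empty {V : Type} (F : SimpleGraph V) (U : Finset V) (s : V) :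
    ClosedPart F U s ∅ := by
  refine ⟨by simp, by simp, by simp⟩

lemma ClosedPart.biUnion {V : Type} [DecidableEq V] {F : SimpleGraph V} {U : Finset V} {s : V}
    {S : Finset (Finset V)} (h : ∀ p ∈ S, ClosedPart F U s p) :
    ClosedPart F U s (S.biUnion id) := by
  refine ⟨?_, ?_, ?_⟩
  · intro x hx
    simp only [Finset.mem_biUnion, id] at hx
    obtain ⟨p, hp, hx⟩ := hx
    exact (h p hp).1 hx
  · intro hx
    simp only [Finset.mem_biUnion, id] at hx
    obtain ⟨p, hp, hx⟩ := hx
    exact (h p hp).2.1 hx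
  · intro x hx y hy hxy
    simp only [Finset.mem_biUnion, id] at hx ⊢
    obtain ⟨p, hp, hx⟩ := hx
    rcases (h p hp).2.2 x hx y hy hxy with h1 | h1
    · exact Or.inl ⟨p, hp, h1⟩
    · exact Or.inr h1

lemma ClosedPart.union {V : Type} [DecidableEq V] {F : SimpleGraph V} {U : Finset V} {s : V}
    {A B : Finset V} (hA : ClosedPart F U s A) (hB : ClosedPart F U s B) :
    ClosedPart F U s (A ∪ B) := by
  obtain ⟨a1, a2, a3⟩ := hA
  obtain ⟨b1, b2, b3⟩ := hB
  refine ⟨Finset.union_subset a1 b1, by simp [a2, b2], ?_⟩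
  intro x hx y hy hxy
  rw [Finset.mem_union] at hx ⊢
  rcases hx with hx | hx
  · have := a3 x hx y hy hxy
    tauto
  · have := b3 x hx y hy hxy
    tauto

lemma ClosedPart.compl {V : Type} [DecidableEq V] {F : SimpleGraph V} {U : Finset V} {s : V}
    {A : Finset V} (hA : ClosedPart F U s A) :
    ClosedPart F U s (U.erase s \ A) := by
  obtain ⟨a1, a2, a3⟩ := hA
  refine ⟨?_, by simp, ?_⟩
  · intro x hx
    simp only [Finset.mem_sdiff, Finset.mem_erase] at hx
    exact hx.1.2
  · intro x hx y hy hxy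
    simp only [Finset.mem_sdiff, Finset.mem_erase] at hx ⊢
    by_cases hys : y = s
    · exact Or.inr hys
    · left
      refine ⟨⟨hys, hy⟩, fun hyA => ?_⟩
      rcases a3 y hyA x hx.1.2 hxy.symm with h | h
      · exact hx.2 h
      · exact hx.1.1 h

lemma ClosedPart.card_compl {V : Type} [DecidableEq V] {F : SimpleGraph V} {U : Finset V} {s : V}
    {A : Finset V} (hA : ClosedPart F U s A) (hs : s ∈ U) :
    (U.erase s \ A).card + A.card + 1 = U.card := by
  have hsub : A ⊆ U.erase s := by
    intro x hx
    rw [Finset.mem_erase]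
    exact ⟨fun h => hA.2.1 (h ▸ hx), hA.1 hx⟩
  have h1 := Finset.card_sdiff_add_card_eq_card hsub
  have h2 := Finset.card_erase_add_one hs
  omega

/-- In an acyclic graph, two neighbours of `b` that are joined by a walk avoiding `b` coincide. -/
lemma acyclic_attach {V : Type} {F H : SimpleGraph V} (hF : F.IsAcyclic) (hle : H ≤ F)
    {b x x' : V} (hb : ∀ y, ¬ H.Adj b y) (hx : F.Adj b x) (hx' : F.Adj b x')
    (hr : H.Reachable x x') : x = x' := by
  classical
  by_contra hne
  obtain ⟨w⟩ := hr
  have hbw : ∀ {u v : V} (w : H.Walk u v), u ≠ b → b ∉ w.support := by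
    intro u v w
    induction w with
    | nil => intro h; simpa using h.symm
    | cons hadj q ih =>
      intro h
      rw [SimpleGraph.Walk.support_cons, List.mem_cons, not_or]
      refine ⟨h.symm, ih ?_⟩
      rintro rfl
      exact hb _ hadj.symm
  have hp1 : (w.toPath.1.mapLe hle).IsPath := by
    rw [SimpleGraph.Walk.isPath_mapLe]
    exact w.toPath.2
  have hbx : b ∉ (w.toPath.1.mapLe hle).support := by
    rw [SimpleGraph.Walk.support_mapLe_eq_support]
    exact hbw _ hx.ne'
  let q : F.Walk x x' := SimpleGraph.Walk.cons hx.symm (SimpleGraph.Walk.cons hx' SimpleGraph.Walk.nil)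
  have hq : q.IsPath := by
    simp [q, SimpleGraph.Walk.cons_isPath_iff, hx.ne', hx'.ne, hne]
  have := (hF.subsingleton_path x x').elim ⟨_, hp1⟩ ⟨q, hq⟩
  have h2 : (w.toPath.1.mapLe hle) = q := congrArg Subtype.val this
  rw [h2] at hbx
  simp [q] at hbx

lemma exists_cut_aux {V : Type} [DecidableEq V] {F : SimpleGraph V} (hF : F.IsAcyclic)
    (U : Finset V) (m : ℕ) : ∀ (n : ℕ) (B : Finset V), B.card = n → B ⊆ U → Branch F U B →
      m + 1 ≤ B.card →
      ∃ (s : V) (P : Finset (Finset V)), s ∈ B ∧ (∀ p ∈ P, p ⊆ B) ∧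
        (P : Set (Finset V)).PairwiseDisjoint id ∧
        (∀ p ∈ P, ClosedPart F U s p ∧ Branch F U p ∧ p.card ≤ m) ∧
        m ≤ ∑ p ∈ P, p.card := by
  classical
  intro n
  induction n using Nat.strong_induction_on with
  | _ n ih =>
  rintro B rfl hBU ⟨b, hbB, hb⟩ hcard
  let W := B.erase b
  let H : SimpleGraph V :=
    { Adj := fun u v => F.Adj u v ∧ u ∈ W ∧ v ∈ W
      symm := ⟨fun u v h => ⟨h.1.symm, h.2.2, h.2.1⟩⟩
      loopless := ⟨fun u h => F.loopless.irrefl u h.1⟩ }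
  have hle : H ≤ F := fun u v h => h.1
  have hbH : ∀ y, ¬ H.Adj b y := by
    intro y h
    have := h.2.1
    simp [W] at this
  let comp : V → Finset V := fun x => W.filter (fun y => H.Reachable x y)
  let P := W.image comp
  have hsub : ∀ p ∈ P, p ⊆ W := by
    intro p hp
    obtain ⟨x, hx, rfl⟩ := Finset.mem_image.1 hp
    exact Finset.filter_subset _ _
  have hWB : W ⊆ B := Finset.erase_subset _ _
  have hclosed : ∀ p ∈ P, ClosedPart F U b p := by
    intro p hp
    refine ⟨(hsub p hp).trans (hWB.trans hBU), fun h => ?_, ?_⟩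
    · have := hsub p hp h
      simp [W] at this
    · intro x hx y hy hxy
      have hxW := hsub p hp hx
      obtain ⟨z, hz, rfl⟩ := Finset.mem_image.1 hp
      by_cases hyb : y = b
      · exact Or.inr hyb
      left
      have hyB : y ∈ B := by
        by_contra hyB
        have := hb x (hWB hxW) y hy hyB hxy
        subst this
        simp [W] at hxW
      have hyW : y ∈ W := Finset.mem_erase.2 ⟨hyb, hyB⟩
      simp only [comp, Finset.mem_filter] at hx ⊢
      refine ⟨hyW, hx.2.trans ?_⟩
      exact SimpleGraph.Adj.reachable (G := H) ⟨hxy, hxW, hyW⟩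
  have hbranch : ∀ p ∈ P, Branch F U p := by
    intro p hp
    have hcl := hclosed p hp
    obtain ⟨z, hz, rfl⟩ := Finset.mem_image.1 hp
    by_cases hex : ∃ x ∈ comp z, F.Adj b x
    · obtain ⟨x, hx, hbx⟩ := hex
      refine ⟨x, hx, ?_⟩
      intro x' hx' y hy hyp hadj
      rcases hcl.2.2 x' hx' y hy hadj with h | h
      · exact absurd h hyp
      · subst h
        refine acyclic_attach hF hle hbH hadj.symm hbx ?_
        simp only [comp, Finset.mem_filter] at hx hx'
        exact hx'.2.symm.trans hx.2
    · refine ⟨z, by simp [comp, hz], ?_⟩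
      intro x' hx' y hy hyp hadj
      rcases hcl.2.2 x' hx' y hy hadj with h | h
      · exact absurd h hyp
      · subst h
        exact absurd ⟨x', hx', hadj.symm⟩ hex
  have hWc : W.card + 1 = B.card := Finset.card_erase_add_one hbB
  by_cases hall : ∀ p ∈ P, p.card ≤ m
  · have hdisj : (P : Set (Finset V)).PairwiseDisjoint id := by
      intro p hp q hq hpq
      obtain ⟨x, hx, rfl⟩ := Finset.mem_image.1 hp
      obtain ⟨y, hy, rfl⟩ := Finset.mem_image.1 hq
      rw [Function.onFun, Finset.disjoint_left]
      intro z hz1 hz2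
      apply hpq
      simp only [id, comp, Finset.mem_filter] at hz1 hz2
      ext t
      simp only [comp, Finset.mem_filter]
      constructor
      · rintro ⟨h1, h2⟩
        exact ⟨h1, hz2.2.trans (hz1.2.symm.trans h2)⟩
      · rintro ⟨h1, h2⟩
        exact ⟨h1, hz1.2.trans (hz2.2.symm.trans h2)⟩
    refine ⟨b, P, hbB, fun p hp => (hsub p hp).trans hWB, hdisj,
      fun p hp => ⟨hclosed p hp, hbranch p hp, hall p hp⟩, ?_⟩
    have h1 : (P.biUnion id).card = ∑ p ∈ P, p.card := Finset.card_biUnion hdisj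
    have h2 : W ⊆ P.biUnion id := by
      intro x hx
      rw [Finset.mem_biUnion]
      exact ⟨comp x, Finset.mem_image_of_mem _ hx, by simp [comp, hx]⟩
    have h3 := Finset.card_le_card h2
    omega
  · push Not at hall
    obtain ⟨p, hp, hpm⟩ := hall
    have hpW := Finset.card_le_card (hsub p hp)
    have hpB := (hsub p hp).trans hWB
    obtain ⟨s, Q, hs, hQ, hrest⟩ := ih p.card (by omega) p rfl (hpB.trans hBU) (hbranch p hp) (by omega)
    exact ⟨s, Q, hpB hs, fun q hq => (hQ q hq).trans hpB, hrest⟩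

lemma exists_cut {V : Type} [DecidableEq V] {F : SimpleGraph V} (hF : F.IsAcyclic)
    (U : Finset V) (m : ℕ) (hm : m + 1 ≤ U.card) :
      ∃ (s : V) (P : Finset (Finset V)), s ∈ U ∧
        (P : Set (Finset V)).PairwiseDisjoint id ∧
        (∀ p ∈ P, ClosedPart F U s p ∧ Branch F U p ∧ p.card ≤ m) ∧
        m ≤ ∑ p ∈ P, p.card := by
  obtain ⟨b, hb⟩ : U.Nonempty := by
    rw [← Finset.card_pos]; omega
  obtain ⟨s, P, h1, _, h2⟩ := exists_cut_aux hF U m U.card U rfl subset_rfl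
    ⟨b, hb, fun x _ y hy hy' => absurd hy hy'⟩ hm
  exact ⟨s, P, h1, h2⟩

lemma greedy_s7 {α : Type} [DecidableEq α] (w : α → ℕ) (M : ℕ) (C S0 : Finset α) (hS : S0 ⊆ C)
    (h0 : ∑ p ∈ S0, w p < M) (h1 : M ≤ ∑ p ∈ C, w p) :
    ∃ S c, S0 ⊆ S ∧ S ⊆ C ∧ c ∈ C ∧ c ∉ S ∧ ∑ p ∈ S, w p < M ∧ M ≤ ∑ p ∈ S, w p + w c := by
  by_contra hcon
  push Not at hcon
  have key : ∀ D : Finset α, D ⊆ C → ∑ p ∈ S0 ∪ D, w p < M := by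
    intro D
    induction D using Finset.induction_on with
    | empty => intro _; simpa using h0
    | insert a D ha ih =>
      intro hD
      have h2 := ih ((Finset.subset_insert _ _).trans hD)
      have haC : a ∈ C := hD (Finset.mem_insert_self _ _)
      by_cases haS : a ∈ S0 ∪ D
      · rwa [Finset.union_insert, Finset.insert_eq_of_mem haS]
      · rw [Finset.union_insert, Finset.sum_insert haS]
        have := hcon (S0 ∪ D) a Finset.subset_union_left
          (Finset.union_subset hS ((Finset.subset_insert _ _).trans hD)) haC haS h2
        omega
  have := key C subset_rfl
  rw [Finset.union_eq_right.2 hS] at this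
  omega

lemma delta_lb {N X a j : ℕ} (hN : 0 < N) (h : X + j * N ≤ a) :
    X + (j + 1) * N ≤ a + delta N X a := by
  have hX : ¬ a < X := by
    have := Nat.zero_le (j * N)
    omega
  unfold delta
  rw [if_neg hX]
  have h1 := Nat.mod_add_div (a - X) N
  have h2 := Nat.mod_lt (a - X) hN
  have h3 : j ≤ (a - X) / N := by
    rw [Nat.le_div_iff_mul_le hN]; omega
  have h4 : N * j ≤ N * ((a - X) / N) := Nat.mul_le_mul_left _ h3
  have h5 : (j + 1) * N = N * j + N := by ring
  omega

/-- choosing sub-families -/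
lemma biUnion_disjoint {V : Type} [DecidableEq V] {P S : Finset (Finset V)} {c : Finset V}
    (hP : (P : Set (Finset V)).PairwiseDisjoint id) (hS : S ⊆ P) (hc : c ∈ P) (hcS : c ∉ S) :
    Disjoint (S.biUnion id) c := by
  rw [Finset.disjoint_biUnion_left]
  intro p hp
  exact hP (hS hp) hc (fun h => hcS (h ▸ hp))

lemma biUnion_card {V : Type} [DecidableEq V] {P S : Finset (Finset V)}
    (hP : (P : Set (Finset V)).PairwiseDisjoint id) (hS : S ⊆ P) :
    (S.biUnion id).card = ∑ p ∈ S, p.card :=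
  Finset.card_biUnion (fun _ hp _ hq h => hP (hS hp) (hS hq) h)

/-- Second cut, in the case where the first two parts reach past `2N + X`. -/
lemma second_cut {V : Type} [DecidableEq V] {F : SimpleGraph V} (hF : F.IsAcyclic)
    (U : Finset V) (N X e M : ℕ) (hX : 0 < X) (hNX : X ≤ N)
    (hlow : 5 * N + X + 3 ≤ M) (hhigh : M ≤ 8 * N + X + 3)
    (he1 : 2 * N + X ≤ e) (he2 : e ≤ 4 * N + X) (hU : U.card + e + 1 = M) :
    ∃ s ∈ U, ∃ A3 A5 : Finset V, ClosedPart F U s A3 ∧ ClosedPart F U s A5 ∧ Disjoint A3 A5 ∧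
      A3.card ≤ 2 * N + delta N X e ∧ A5.card ≤ 2 * N + delta N X (e + A3.card) ∧
      5 * N + X ≤ e + A3.card + A5.card := by
  obtain ⟨m, hm⟩ : ∃ m, m + e = 5 * N + X := ⟨5 * N + X - e, by omega⟩
  obtain ⟨k, hk⟩ : ∃ k, k + (5 * N + X + 2) = M := ⟨M - (5 * N + X + 2), by omega⟩
  have hde : 3 * N + X ≤ e + delta N X e := by
    have := delta_lb (N := N) (X := X) (a := e) (j := 2) (by omega) (by omega)
    omega
  obtain ⟨s, P, hsU, hdisj, hP, hsum⟩ := exists_cut hF U m (by omega)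
  -- generic greedy finish
  have fin1 : ∀ S0 ⊆ P, (∑ p ∈ S0, p.card < m) → (∀ p ∈ P, p ∉ S0 → p.card ≤ 2 * N) →
      ∃ s ∈ U, ∃ A3 A5 : Finset V, ClosedPart F U s A3 ∧ ClosedPart F U s A5 ∧ Disjoint A3 A5 ∧
      A3.card ≤ 2 * N + delta N X e ∧ A5.card ≤ 2 * N + delta N X (e + A3.card) ∧
      5 * N + X ≤ e + A3.card + A5.card := by
    intro S0 hS0 hlt hsmall
    obtain ⟨S, c, h1, h2, h3, h4, h5, h6⟩ := greedy_s7 Finset.card m P S0 hS0 hlt hsum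
    have hc := biUnion_card hdisj h2
    have hcs := hsmall c h3 (fun h => h4 (h1 h))
    refine ⟨s, hsU, S.biUnion id, c, ClosedPart.biUnion fun p hp => (hP p (h2 hp)).1,
      (hP c h3).1, biUnion_disjoint hdisj h2 h3 h4, ?_, ?_, ?_⟩ <;> omega
  by_cases hall : ∀ p ∈ P, p.card ≤ 2 * N
  · exact fin1 ∅ (by simp) (by simp; omega) (fun p hp _ => hall p hp)
  push Not at hall
  obtain ⟨p0, hp0, hp0'⟩ := hall
  obtain ⟨c1, hc1, hmax⟩ := Finset.exists_max_image P Finset.card ⟨p0, hp0⟩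
  have hc1big : 2 * N < c1.card := lt_of_lt_of_le hp0' (hmax p0 hp0)
  have hc1m := (hP c1 hc1).2.2
  rcases hc1m.eq_or_lt with hc1m | hc1m
  · refine ⟨s, hsU, c1, ∅, (hP c1 hc1).1, ClosedPart.empty _ _ _, by simp, ?_, by simp, ?_⟩
    · omega
    · simp; omega
  by_cases hall2 : ∀ p ∈ P, p ∉ ({c1} : Finset (Finset V)) → p.card ≤ 2 * N
  · exact fin1 {c1} (by simpa using hc1) (by simpa using hc1m) hall2
  push Not at hall2
  obtain ⟨c2, hc2, hc2', hc2big⟩ := hall2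
  have hne : c1 ≠ c2 := fun h => hc2' (by simp [h])
  have hd12 : Disjoint c1 c2 := hdisj hc1 hc2 hne
  have hle := hmax c2 hc2
  have hd1 : 5 * N + X ≤ e + c1.card + delta N X (e + c1.card) := by
    have := delta_lb (N := N) (X := X) (a := e + c1.card) (j := 4) (by omega) (by omega)
    omega
  by_cases hfit : c2.card + c1.card ≤ 2 * N + m
  · refine ⟨s, hsU, c1, c2, (hP c1 hc1).1, (hP c2 hc2).1, hd12, ?_, ?_, ?_⟩ <;> omega
  have hcl := ((hP c1 hc1).1.union (hP c2 hc2).1)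
  have hucard := Finset.card_union_of_disjoint hd12
  have hcc := hcl.card_compl hsU
  by_cases hck : c2.card ≤ k
  · refine ⟨s, hsU, c1, U.erase s \ (c1 ∪ c2), (hP c1 hc1).1, hcl.compl, ?_, ?_, ?_, ?_⟩
    · exact Finset.disjoint_sdiff.mono_left Finset.subset_union_left
    all_goals omega
  -- second option
  obtain ⟨t, Q, htc, hQc, hQdisj, hQ, hQsum⟩ := exists_cut_aux hF U k c1.card c1 rfl
    (hP c1 hc1).1.1 (hP c1 hc1).2.1 (by omega)
  have htU : t ∈ U := (hP c1 hc1).1.1 htc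
  have hQcl : ClosedPart F U t (Q.biUnion id) := ClosedPart.biUnion fun p hp => (hQ p hp).1
  have hQcard := biUnion_card hQdisj (subset_refl Q)
  have hupc := hQcl.card_compl htU
  have hQsub : Q.biUnion id ⊆ c1 := by
    rw [Finset.biUnion_subset]; exact hQc
  set up := U.erase t \ Q.biUnion id with hup
  have hupcl : ClosedPart F U t up := hQcl.compl
  have hc2up : c2 ⊆ up := by
    intro x hx
    have hx1 : x ∉ c1 := Finset.disjoint_right.1 hd12 hx
    rw [hup, Finset.mem_sdiff, Finset.mem_erase]
    exact ⟨⟨fun h => hx1 (h ▸ htc), (hP c2 hc2).1.1 hx⟩, fun h => hx1 (hQsub h)⟩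
  have hupbig := Finset.card_le_card hc2up
  have hupd : ∀ q ∈ Q, Disjoint up q := fun q hq =>
    Finset.sdiff_disjoint.mono_right (Finset.subset_biUnion_of_mem id hq)
  by_cases hupm : m ≤ up.card
  · refine ⟨t, htU, up, ∅, hupcl, ClosedPart.empty _ _ _, by simp, ?_, by simp, ?_⟩
    · omega
    · simp; omega
  by_cases hQall : ∀ q ∈ Q, q.card ≤ 2 * N
  · obtain ⟨S, c, h1, h2, h3, h4, h5, h6⟩ := greedy_s7 Finset.card (m - up.card) Q ∅ (by simp)
      (by simp; omega) (by omega)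
    have hc := biUnion_card hQdisj h2
    have hcs := hQall c h3
    have hdus : Disjoint up (S.biUnion id) := by
      rw [Finset.disjoint_biUnion_right]
      exact fun q hq => hupd q (h2 hq)
    have hcu := Finset.card_union_of_disjoint hdus
    refine ⟨t, htU, up ∪ S.biUnion id, c,
      hupcl.union (ClosedPart.biUnion fun p hp => (hQ p (h2 hp)).1),
      (hQ c h3).1, ?_, ?_, ?_, ?_⟩
    · rw [Finset.disjoint_union_left]
      exact ⟨hupd c h3, biUnion_disjoint hQdisj h2 h3 h4⟩
    all_goals omega
  push Not at hQall
  obtain ⟨d, hd, hdbig⟩ := hQall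
  have hdk := (hQ d hd).2.2
  have hcl2 := hupcl.union (hQ d hd).1
  have hcc2 := hcl2.card_compl htU
  have hcu := Finset.card_union_of_disjoint (hupd d hd)
  refine ⟨t, htU, up, U.erase t \ (up ∪ d), hupcl, hcl2.compl, ?_, ?_, ?_, ?_⟩
  · exact Finset.disjoint_sdiff.mono_left Finset.subset_union_left
  all_goals omega

/-- Second cut in the bad case. -/
lemma second_cut_bad {V : Type} [DecidableEq V] {F : SimpleGraph V} (hF : F.IsAcyclic)
    (U : Finset V) (r w : ℕ) (hr : 0 < r) (hw : 2 * r ≤ w) (hU : w + 1 ≤ U.card) :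
    ∃ s ∈ U, ∃ A3 A5 : Finset V, ClosedPart F U s A3 ∧ ClosedPart F U s A5 ∧ Disjoint A3 A5 ∧
      r ≤ A3.card ∧ A3.card ≤ w ∧ A5.card ≤ w ∧ w ≤ A3.card + A5.card := by
  obtain ⟨s, P, hsU, hdisj, hP, hsum⟩ := exists_cut hF U w hU
  obtain ⟨S0, hS0, hS0r, hS0w⟩ : ∃ S0 ⊆ P, r ≤ ∑ p ∈ S0, p.card ∧ ∑ p ∈ S0, p.card ≤ w := by
    by_cases hbig : ∃ q ∈ P, r ≤ q.card
    · obtain ⟨q, hq, hqr⟩ := hbig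
      exact ⟨{q}, by simpa using hq, by simpa using hqr, by simpa using (hP q hq).2.2⟩
    · push Not at hbig
      obtain ⟨S, c, h1, h2, h3, h4, h5, h6⟩ := greedy_s7 Finset.card r P ∅ (by simp)
        (by simpa using hr) (by omega)
      have := hbig c h3
      refine ⟨insert c S, Finset.insert_subset h3 h2, ?_⟩
      rw [Finset.sum_insert h4]
      omega
  rcases hS0w.eq_or_lt with h | h
  · have hc := biUnion_card hdisj hS0
    refine ⟨s, hsU, S0.biUnion id, ∅, ClosedPart.biUnion fun p hp => (hP p (hS0 hp)).1,
      ClosedPart.empty _ _ _, by simp, ?_, ?_, by simp, ?_⟩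
    · omega
    · omega
    · simp only [Finset.card_empty]; omega
  · obtain ⟨S, c, h1, h2, h3, h4, h5, h6⟩ := greedy_s7 Finset.card w P S0 hS0 h hsum
    have hc := biUnion_card hdisj h2
    have hcs := (hP c h3).2.2
    have hmono : ∑ p ∈ S0, p.card ≤ ∑ p ∈ S, p.card :=
      Finset.sum_le_sum_of_subset h1
    refine ⟨s, hsU, S.biUnion id, c, ClosedPart.biUnion fun p hp => (hP p (h2 hp)).1,
      (hP c h3).1, biUnion_disjoint hdisj h2 h3 h4, ?_, ?_, ?_, ?_⟩ <;> omega

/-- For `N ≥ X > 0` and a forest `F` with `5N + X + 3 ≤ |F| ≤ 8N + X + 3`, there is a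
vertex `s₁`, a partition of `F` minus `s₁` into parts `F₁, F₂, F₄, F̄`, a vertex
`s₂ ∈ F̄` and a partition of `F̄` minus `s₂` into parts `F₃, F₅, F₆`, such that
`|F₁| ≤ 2N + X`, `|F₁| + |F₂| ≥ (3/2)N + X` and
`|Fᵢ| ≤ 2N + Δ(|F₁| + ⋯ + |F_{i-1}|) + Iᵢ` for `2 ≤ i ≤ 6`, where `I₆ = 1` iff
`|F| = 8N + X + 3` and `Iᵢ = 0` otherwise. -/
theorem stmt_7 {V : Type} [Fintype V] [DecidableEq V]
    (F : SimpleGraph V) (hF : F.IsAcyclic) (N X : ℕ)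
    (hX : 0 < X) (hNX : X ≤ N)
    (hlow : 5 * N + X + 3 ≤ Fintype.card V)
    (hhigh : Fintype.card V ≤ 8 * N + X + 3) :
    ∃ (s1 : V) (F1 F2 F4 Fbar : Finset V) (s2 : V) (F3 F5 F6 : Finset V),
      -- partition of F minus s₁ into F₁, F₂, F₄, F̄
      (Disjoint F1 F2 ∧ Disjoint F1 F4 ∧ Disjoint F1 Fbar ∧
        Disjoint F2 F4 ∧ Disjoint F2 Fbar ∧ Disjoint F4 Fbar) ∧
      F1 ∪ F2 ∪ F4 ∪ Fbar = Finset.univ.erase s1 ∧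
      (∀ u v : V, F.Adj u v →
        ¬(u ∈ F1 ∧ v ∈ F2) ∧ ¬(u ∈ F1 ∧ v ∈ F4) ∧ ¬(u ∈ F1 ∧ v ∈ Fbar) ∧
        ¬(u ∈ F2 ∧ v ∈ F4) ∧ ¬(u ∈ F2 ∧ v ∈ Fbar) ∧ ¬(u ∈ F4 ∧ v ∈ Fbar)) ∧
      -- partition of F̄ minus s₂ into F₃, F₅, F₆
      s2 ∈ Fbar ∧
      (Disjoint F3 F5 ∧ Disjoint F3 F6 ∧ Disjoint F5 F6) ∧
      F3 ∪ F5 ∪ F6 = Fbar.erase s2 ∧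
      (∀ u v : V, F.Adj u v →
        ¬(u ∈ F3 ∧ v ∈ F5) ∧ ¬(u ∈ F3 ∧ v ∈ F6) ∧ ¬(u ∈ F5 ∧ v ∈ F6)) ∧
      -- size conditions
      F1.card ≤ 2 * N + X ∧
      ((3 : ℝ) / 2 * N + X ≤ (F1.card : ℝ) + (F2.card : ℝ)) ∧
      F2.card ≤ 2 * N + delta N X F1.card ∧
      F3.card ≤ 2 * N + delta N X (F1.card + F2.card) ∧
      F4.card ≤ 2 * N + delta N X (F1.card + F2.card + F3.card) ∧
      F5.card ≤ 2 * N + delta N X (F1.card + F2.card + F3.card + F4.card) ∧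
      F6.card ≤ 2 * N + delta N X (F1.card + F2.card + F3.card + F4.card + F5.card)
        + (if Fintype.card V = 8 * N + X + 3 then 1 else 0) := by
  classical
  have hN : 0 < N := by omega
  -- assembling
  have assemble : ∀ (s1 : V) (A1 A2 A4 : Finset V), ClosedPart F Finset.univ s1 A1 →
      ClosedPart F Finset.univ s1 A2 → ClosedPart F Finset.univ s1 A4 →
      Disjoint A1 A2 → Disjoint A1 A4 → Disjoint A2 A4 →
      A1.card ≤ 2 * N + X → 3 * N + 2 * X ≤ 2 * (A1.card + A2.card) →
      A2.card ≤ 2 * N + delta N X A1.card →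
      (∃ s2 ∈ (Finset.univ.erase s1 \ (A1 ∪ A2 ∪ A4)), ∃ A3 A5 : Finset V,
        ClosedPart F (Finset.univ.erase s1 \ (A1 ∪ A2 ∪ A4)) s2 A3 ∧
        ClosedPart F (Finset.univ.erase s1 \ (A1 ∪ A2 ∪ A4)) s2 A5 ∧ Disjoint A3 A5 ∧
        A3.card ≤ 2 * N + delta N X (A1.card + A2.card) ∧
        A4.card ≤ 2 * N + delta N X (A1.card + A2.card + A3.card) ∧
        A5.card ≤ 2 * N + delta N X (A1.card + A2.card + A3.card + A4.card) ∧
        5 * N + X ≤ A1.card + A2.card + A3.card + A4.card + A5.card) →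
      ∃ (s1 : V) (F1 F2 F4 Fbar : Finset V) (s2 : V) (F3 F5 F6 : Finset V),
      (Disjoint F1 F2 ∧ Disjoint F1 F4 ∧ Disjoint F1 Fbar ∧
        Disjoint F2 F4 ∧ Disjoint F2 Fbar ∧ Disjoint F4 Fbar) ∧
      F1 ∪ F2 ∪ F4 ∪ Fbar = Finset.univ.erase s1 ∧
      (∀ u v : V, F.Adj u v →
        ¬(u ∈ F1 ∧ v ∈ F2) ∧ ¬(u ∈ F1 ∧ v ∈ F4) ∧ ¬(u ∈ F1 ∧ v ∈ Fbar) ∧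
        ¬(u ∈ F2 ∧ v ∈ F4) ∧ ¬(u ∈ F2 ∧ v ∈ Fbar) ∧ ¬(u ∈ F4 ∧ v ∈ Fbar)) ∧
      s2 ∈ Fbar ∧
      (Disjoint F3 F5 ∧ Disjoint F3 F6 ∧ Disjoint F5 F6) ∧
      F3 ∪ F5 ∪ F6 = Fbar.erase s2 ∧
      (∀ u v : V, F.Adj u v →
        ¬(u ∈ F3 ∧ v ∈ F5) ∧ ¬(u ∈ F3 ∧ v ∈ F6) ∧ ¬(u ∈ F5 ∧ v ∈ F6)) ∧
      F1.card ≤ 2 * N + X ∧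
      ((3 : ℝ) / 2 * N + X ≤ (F1.card : ℝ) + (F2.card : ℝ)) ∧
      F2.card ≤ 2 * N + delta N X F1.card ∧
      F3.card ≤ 2 * N + delta N X (F1.card + F2.card) ∧
      F4.card ≤ 2 * N + delta N X (F1.card + F2.card + F3.card) ∧
      F5.card ≤ 2 * N + delta N X (F1.card + F2.card + F3.card + F4.card) ∧
      F6.card ≤ 2 * N + delta N X (F1.card + F2.card + F3.card + F4.card + F5.card)
        + (if Fintype.card V = 8 * N + X + 3 then 1 else 0) := by
    intro s1 A1 A2 A4 c1 c2 c4 d12 d14 d24 b1 b12 b2 hex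
    obtain ⟨s2, hs2, A3, A5, c3, c5, d35, b3, b4, b5, b6⟩ := hex
    have c124 := (c1.union c2).union c4
    have e1 := c124.card_compl (Finset.mem_univ s1)
    have d124 : Disjoint (A1 ∪ A2) A4 := by
      rw [Finset.disjoint_union_left]; exact ⟨d14, d24⟩
    have e2 := Finset.card_union_of_disjoint d124
    have e3 := Finset.card_union_of_disjoint d12
    have cb := c124.compl
    rw [Finset.card_univ] at e1
    set Fb := Finset.univ.erase s1 \ (A1 ∪ A2 ∪ A4) with hFb
    have c35 := c3.union c5
    have e4 := c35.card_compl hs2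
    have e5 := Finset.card_union_of_disjoint d35
    have c6 := c35.compl
    have hAsub : A1 ∪ A2 ∪ A4 ⊆ Finset.univ.erase s1 := by
      intro x hx
      rw [Finset.mem_erase]
      exact ⟨fun h => c124.2.1 (h ▸ hx), Finset.mem_univ _⟩
    have hA35 : A3 ∪ A5 ⊆ Fb.erase s2 := by
      intro x hx
      rw [Finset.mem_erase]
      exact ⟨fun h => c35.2.1 (h ▸ hx), c35.1 hx⟩
    have db : Disjoint (A1 ∪ A2 ∪ A4) Fb := Finset.disjoint_sdiff
    have d6 : Disjoint (A3 ∪ A5) (Fb.erase s2 \ (A3 ∪ A5)) := Finset.disjoint_sdiff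
    have nosep : ∀ (U : Finset V) (s : V) (A B : Finset V), ClosedPart F U s A →
        ClosedPart F U s B → Disjoint A B → ∀ u v, F.Adj u v → ¬ (u ∈ A ∧ v ∈ B) := by
      rintro U s A B hA hB hd u v huv ⟨hu, hv⟩
      rcases hA.2.2 u hu v (hB.1 hv) huv with h | h
      · exact Finset.disjoint_left.1 hd h hv
      · exact hB.2.1 (h ▸ hv)
    have d1b : Disjoint A1 Fb := db.mono_left (by intro x hx; simp [hx])
    have d2b : Disjoint A2 Fb := db.mono_left (by intro x hx; simp [hx])
    have d4b : Disjoint A4 Fb := db.mono_left (by intro x hx; simp [hx])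
    have d36 : Disjoint A3 (Fb.erase s2 \ (A3 ∪ A5)) := d6.mono_left Finset.subset_union_left
    have d56 : Disjoint A5 (Fb.erase s2 \ (A3 ∪ A5)) := d6.mono_left Finset.subset_union_right
    refine ⟨s1, A1, A2, A4, Fb, s2, A3, A5, Fb.erase s2 \ (A3 ∪ A5),
      ⟨d12, d14, d1b, d24, d2b, d4b⟩, Finset.union_sdiff_of_subset hAsub, ?_, hs2,
      ⟨d35, d36, d56⟩, Finset.union_sdiff_of_subset hA35, ?_, b1, ?_, b2, b3, b4, b5, ?_⟩
    · intro u v huv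
      exact ⟨nosep _ _ _ _ c1 c2 d12 u v huv, nosep _ _ _ _ c1 c4 d14 u v huv,
        nosep _ _ _ _ c1 cb d1b u v huv, nosep _ _ _ _ c2 c4 d24 u v huv,
        nosep _ _ _ _ c2 cb d2b u v huv, nosep _ _ _ _ c4 cb d4b u v huv⟩
    · intro u v huv
      exact ⟨nosep _ _ _ _ c3 c5 d35 u v huv, nosep _ _ _ _ c3 c6 d36 u v huv,
        nosep _ _ _ _ c5 c6 d56 u v huv⟩
    · have : (3 : ℝ) * N + 2 * X ≤ 2 * (A1.card + A2.card) := by exact_mod_cast b12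
      linarith
    · have hd := delta_lb (N := N) (X := X) (j := 5) hN (by omega :
        X + 5 * N ≤ A1.card + A2.card + A3.card + A4.card + A5.card)
      split_ifs <;> omega
  by_contra hG
  -- good case
  have good : ∀ (s1 : V) (A1 A2 : Finset V), ClosedPart F Finset.univ s1 A1 →
      ClosedPart F Finset.univ s1 A2 → Disjoint A1 A2 →
      A1.card ≤ 2 * N + X → 2 * N + X ≤ A1.card + A2.card → A1.card + A2.card ≤ 4 * N + X →
      A2.card ≤ 2 * N + delta N X A1.card → False := by
    intro s1 A1 A2 c1 c2 d12 b1 b12 b12' b2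
    refine hG (assemble s1 A1 A2 ∅ c1 c2 (ClosedPart.empty _ _ _) d12 (by simp) (by simp) b1
      (by omega) b2 ?_)
    have c124 := (c1.union c2).union (ClosedPart.empty F Finset.univ s1)
    have e1 := c124.card_compl (Finset.mem_univ s1)
    have e3 := Finset.card_union_of_disjoint d12
    rw [Finset.card_univ] at e1
    have e2 : (A1 ∪ A2 ∪ ∅).card = A1.card + A2.card := by rw [Finset.union_empty, e3]
    obtain ⟨s2, hs2, A3, A5, h1, h2, h3, h4, h5, h6⟩ := second_cut hF
      (Finset.univ.erase s1 \ (A1 ∪ A2 ∪ ∅)) N X (A1.card + A2.card) (Fintype.card V)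
      hX hNX hlow hhigh b12 b12' (by omega)
    exact ⟨s2, hs2, A3, A5, h1, h2, h3, h4, by simp, by simpa using h5, by simpa using h6⟩
  obtain ⟨s1, P, -, hdisj, hP, hsum⟩ := exists_cut hF Finset.univ (2 * N + X)
    (by rw [Finset.card_univ]; omega)
  have fin1 : ∀ S0 ⊆ P, (∑ p ∈ S0, p.card < 2 * N + X) →
      (∀ p ∈ P, p ∉ S0 → p.card ≤ 2 * N) → False := by
    intro S0 hS0 hlt hsmall
    obtain ⟨S, c, h1, h2, h3, h4, h5, h6⟩ := greedy_s7 Finset.card _ P S0 hS0 hlt hsum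
    have hc := biUnion_card hdisj h2
    have hcs := hsmall c h3 (fun h => h4 (h1 h))
    exact good s1 (S.biUnion id) c (ClosedPart.biUnion fun p hp => (hP p (h2 hp)).1)
      (hP c h3).1 (biUnion_disjoint hdisj h2 h3 h4) (by omega) (by omega) (by omega) (by omega)
  by_cases hall : ∀ p ∈ P, p.card ≤ 2 * N
  · exact fin1 ∅ (by simp) (by simp; omega) (fun p hp _ => hall p hp)
  push Not at hall
  obtain ⟨p0, hp0, hp0'⟩ := hall
  obtain ⟨c1, hc1, hmax⟩ := Finset.exists_max_image P Finset.card ⟨p0, hp0⟩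
  have hc1big : 2 * N < c1.card := lt_of_lt_of_le hp0' (hmax p0 hp0)
  have hc1m := (hP c1 hc1).2.2
  rcases hc1m.eq_or_lt with hc1m | hc1m
  · exact good s1 c1 ∅ (hP c1 hc1).1 (ClosedPart.empty _ _ _) (by simp) (by omega)
      (by simp; omega) (by simp; omega) (by simp)
  by_cases hall2 : ∀ p ∈ P, p ∉ ({c1} : Finset (Finset V)) → p.card ≤ 2 * N
  · exact fin1 {c1} (by simpa using hc1) (by simpa using hc1m) hall2
  push Not at hall2
  obtain ⟨c2, hc2, hc2', hc2big⟩ := hall2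
  have hne : c1 ≠ c2 := fun h => hc2' (by simp [h])
  have hd12 : Disjoint c1 c2 := hdisj hc1 hc2 hne
  have hle := hmax c2 hc2
  have hd1 := delta_lb (N := N) (X := X) (a := c1.card) (j := 1) hN (by omega)
  by_cases hfit : c1.card + c2.card ≤ 4 * N + X
  · exact good s1 c1 c2 (hP c1 hc1).1 (hP c2 hc2).1 hd12 (by omega) (by omega) hfit (by omega)
  -- bad case
  obtain ⟨r, hr⟩ : ∃ r, r + c1.card = 2 * N + X := ⟨2 * N + X - c1.card, by omega⟩
  obtain ⟨w, hw⟩ : ∃ w, w + c2.card = 3 * N + r := ⟨3 * N + r - c2.card, by omega⟩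
  have c124 := ((hP c1 hc1).1.union (ClosedPart.empty F Finset.univ s1)).union (hP c2 hc2).1
  have e1 := c124.card_compl (Finset.mem_univ s1)
  have e3 := Finset.card_union_of_disjoint hd12
  rw [Finset.card_univ] at e1
  have e2 : (c1 ∪ ∅ ∪ c2).card = c1.card + c2.card := by rw [Finset.union_empty, e3]
  refine hG (assemble s1 c1 ∅ c2 (hP c1 hc1).1 (ClosedPart.empty _ _ _) (hP c2 hc2).1
    (by simp) hd12 (by simp) (by omega) (by simp only [Finset.card_empty]; omega) (by simp) ?_)
  obtain ⟨s2, hs2, A3, A5, h1, h2, h3, h4, h5, h6, h7⟩ := second_cut_bad hF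
    (Finset.univ.erase s1 \ (c1 ∪ ∅ ∪ c2)) r w (by omega) (by omega) (by omega)
  refine ⟨s2, hs2, A3, A5, h1, h2, h3, ?_, ?_, ?_, ?_⟩
  · omega
  · have := delta_lb (N := N) (X := X) (a := c1.card + (∅ : Finset V).card + A3.card) (j := 2) hN
      (by simp only [Finset.card_empty]; omega)
    simp only [Finset.card_empty] at this ⊢
    omega
  · omega
  · omega
end

section
/- Let w ≥ 1 and m, M be integers with 0 ≤ m and 2m ≤ M, and let G be a graph with treewidth at most w and |G| ≥ w + 1 + M. Then there exists a set S of exactly w + 1 vertices of G and a partition of G minus S into parts G_1, G_2, G_3 such that m ≤ |G_3| ≤ M, |G_1| ≤ |G| − w − 1 − M, and |G_2| ≤ |G_1|. -/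
/-- In a tree rooted at `r`: if `t` minimises the distance to `r` along the walk `q`,
then `t` lies on every walk from `r` to the end of `q`. -/
theorem aux_top_mem {ι : Type} (T : SimpleGraph ι) (hT : T.IsTree) (r t z : ι)
    (q : T.Walk t z) (hq : ∀ x ∈ q.support, T.dist r t ≤ T.dist r x)
    (p : T.Walk r z) : t ∈ p.support := by
  classical
  obtain ⟨a, ha, hal⟩ := hT.connected.exists_path_of_dist r t
  have hpath : (a.append q.bypass).IsPath := by
    rw [SimpleGraph.Walk.isPath_def, SimpleGraph.Walk.support_append]
    have hqn : q.bypass.support.Nodup := q.bypass_isPath.support_nodup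
    refine List.Nodup.append ha.support_nodup (hqn.sublist (List.tail_sublist _)) ?_
    intro x hx hx'
    have hxt : x ≠ t := by
      rintro rfl
      rw [← SimpleGraph.Walk.cons_tail_support] at hqn
      exact (List.nodup_cons.mp hqn).1 hx'
    have h1 := hq x (q.support_bypass_subset_support (List.mem_of_mem_tail hx'))
    have h2 := SimpleGraph.dist_le (a.takeUntil x hx)
    have h3 := SimpleGraph.Walk.length_takeUntil_lt_length hx hxt
    omega
  have h := (hT.isAcyclic.subsingleton_path r z).elim ⟨_, hpath⟩ ⟨_, p.bypass_isPath⟩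
  have h' : a.append q.bypass = p.bypass := congrArg Subtype.val h
  apply p.support_bypass_subset_support
  rw [← h', SimpleGraph.Walk.mem_support_append_iff]
  simp

/-- A subtree `Y` reaching at least as high as `t` contains `t`. -/
theorem aux_top_mem' {ι : Type} (T : SimpleGraph ι) (hT : T.IsTree) (r t z y : ι)
    (q : T.Walk t z) (hq : ∀ x ∈ q.support, T.dist r t ≤ T.dist r x)
    (p : T.Walk y z) (hy : T.dist r y ≤ T.dist r t) : t ∈ p.support := by
  classical
  obtain ⟨a, ha, hal⟩ := hT.connected.exists_path_of_dist r y
  have h := aux_top_mem T hT r t z q hq (a.append p)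
  rw [SimpleGraph.Walk.mem_support_append_iff] at h
  rcases h with h | h
  · by_cases hty : t = y
    · subst hty; simp
    have h2 := SimpleGraph.dist_le (a.takeUntil t h)
    have h3 := SimpleGraph.Walk.length_takeUntil_lt_length h hty
    omega
  · exact h

/-- Walk inside an induced connected subgraph. -/
theorem aux_walk_in {ι : Type} (T : SimpleGraph ι) (X : Set ι) (h : (T.induce X).Connected)
    (x y : ι) (hx : x ∈ X) (hy : y ∈ X) : ∃ p : T.Walk x y, ∀ z ∈ p.support, z ∈ X := by
  obtain ⟨p⟩ := h.preconnected ⟨x, hx⟩ ⟨y, hy⟩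
  refine ⟨p.map (SimpleGraph.Embedding.induce X).toHom, ?_⟩
  intro z hz
  have hz' := hz
  erw [SimpleGraph.Walk.support_map, List.mem_map] at hz'
  obtain ⟨a, _, rfl⟩ := hz'
  exact a.2

/-- A good elimination ordering. -/
theorem aux_order {V : Type} [Fintype V] [DecidableEq V]
    (G : SimpleGraph V) (w : ℕ) (htw : TreewidthLE G w) :
    ∃ f : V → ℕ, Function.Injective f ∧ ∀ (D N : Finset V), D.Nonempty →
      (∀ a ∈ D, ∀ b ∈ D,
        Relation.ReflTransGen (fun u v => G.Adj u v ∧ u ∈ D ∧ v ∈ D) a b) →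
      (∀ s ∈ N, (∀ d ∈ D, f s < f d) ∧ ∃ d ∈ D, G.Adj s d) → N.card ≤ w := by
  classical
  obtain ⟨ι, _, T, B, ⟨hT, hcov, hedge, hconn⟩, hB⟩ := htw
  have := hT.connected.nonempty
  obtain ⟨r⟩ := hT.connected.nonempty
  -- the top of each vertex
  have htop : ∀ v, ∃ x, v ∈ B x ∧ ∀ y, v ∈ B y → T.dist r x ≤ T.dist r y := by
    intro v
    obtain ⟨x, hx, hmin⟩ := Finset.exists_min_image (Finset.univ.filter fun x => v ∈ B x)
      (fun x => T.dist r x) (by obtain ⟨x, hx⟩ := hcov v; exact ⟨x, by simpa using hx⟩)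
    exact ⟨x, by simpa using hx, fun y hy => hmin y (by simpa using hy)⟩
  choose top htopm htopmin using htop
  let e := Fintype.equivFin V
  let n := Fintype.card V
  have he : ∀ v, (e v : ℕ) < n := fun v => (e v).2
  let f : V → ℕ := fun v => (e v : ℕ) + n * T.dist r (top v)
  have hlt : ∀ u v, f u < f v → T.dist r (top u) ≤ T.dist r (top v) := by
    intro u v h
    by_contra hc
    push Not at hc
    have : n * (T.dist r (top v) + 1) ≤ n * T.dist r (top u) := Nat.mul_le_mul_left _ hc
    have := he v
    simp only [f] at h
    rw [Nat.mul_add] at *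
    omega
  refine ⟨f, ?_, ?_⟩
  · intro u v h
    apply e.injective
    apply Fin.ext
    have h1 : f u % n = f v % n := by rw [h]
    simpa [f, Nat.add_mul_mod_self_left, Nat.mod_eq_of_lt (he u), Nat.mod_eq_of_lt (he v)] using h1
  · intro D N hD hDc hN
    obtain ⟨d, hd, hdmin⟩ := Finset.exists_min_image D f hD
    have hdle : ∀ a ∈ D, T.dist r (top d) ≤ T.dist r (top a) := by
      intro a ha
      rcases (hdmin a ha).lt_or_eq with h | h
      · exact hlt _ _ h
      · by_cases hn : a = d
        · rw [hn]
        · exfalso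
          apply hn
          have h1 : f a % n = f d % n := by rw [h]
          apply e.injective
          apply Fin.ext
          simpa [f, Nat.add_mul_mod_self_left, Nat.mod_eq_of_lt (he a),
            Nat.mod_eq_of_lt (he d)] using h1
    -- walks from top d inside the union
    have hwalk : ∀ a, Relation.ReflTransGen (fun u v => G.Adj u v ∧ u ∈ D ∧ v ∈ D) d a →
        ∀ z, a ∈ B z → ∃ q : T.Walk (top d) z, ∀ x ∈ q.support, ∃ b ∈ D, b ∈ B x := by
      intro a ha
      induction ha with
      | refl =>
        intro z hz
        obtain ⟨p, hp⟩ := aux_walk_in T _ (hconn d) (top d) z (htopm d) hz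
        exact ⟨p, fun x hx => ⟨d, hd, hp x hx⟩⟩
      | tail _ hbc ih =>
        rename_i b c _
        intro z hz
        obtain ⟨y, hyb, hyc⟩ := hedge _ _ hbc.1
        obtain ⟨q, hq⟩ := ih y hyb
        obtain ⟨p, hp⟩ := aux_walk_in T _ (hconn c) y z hyc hz
        refine ⟨q.append p, fun x hx => ?_⟩
        rw [SimpleGraph.Walk.mem_support_append_iff] at hx
        rcases hx with hx | hx
        · exact hq x hx
        · exact ⟨c, hbc.2.2, hp x hx⟩
    have hsub : insert d N ⊆ B (top d) := by
      intro s hs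
      rcases Finset.mem_insert.mp hs with rfl | hs
      · exact htopm _
      obtain ⟨hsl, a, ha, hsa⟩ := hN s hs
      obtain ⟨z, hzs, hza⟩ := hedge _ _ hsa
      obtain ⟨q, hq⟩ := hwalk a (hDc d hd a ha) z hza
      obtain ⟨p, hp⟩ := aux_walk_in T _ (hconn s) (top s) z (htopm s) hzs
      refine hp _ (aux_top_mem' T hT r (top d) z (top s) q ?_ p (hlt _ _ (hsl d hd)))
      intro x hx
      obtain ⟨b, hb, hbx⟩ := hq x hx
      exact (hdle b hb).trans (htopmin b x hbx)
    have hdN : d ∉ N := fun h => lt_irrefl _ ((hN d h).1 d hd)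
    have h1 := Finset.card_le_card hsub
    rw [Finset.card_insert_of_notMem hdN] at h1
    have := hB (top d)
    omega

/-- Initial segments of an ordering. -/
theorem aux_initial {V : Type} [Fintype V] [DecidableEq V] (f : V → ℕ)
    (hf : Function.Injective f) (j : ℕ) (hj : j ≤ Fintype.card V) :
    ∃ S : Finset V, S.card = j ∧ ∀ s ∈ S, ∀ c ∉ S, f s < f c := by
  induction j with
  | zero => exact ⟨∅, by simp⟩
  | succ j ih =>
    obtain ⟨S, hS, hSl⟩ := ih (by omega)
    have hne : (Sᶜ).Nonempty := by
      rw [← Finset.card_pos, Finset.card_compl]; omega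
    obtain ⟨d, hd, hmin⟩ := Finset.exists_min_image _ f hne
    rw [Finset.mem_compl] at hd
    refine ⟨insert d S, by rw [Finset.card_insert_of_notMem hd, hS], ?_⟩
    intro s hs c hc
    simp only [Finset.mem_insert, not_or] at hs hc
    rcases hs with rfl | hs
    · exact lt_of_le_of_ne (hmin c (by simpa using hc.2)) (fun h => hc.1 (hf h).symm)
    · exact hSl s hs c hc.2

theorem aux_symm {V : Type} (R : V → V → Prop) (h : ∀ u v, R u v → R v u) (a b : V)
    (hab : Relation.ReflTransGen R a b) : Relation.ReflTransGen R b a := by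
  induction hab with
  | refl => exact .refl
  | tail _ hbc ih => exact Relation.ReflTransGen.head (h _ _ hbc) ih

/-- Descent: a separator below which all components are small. -/
theorem aux_descent {V : Type} [Fintype V] [DecidableEq V] (G : SimpleGraph V) (w K : ℕ)
    (f : V → ℕ) (hf : Function.Injective f)
    (hord : ∀ (D N : Finset V), D.Nonempty →
      (∀ a ∈ D, ∀ b ∈ D,
        Relation.ReflTransGen (fun u v => G.Adj u v ∧ u ∈ D ∧ v ∈ D) a b) →
      (∀ s ∈ N, (∀ d ∈ D, f s < f d) ∧ ∃ d ∈ D, G.Adj s d) → N.card ≤ w) (j : ℕ) :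
    ∀ (S C : Finset V), C.card ≤ j → S.card = w + 1 → (∀ s ∈ S, ∀ c ∈ C, f s < f c) →
      (∀ u v, G.Adj u v → u ∈ C → v ∈ C ∨ v ∈ S) → K ≤ C.card →
    ∃ (S C : Finset V) (Q : Type) (g : V → Q), S.card = w + 1 ∧ Disjoint S C ∧
      (∀ u v, G.Adj u v → u ∈ C → v ∈ C ∨ v ∈ S) ∧ K ≤ C.card ∧
      (∀ u v, G.Adj u v → u ∈ C → v ∈ C → g u = g v) ∧
      ∀ a : V, a ∈ C → ∀ D : Finset V, (∀ d ∈ D, d ∈ C ∧ g d = g a) → D.card ≤ K := by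
  classical
  induction j with
  | zero =>
    intro S C hC hS hlt hadj hK
    have : C = ∅ := by simpa using hC
    subst this
    exact ⟨S, ∅, Unit, fun _ => (), hS, by simp, by simp, hK, by simp, by simp⟩
  | succ j ih =>
    intro S C hC hS hlt hadj hK
    let R : V → V → Prop := fun u v => G.Adj u v ∧ u ∈ C ∧ v ∈ C
    have hRs := aux_symm R (fun u v h => ⟨h.1.symm, h.2.2, h.2.1⟩)
    let st : Setoid V := ⟨Relation.ReflTransGen R, fun _ => .refl,
      fun h => hRs _ _ h, fun h h' => h.trans h'⟩
    by_cases hall : ∀ a : V, a ∈ C → ∀ D : Finset V,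
        (∀ d ∈ D, d ∈ C ∧ Quotient.mk st d = Quotient.mk st a) → D.card ≤ K
    · refine ⟨S, C, Quotient st, Quotient.mk st, hS, ?_, hadj, hK, ?_, hall⟩
      · rw [Finset.disjoint_left]
        exact fun s hs hc => lt_irrefl _ (hlt s hs s hc)
      · intro u v h hu hv
        exact Quotient.sound (Relation.ReflTransGen.single ⟨h, hu, hv⟩)
    push Not at hall
    obtain ⟨a, ha, D0, hD0, hD0K⟩ := hall
    let D := C.filter fun d => Relation.ReflTransGen R a d
    have hDC : D ⊆ C := Finset.filter_subset _ _
    have hDK : K < D.card := by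
      refine hD0K.trans_le (Finset.card_le_card fun d hd => ?_)
      have := hD0 d hd
      exact Finset.mem_filter.mpr ⟨this.1,
        hRs _ _ (Quotient.exact this.2)⟩
    have hDstep : ∀ u v, u ∈ D → G.Adj u v → v ∈ C → v ∈ D := by
      intro u v hu h hv
      have := Finset.mem_filter.mp hu
      exact Finset.mem_filter.mpr ⟨hv, this.2.tail ⟨h, this.1, hv⟩⟩
    have haD : a ∈ D := Finset.mem_filter.mpr ⟨ha, .refl⟩
    have hreach : ∀ b, Relation.ReflTransGen R a b →
        b ∈ D ∧ Relation.ReflTransGen (fun u v => G.Adj u v ∧ u ∈ D ∧ v ∈ D) a b := by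
      intro b hb
      induction hb with
      | refl => exact ⟨haD, .refl⟩
      | tail _ h ih =>
        have := hDstep _ _ ih.1 h.1 h.2.2
        exact ⟨this, ih.2.tail ⟨h.1, ih.1, this⟩⟩
    have hDconn : ∀ a ∈ D, ∀ b ∈ D,
        Relation.ReflTransGen (fun u v => G.Adj u v ∧ u ∈ D ∧ v ∈ D) a b := by
      intro b hb c hc
      have h1 := (hreach b (Finset.mem_filter.mp hb).2).2
      have h2 := (hreach c (Finset.mem_filter.mp hc).2).2
      have hs := aux_symm (fun u v => G.Adj u v ∧ u ∈ D ∧ v ∈ D)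
        (fun u v h => ⟨h.1.symm, h.2.2, h.2.1⟩)
      exact (hs _ _ h1).trans h2
    let N := S.filter fun s => ∃ d ∈ D, G.Adj s d
    have hNw : N.card ≤ w := by
      refine hord D N ⟨a, haD⟩ hDconn fun s hs => ?_
      have := Finset.mem_filter.mp hs
      exact ⟨fun d hd => hlt s this.1 d (hDC hd), this.2⟩
    obtain ⟨S0, hNS0, hS0S, hS0⟩ := Finset.exists_subsuperset_card_eq
      (Finset.filter_subset _ _ : N ⊆ S) hNw (by omega)
    obtain ⟨d, hd, hmin⟩ := Finset.exists_min_image D f ⟨a, haD⟩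
    have hdS0 : d ∉ S0 := fun h => lt_irrefl _ (hlt d (hS0S h) d (hDC hd))
    have hcard := Finset.card_erase_of_mem hd
    have hDc := Finset.card_le_card hDC
    refine ih (insert d S0) (D.erase d) (by omega)
      (by rw [Finset.card_insert_of_notMem hdS0, hS0]) ?_ ?_ (by omega)
    · intro s hs c hc
      rw [Finset.mem_erase] at hc
      rcases Finset.mem_insert.mp hs with rfl | hs
      · exact lt_of_le_of_ne (hmin c hc.2) fun h => hc.1 (hf h).symm
      · exact hlt s (hS0S hs) c (hDC hc.2)
    · intro u v h hu
      rw [Finset.mem_erase] at hu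
      by_cases hvd : v = d
      · right; simp [hvd]
      rcases hadj u v h (hDC hu.2) with hv | hv
      · left; exact Finset.mem_erase.mpr ⟨hvd, hDstep u v hu.2 h hv⟩
      · right
        exact Finset.mem_insert_of_mem (hNS0 (Finset.mem_filter.mpr ⟨hv, u, hu.2, h.symm⟩))

/-- Greedy choice of two groups of pieces. -/
theorem aux_greedy {V Q : Type} [DecidableEq V] (C : Finset V) (g : V → Q) (k L : ℕ)
    (hk : ∀ a ∈ C, ∀ D : Finset V, (∀ d ∈ D, d ∈ C ∧ g d = g a) → D.card ≤ k)
    (hL : ∀ a ∈ C, ∀ D : Finset V, (∀ d ∈ D, d ∈ C ∧ g d = g a) → D.card ≤ L)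
    (hC : k ≤ C.card) :
    ∃ A B : Finset V, A ⊆ C ∧ B ⊆ C ∧ Disjoint A B ∧ A.card ≤ k ∧ B.card ≤ k ∧ B.card ≤ L ∧
      k ≤ A.card + B.card ∧
      ∀ u ∈ C, ∀ v ∈ C, g u = g v → (u ∈ A ↔ v ∈ A) ∧ (u ∈ B ↔ v ∈ B) := by
  classical
  have main : ∀ P : Finset Q, k ≤ (C.filter fun v => g v ∈ P).card →
      ∃ A B : Finset V, A ⊆ C ∧ B ⊆ C ∧ Disjoint A B ∧ A.card ≤ k ∧ B.card ≤ k ∧ B.card ≤ L ∧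
      k ≤ A.card + B.card ∧
      ∀ u ∈ C, ∀ v ∈ C, g u = g v → (u ∈ A ↔ v ∈ A) ∧ (u ∈ B ↔ v ∈ B) := by
    intro P
    induction P using Finset.induction_on with
    | empty =>
      intro h
      exact ⟨∅, ∅, by simp, by simp, by simp, by simp, by simp, by simp, by simpa using h,
        by simp⟩
    | insert q P hq ih =>
      intro h
      by_cases h' : k ≤ (C.filter fun v => g v ∈ P).card
      · exact ih h'
      refine ⟨C.filter fun v => g v ∈ P, C.filter fun v => g v = q, Finset.filter_subset _ _,
        Finset.filter_subset _ _, ?_, by omega, ?_, ?_, ?_, ?_⟩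
      · rw [Finset.disjoint_left]
        intro v hv hv'
        simp only [Finset.mem_filter] at hv hv'
        exact hq (hv'.2 ▸ hv.2)
      · rcases (C.filter fun v => g v = q).eq_empty_or_nonempty with h0 | ⟨a, ha⟩
        · simp [h0]
        · simp only [Finset.mem_filter] at ha
          exact hk a ha.1 _ (by intro d hd; simp only [Finset.mem_filter] at hd; exact ⟨hd.1, hd.2.trans ha.2.symm⟩)
      · rcases (C.filter fun v => g v = q).eq_empty_or_nonempty with h0 | ⟨a, ha⟩
        · simp [h0]
        · simp only [Finset.mem_filter] at ha
          exact hL a ha.1 _ (by intro d hd; simp only [Finset.mem_filter] at hd; exact ⟨hd.1, hd.2.trans ha.2.symm⟩)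
      · refine h.trans ((Finset.card_le_card ?_).trans (Finset.card_union_le _ _))
        intro v hv
        simp only [Finset.mem_filter, Finset.mem_insert, Finset.mem_union] at hv ⊢
        tauto
      · intro u hu v hv huv
        simp [hu, hv, huv]
  refine main (C.image g) ?_
  rwa [Finset.filter_true_of_mem fun v hv => Finset.mem_image_of_mem g hv]

set_option maxHeartbeats 1000000 in
/-- Separator lemma for treewidth: for `w ≥ 1`, `0 ≤ m`, `2m ≤ M` and a graph `G` with
treewidth at most `w` and `|G| ≥ w + 1 + M`, there is a set `S` of exactly `w + 1`
vertices and a partition of `G` minus `S` into parts `G₁, G₂, G₃` (pairwise disjoint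
vertex sets covering all vertices outside `S`, with no edge of `G` between different
parts) with `m ≤ |G₃| ≤ M`, `|G₁| ≤ |G| - w - 1 - M` and `|G₂| ≤ |G₁|`. -/
theorem stmt_9 {V : Type} [Fintype V] [DecidableEq V]
    (G : SimpleGraph V) (w : ℕ) (hw : 1 ≤ w) (htw : TreewidthLE G w)
    (m M : ℕ) (hmM : 2 * m ≤ M)
    (hcard : w + 1 + M ≤ Fintype.card V) :
    ∃ (S G1 G2 G3 : Finset V), S.card = w + 1 ∧
      Disjoint G1 G2 ∧ Disjoint G1 G3 ∧ Disjoint G2 G3 ∧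
      G1 ∪ G2 ∪ G3 = Finset.univ \ S ∧
      (∀ u v : V, G.Adj u v →
        ¬(u ∈ G1 ∧ v ∈ G2) ∧ ¬(u ∈ G1 ∧ v ∈ G3) ∧ ¬(u ∈ G2 ∧ v ∈ G3)) ∧
      m ≤ G3.card ∧ G3.card ≤ M ∧
      G1.card ≤ Fintype.card V - w - 1 - M ∧
      G2.card ≤ G1.card := by
  classical
  -- assembling
  have key : ∀ S A B Z : Finset V, S.card = w + 1 →
      Disjoint A B → Disjoint A Z → Disjoint B Z → A ∪ B ∪ Z = Finset.univ \ S →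
      (∀ u v, G.Adj u v → u ∉ S → v ∉ S → (u ∈ A ↔ v ∈ A) ∧ (u ∈ B ↔ v ∈ B) ∧ (u ∈ Z ↔ v ∈ Z)) →
      m ≤ Z.card → Z.card ≤ M → A.card ≤ Fintype.card V - w - 1 - M →
      B.card ≤ Fintype.card V - w - 1 - M →
      ∃ (S G1 G2 G3 : Finset V), S.card = w + 1 ∧
      Disjoint G1 G2 ∧ Disjoint G1 G3 ∧ Disjoint G2 G3 ∧
      G1 ∪ G2 ∪ G3 = Finset.univ \ S ∧
      (∀ u v : V, G.Adj u v →
        ¬(u ∈ G1 ∧ v ∈ G2) ∧ ¬(u ∈ G1 ∧ v ∈ G3) ∧ ¬(u ∈ G2 ∧ v ∈ G3)) ∧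
      m ≤ G3.card ∧ G3.card ≤ M ∧
      G1.card ≤ Fintype.card V - w - 1 - M ∧
      G2.card ≤ G1.card := by
    intro S A B Z hS hAB hAZ hBZ hU hE hm hM hA hB
    have hmem : ∀ v, (v ∈ A ∨ v ∈ B ∨ v ∈ Z) → v ∉ S := by
      intro v hv
      have : v ∈ A ∪ B ∪ Z := by simpa [or_assoc] using hv
      rw [hU] at this
      simpa using this
    have hAB' := Finset.disjoint_left.mp hAB
    have hAZ' := Finset.disjoint_left.mp hAZ
    have hBZ' := Finset.disjoint_left.mp hBZ
    rcases le_total B.card A.card with h | h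
    · refine ⟨S, A, B, Z, hS, hAB, hAZ, hBZ, hU, ?_, hm, hM, hA, h⟩
      intro u v huv
      have hE' := hE u v huv
      have hu := hmem u
      have hv := hmem v
      refine ⟨fun h => ?_, fun h => ?_, fun h => ?_⟩
      · exact hAB' ((hE' (hu (by simp [h.1])) (hv (by simp [h.2]))).1.mp h.1) h.2
      · exact hAZ' ((hE' (hu (by simp [h.1])) (hv (by simp [h.2]))).1.mp h.1) h.2
      · exact hBZ' ((hE' (hu (by simp [h.1])) (hv (by simp [h.2]))).2.1.mp h.1) h.2
    · refine ⟨S, B, A, Z, hS, hAB.symm, hBZ, hAZ, by rw [Finset.union_comm B A, hU], ?_,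
        hm, hM, hB, h⟩
      intro u v huv
      have hE' := hE u v huv
      have hu := hmem u
      have hv := hmem v
      refine ⟨fun h => ?_, fun h => ?_, fun h => ?_⟩
      · exact hAB' h.2 ((hE' (hu (by simp [h.1])) (hv (by simp [h.2]))).2.1.mp h.1)
      · exact hBZ' ((hE' (hu (by simp [h.1])) (hv (by simp [h.2]))).2.1.mp h.1) h.2
      · exact hAZ' ((hE' (hu (by simp [h.1])) (hv (by simp [h.2]))).1.mp h.1) h.2
  -- assembling from two closed sets
  have key2 : ∀ S A B : Finset V, S.card = w + 1 → Disjoint S A → Disjoint S B → Disjoint A B →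
      (∀ u v, G.Adj u v → u ∉ S → v ∉ S → (u ∈ A ↔ v ∈ A) ∧ (u ∈ B ↔ v ∈ B)) →
      ∃ Z : Finset V, Disjoint A Z ∧ Disjoint B Z ∧ A ∪ B ∪ Z = Finset.univ \ S ∧
      Z.card + A.card + B.card + (w + 1) = Fintype.card V ∧ Z = Finset.univ \ (S ∪ A ∪ B) ∧
      (∀ u v, G.Adj u v → u ∉ S → v ∉ S →
        (u ∈ A ↔ v ∈ A) ∧ (u ∈ B ↔ v ∈ B) ∧ (u ∈ Z ↔ v ∈ Z)) := by
    intro S A B hS hSA hSB hAB hE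
    have hSA' := Finset.disjoint_left.mp hSA
    have hSB' := Finset.disjoint_left.mp hSB
    refine ⟨Finset.univ \ (S ∪ A ∪ B), ?_, ?_, ?_, ?_, rfl, ?_⟩
    · rw [Finset.disjoint_left]; intro v; simp; tauto
    · rw [Finset.disjoint_left]; intro v; simp; tauto
    · ext v
      have := @hSA' v
      have := @hSB' v
      simp; tauto
    · have h1 : (S ∪ A ∪ B).card = S.card + A.card + B.card := by
        rw [Finset.card_union_of_disjoint (Finset.disjoint_union_left.mpr ⟨hSB, hAB⟩),
          Finset.card_union_of_disjoint hSA]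
      have h2 := Finset.card_le_univ (S ∪ A ∪ B)
      rw [Finset.card_univ_sdiff]
      omega
    · intro u v huv hu hv
      have := hE u v huv hu hv
      simp; tauto
  obtain ⟨f, hf, hord⟩ := aux_order G w htw
  obtain ⟨S0, hS0, hS0l⟩ := aux_initial f hf (w + 1) (by omega)
  have hC0 : (S0ᶜ).card = Fintype.card V - (w + 1) := by rw [Finset.card_compl, hS0]
  have desc : ∀ K, K ≤ Fintype.card V - (w + 1) → _ := fun K hK =>
    aux_descent G w K f hf hord _ S0 S0ᶜ le_rfl hS0
    (fun s hs c hc => hS0l s hs c (by simpa using hc))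
    (fun u v _ _ => by by_cases h : v ∈ S0 <;> simp [h]) (by omega)
  -- closedness of a union of pieces
  have clos : ∀ (S C : Finset V) (A : Finset V), A ⊆ C →
      (∀ u v, G.Adj u v → u ∈ C → v ∈ C ∨ v ∈ S) →
      (∀ u ∈ C, ∀ v ∈ C, G.Adj u v → (u ∈ A ↔ v ∈ A)) →
      ∀ u v, G.Adj u v → u ∉ S → v ∉ S → (u ∈ A ↔ v ∈ A) := by
    intro S C A hAC hadj hA u v huv hu hv
    have h1 := hadj u v huv
    have h2 := hadj v u huv.symm
    by_cases huC : u ∈ C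
    · exact hA u huC v ((h1 huC).resolve_right hv) huv
    · have hvC : v ∉ C := fun h => huC ((h2 h).resolve_right hu)
      exact ⟨fun h => absurd (hAC h) huC, fun h => absurd (hAC h) hvC⟩
  obtain ⟨k, hk⟩ : ∃ k, k = Fintype.card V - w - 1 - M := ⟨_, rfl⟩
  by_cases hMk : M ≤ k
  · obtain ⟨S, C, Q, g, hS, hSC, hadj, hMC, hg, hsmall⟩ := desc M (by omega)
    obtain ⟨A, B, hAC, hBC, hAB, hA, hB, -, hs, hcl⟩ := aux_greedy C g M M hsmall hsmall hMC
    -- wlog the first is larger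
    obtain ⟨A, B, hAC, hBC, hAB, hA, hB, hs, hcl, hBA⟩ : ∃ A B : Finset V, A ⊆ C ∧ B ⊆ C ∧
        Disjoint A B ∧ A.card ≤ M ∧ B.card ≤ M ∧ M ≤ A.card + B.card ∧
        (∀ u ∈ C, ∀ v ∈ C, g u = g v → (u ∈ A ↔ v ∈ A) ∧ (u ∈ B ↔ v ∈ B)) ∧
        B.card ≤ A.card := by
      rcases le_total B.card A.card with h | h
      · exact ⟨A, B, hAC, hBC, hAB, hA, hB, hs, hcl, h⟩
      · exact ⟨B, A, hBC, hAC, hAB.symm, hB, hA, by omega,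
          fun u hu v hv h => (hcl u hu v hv h).symm, h⟩
    have hSA := Finset.disjoint_of_subset_right hAC hSC
    have hSB := Finset.disjoint_of_subset_right hBC hSC
    obtain ⟨Z, hAZ, hBZ, hU, hc, -, hE⟩ := key2 S A B hS hSA hSB hAB
      (fun u v huv hu hv => ⟨
        clos S C A hAC hadj (fun u hu v hv h => (hcl u hu v hv (hg u v h hu hv)).1) u v huv hu hv,
        clos S C B hBC hadj (fun u hu v hv h => (hcl u hu v hv (hg u v h hu hv)).2) u v huv hu hv⟩)
    refine key S Z B A hS hBZ.symm hAZ.symm hAB.symm ?_ ?_ (by omega) (by omega) (by omega)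
      (by omega)
    · rw [← hU]; ext v; simp; tauto
    · intro u v huv hu hv
      have := hE u v huv hu hv
      tauto
  · obtain ⟨S, C, Q, g, hS, hSC, hadj, hMC, hg, hsmall⟩ := desc k (by omega)
    -- finishing from a greedy choice
    have fin : ∀ A B : Finset V, Disjoint S A → Disjoint S B → Disjoint A B → A.card ≤ k →
        B.card ≤ k → k ≤ A.card + B.card →
        (∀ u v, G.Adj u v → u ∉ S → v ∉ S → (u ∈ A ↔ v ∈ A) ∧ (u ∈ B ↔ v ∈ B)) →
        m ≤ (Finset.univ \ (S ∪ A ∪ B)).card →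
      ∃ (S G1 G2 G3 : Finset V), S.card = w + 1 ∧
      Disjoint G1 G2 ∧ Disjoint G1 G3 ∧ Disjoint G2 G3 ∧
      G1 ∪ G2 ∪ G3 = Finset.univ \ S ∧
      (∀ u v : V, G.Adj u v →
        ¬(u ∈ G1 ∧ v ∈ G2) ∧ ¬(u ∈ G1 ∧ v ∈ G3) ∧ ¬(u ∈ G2 ∧ v ∈ G3)) ∧
      m ≤ G3.card ∧ G3.card ≤ M ∧
      G1.card ≤ Fintype.card V - w - 1 - M ∧
      G2.card ≤ G1.card := by
      intro A B hSA hSB hAB hA hB hs hcl hm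
      obtain ⟨Z, hAZ, hBZ, hU, hc, hZ, hE⟩ := key2 S A B hS hSA hSB hAB hcl
      rw [← hZ] at hm
      exact key S A B Z hS hAB hAZ hBZ hU hE hm (by omega) (by omega) (by omega)
    have fromC : ∀ L, (∀ a ∈ C, ∀ D : Finset V, (∀ d ∈ D, d ∈ C ∧ g d = g a) → D.card ≤ L) →
        (∀ A B : Finset V, A ⊆ C → B ⊆ C → Disjoint A B → A.card ≤ k → B.card ≤ L →
          m ≤ (Finset.univ \ (S ∪ A ∪ B)).card) →
      ∃ (S G1 G2 G3 : Finset V), S.card = w + 1 ∧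
      Disjoint G1 G2 ∧ Disjoint G1 G3 ∧ Disjoint G2 G3 ∧
      G1 ∪ G2 ∪ G3 = Finset.univ \ S ∧
      (∀ u v : V, G.Adj u v →
        ¬(u ∈ G1 ∧ v ∈ G2) ∧ ¬(u ∈ G1 ∧ v ∈ G3) ∧ ¬(u ∈ G2 ∧ v ∈ G3)) ∧
      m ≤ G3.card ∧ G3.card ≤ M ∧
      G1.card ≤ Fintype.card V - w - 1 - M ∧
      G2.card ≤ G1.card := by
      intro L hL hm
      obtain ⟨A, B, hAC, hBC, hAB, hA, hB, hBL, hs, hcl⟩ := aux_greedy C g k L hsmall hL hMC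
      exact fin A B (Finset.disjoint_of_subset_right hAC hSC)
        (Finset.disjoint_of_subset_right hBC hSC) hAB hA hB hs
        (fun u v huv hu hv => ⟨
        clos S C A hAC hadj (fun u hu v hv h => (hcl u hu v hv (hg u v h hu hv)).1) u v huv hu hv,
        clos S C B hBC hadj (fun u hu v hv h => (hcl u hu v hv (hg u v h hu hv)).2) u v huv hu hv⟩)
        (hm A B hAC hBC hAB hA hBL)
    by_cases hL : ∀ a ∈ C, ∀ D : Finset V, (∀ d ∈ D, d ∈ C ∧ g d = g a) → D.card ≤ M - m
    · refine fromC (M - m) hL ?_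
      intro A B _ _ _ hA hB
      have h1 := Finset.card_union_le (S ∪ A) B
      have h2 := Finset.card_union_le S A
      rw [Finset.card_univ_sdiff]
      omega
    push Not at hL
    obtain ⟨a, ha, D0, hD0, hD0c⟩ := hL
    let U := Finset.univ \ (S ∪ C)
    by_cases hUk : U.card ≤ k
    · let D := C.filter fun v => g v = g a
      have hDC : D ⊆ C := Finset.filter_subset _ _
      have hD0D : D0 ⊆ D := fun d hd => Finset.mem_filter.mpr (hD0 d hd)
      have hDc := Finset.card_le_card hD0D
      have hDk : D.card ≤ k := hsmall a ha D fun d hd => Finset.mem_filter.mp hd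
      let C' := Finset.univ \ (S ∪ D)
      let g' : V → Option Q := fun v => if v ∈ C then some (g v) else none
      have hsmall' : ∀ a ∈ C', ∀ E : Finset V, (∀ d ∈ E, d ∈ C' ∧ g' d = g' a) → E.card ≤ k := by
        intro b hb E hE
        by_cases hbC : b ∈ C
        · refine hsmall b hbC E fun d hd => ?_
          have := (hE d hd).2
          by_cases hdC : d ∈ C
          · simpa [g', hdC, hbC] using this
          · simp [g', hdC, hbC] at this
        · refine (Finset.card_le_card fun d hd => ?_).trans hUk
          have h1 := hE d hd
          have hdC : d ∉ C := by
            intro hdC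
            simp [g', hdC, hbC] at h1
          have h2 := h1.1
          simp only [C', U, Finset.mem_sdiff, Finset.mem_univ, true_and, Finset.mem_union] at h2 ⊢
          tauto
      have hC' : k ≤ C'.card := by
        have h1 := Finset.card_union_le S D
        have : C'.card = Fintype.card V - (S ∪ D).card := Finset.card_univ_sdiff _
        omega
      obtain ⟨A, B, hAC, hBC, hAB, hA, hB, -, hs, hcl⟩ :=
        aux_greedy C' g' k k hsmall' hsmall' hC'
      have hSC' : Disjoint S C' := by
        rw [Finset.disjoint_left]; intro v; simp [C']; tauto
      have hstep : ∀ u v, G.Adj u v → u ∉ S → v ∉ S → (u ∈ C ↔ v ∈ C) := by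
        intro u v huv hu hv
        exact ⟨fun h => (hadj u v huv h).resolve_right hv,
          fun h => (hadj v u huv.symm h).resolve_right hu⟩
      have hg' : ∀ u v, G.Adj u v → u ∉ S → v ∉ S → g' u = g' v := by
        intro u v huv hu hv
        have h := hstep u v huv hu hv
        by_cases huC : u ∈ C
        · simp [g', huC, h.mp huC, hg u v huv huC (h.mp huC)]
        · have hvC : v ∉ C := fun h' => huC (h.mpr h')
          simp [g', huC, hvC]
      have hadj' : ∀ u v, G.Adj u v → u ∈ C' → v ∈ C' ∨ v ∈ S := by
        intro u v huv hu
        by_cases hv : v ∈ S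
        · exact Or.inr hv
        left
        simp only [C', D, Finset.mem_sdiff, Finset.mem_univ, true_and, Finset.mem_union,
          Finset.mem_filter, not_or] at hu ⊢
        refine ⟨hv, fun h => hu.2 ?_⟩
        have huC := (hstep u v huv hu.1 hv).mpr h.1
        exact ⟨huC, (hg u v huv huC h.1).trans h.2⟩
      have hnS : ∀ u ∈ C', u ∉ S := fun u hu hS => Finset.disjoint_left.mp hSC' hS hu
      refine fin A B (Finset.disjoint_of_subset_right hAC hSC')
        (Finset.disjoint_of_subset_right hBC hSC') hAB hA hB hs
        (fun u v huv hu hv => ⟨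
        clos S C' A hAC hadj' (fun u hu v hv h =>
          (hcl u hu v hv (hg' u v h (hnS u hu) (hnS v hv))).1) u v huv hu hv,
        clos S C' B hBC hadj' (fun u hu v hv h =>
          (hcl u hu v hv (hg' u v h (hnS u hu) (hnS v hv))).2) u v huv hu hv⟩) ?_
      have : D ⊆ Finset.univ \ (S ∪ A ∪ B) := by
        intro d hd
        have h1 : d ∉ C' := by simp [C', hd]
        have h2 : d ∉ S := fun h => Finset.disjoint_left.mp hSC h (hDC hd)
        have h3 : d ∉ A := fun h => h1 (hAC h)
        have h4 : d ∉ B := fun h => h1 (hBC h)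
        simp [h2, h3, h4]
      have := Finset.card_le_card this
      omega
    · refine fromC k hsmall ?_
      intro A B hAC hBC _ _ _
      have hsub : U ⊆ Finset.univ \ (S ∪ A ∪ B) := by
        intro d hd
        simp only [U, Finset.mem_sdiff, Finset.mem_univ, true_and, Finset.mem_union] at hd ⊢
        rintro ((h | h) | h)
        · exact hd (Or.inl h)
        · exact hd (Or.inr (hAC h))
        · exact hd (Or.inr (hBC h))
      have h1 := Finset.card_le_card hsub
      have h2 := hsmall a ha D0 hD0
      omega
end
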